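/- arXiv:2003.06178 — 2 statements merged into one kernel-verified Lean document; each statement's English description precedes it below -/
import Mathlib

section
/- Let D be a rooted digraph and F a vertex-flame in D. Then there exists an F-quasi-flame Z with F ⊆ Z ⊆ D such that every spanning subdigraph L ⊆ Z that is Z-large is also D-large. -/
/-!  Common framework: digraphs as edge sets on a vertex type, directed paths,
path-systems, separations, flames and largeness. -/

universe u

variable {V : Type u}

/-- A directed path in the digraph on `V` with edge set `E`, given by its
(nonempty, repetition-free) list of vertices `start :: rest`. -/
structure Dipath (E : Set (V × V)) : Type u where
  start : V
  rest : List V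
  chain : List.Chain (fun a b => (a, b) ∈ E) start rest
  nodup : (start :: rest).Nodup

namespace Dipath

variable {E : Set (V × V)}

/-- The list of vertices of the path. -/
def verts (p : Dipath E) : List V := p.start :: p.rest

/-- The terminal vertex of the path. -/
def last (p : Dipath E) : V := (p.start :: p.rest).getLast (List.cons_ne_nil _ _)

/-- The set of vertices of the path. -/
def support (p : Dipath E) : Set V := {v | v ∈ p.verts}

/-- The internal vertices of the path (all vertices except the first and the last). -/
def internal (p : Dipath E) : Set V := {v | v ∈ p.rest.dropLast}

/-- The list of (directed) edges of the path. -/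
def edges (p : Dipath E) : List (V × V) := p.verts.zip p.rest

/-- The set of edges of the path. -/
def edgeSet (p : Dipath E) : Set (V × V) := {e | e ∈ p.edges}

/-- The last edge of the path, if the path has at least one edge. -/
def lastEdge? (p : Dipath E) : Option (V × V) := p.edges.getLast?

end Dipath

section Defs

variable (E : Set (V × V))

/-- The set of ingoing edges of `v`. -/
def inEdges (v : V) : Set (V × V) := {e ∈ E | e.2 = v}

/-- The set of initial vertices of a set of paths. -/
def initVerts {E : Set (V × V)} (P : Set (Dipath E)) : Set V := Dipath.start '' P

/-- The set of terminal vertices of a set of paths. -/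
def termVerts {E : Set (V × V)} (P : Set (Dipath E)) : Set V := Dipath.last '' P

/-- The set of terminal edges of a set of paths. -/
def termEdges {E : Set (V × V)} (P : Set (Dipath E)) : Set (V × V) :=
  {e | ∃ p ∈ P, p.lastEdge? = some e}

/-- An `(r,v)`-path-system: a set of pairwise internally disjoint directed
paths from `r` to `v`. -/
def IsRVSystem (r v : V) (P : Set (Dipath E)) : Prop :=
  (∀ p ∈ P, p.start = r ∧ p.last = v) ∧
    P.Pairwise fun p q => p.support ∩ q.support ⊆ {r, v}

/-- An `(r,v)`-separation: a set of vertices avoiding `r` and `v` and meeting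
every directed path from `r` to `v`. -/
def IsSeparation (r v : V) (S : Set V) : Prop :=
  r ∉ S ∧ v ∉ S ∧ ∀ p : Dipath E, p.start = r → p.last = v → (p.support ∩ S).Nonempty

/-- A set of paths `P` and a vertex set `S` are orthogonal:  every path of `P`
meets `S` in exactly one vertex and every vertex of `S` lies on a path of `P`. -/
def Orthogonal {E : Set (V × V)} (P : Set (Dipath E)) (S : Set V) : Prop :=
  (∀ p ∈ P, ∃! x, x ∈ p.support ∩ S) ∧ ∀ x ∈ S, ∃ p ∈ P, x ∈ p.support

/-- An Erdős–Menger `(r,v)`-path-system: one orthogonal to some `(r,v)`-separation. -/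
def IsEMSystem (r v : V) (P : Set (Dipath E)) : Prop :=
  IsRVSystem E r v P ∧ ∃ S, IsSeparation E r v S ∧ Orthogonal P S

/-- An Erdős–Menger `(r,v)`-separation: one orthogonal to some `(r,v)`-path-system. -/
def IsEMSeparation (r v : V) (S : Set V) : Prop :=
  IsSeparation E r v S ∧ ∃ P : Set (Dipath E), IsRVSystem E r v P ∧ Orthogonal P S

/-- `𝒢_E(v)` (with root `r`): the collection of edge sets `I` that arise as the set of
terminal edges of an internally disjoint `(r,v)`-path-system in `E`. -/
def GSet (r v : V) : Set (Set (V × V)) :=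
  {I | ∃ P : Set (Dipath E), IsRVSystem E r v P ∧ termEdges P = I}

/-- A vertex-flame (with root `r`): for every `v ≠ r`, the whole in-edge set of `v`
is the terminal edge set of an internally disjoint `(r,v)`-path-system. -/
def IsFlame (r : V) : Prop := ∀ v, v ≠ r → inEdges E v ∈ GSet E r v

/-- `L` is `v`-large with respect to the digraph `E` rooted at `r`: `L` contains `rv`
whenever `E` does, and some Erdős–Menger `(r,v)`-path-system of `E - rv` lies in `L`. -/
def VLarge (r : V) (L : Set (V × V)) (v : V) : Prop :=
  ((r, v) ∈ E → (r, v) ∈ L) ∧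
    ∃ P : Set (Dipath (E \ {(r, v)})),
      IsEMSystem (E \ {(r, v)}) r v P ∧ ∀ p ∈ P, p.edgeSet ⊆ L

/-- `L` is large with respect to the digraph `E` rooted at `r`. -/
def Large (r : V) (L : Set (V × V)) : Prop := ∀ v, v ≠ r → VLarge E r L v

/-- An `(X,Y)`-path: from `X` to `Y`, internally disjoint from `X ∪ Y`. -/
def IsXYPath (X Y : Set V) (p : Dipath E) : Prop :=
  p.start ∈ X ∧ p.last ∈ Y ∧ ∀ w ∈ p.internal, w ∉ X ∪ Y

/-- An `(X,Y)`-path-system: pairwise disjoint `(X,Y)`-paths. -/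
def IsXYSystem (X Y : Set V) (P : Set (Dipath E)) : Prop :=
  (∀ p ∈ P, IsXYPath E X Y p) ∧ P.Pairwise fun p q => Disjoint p.support q.support

/-- `X` is joinable to `Y`: some `(X,Y)`-path-system covers `X` with its initial vertices. -/
def Joinable (X Y : Set V) : Prop :=
  ∃ P : Set (Dipath E), IsXYSystem E X Y P ∧ initVerts P = X

/-- `X` is incompressible to `Y`: `X` is joinable to `Y` and every witnessing
path-system covers `Y` with its terminal vertices. -/
def Incompressible (X Y : Set V) : Prop :=
  Joinable E X Y ∧
    ∀ P : Set (Dipath E), IsXYSystem E X Y P → initVerts P = X → termVerts P = Y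

/-- An `(X,Y)`-separation: a vertex set meeting every `(X,Y)`-path. -/
def IsXYSeparation (X Y : Set V) (S : Set V) : Prop :=
  ∀ p : Dipath E, IsXYPath E X Y p → (p.support ∩ S).Nonempty

/-- An Erdős–Menger `(X,Y)`-separation: one orthogonal to some `(X,Y)`-path-system. -/
def IsEMXYSeparation (X Y : Set V) (S : Set V) : Prop :=
  IsXYSeparation E X Y S ∧ ∃ P : Set (Dipath E), IsXYSystem E X Y P ∧ Orthogonal P S

/-- `X'` is `(X,Y)`-finitely extendable: every `O` with `X' ⊆ O ⊆ X` and `O \ X'`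
finite is joinable to `Y`. -/
def FinExtendable (X Y X' : Set V) : Prop :=
  X' ⊆ X ∧ ∀ O, X' ⊆ O → O ⊆ X → (O \ X').Finite → Joinable E O Y

/-- `S` separates the vertex `y` from `r`:  every directed path from `r` to `y` meets `S`. -/
def SeparatesFrom (r : V) (S : Set V) (y : V) : Prop :=
  ∀ p : Dipath E, p.start = r → p.last = y → (p.support ∩ S).Nonempty

/-- An `(X,y)`-path: from a vertex of `X` to `y`, internally disjoint from `X`. -/
def IsXyPath (X : Set V) (y : V) (p : Dipath E) : Prop :=
  p.start ∈ X ∧ p.last = y ∧ ∀ w ∈ p.internal, w ∉ X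

/-- An `(X,y)`-path-system: `(X,y)`-paths, pairwise disjoint except possibly at `y`. -/
def IsXySystem (X : Set V) (y : V) (P : Set (Dipath E)) : Prop :=
  (∀ p ∈ P, IsXyPath E X y p) ∧ P.Pairwise fun p q => p.support ∩ q.support ⊆ {y}

/-- An `(r,S)`-path: from `r` to a vertex of `S`, internally disjoint from `S`. -/
def IsRSPath (r : V) (S : Set V) (p : Dipath E) : Prop :=
  p.start = r ∧ p.last ∈ S ∧ ∀ w ∈ p.internal, w ∉ S

/-- An `(r,S)`-path-system: `(r,S)`-paths, pairwise disjoint apart from `r`. -/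
def IsRSSystem (r : V) (S : Set V) (P : Set (Dipath E)) : Prop :=
  (∀ p ∈ P, IsRSPath E r S p) ∧ P.Pairwise fun p q => p.support ∩ q.support ⊆ {r}

/-- `E` is a `G`-quasi-flame (with root `r`): for every `v ≠ r`, every set `I` of
ingoing edges of `v` with `I \ inEdges G v` finite lies in `𝒢_E(v)`. -/
def QuasiFlame (r : V) (G : Set (V × V)) : Prop :=
  ∀ v, v ≠ r → ∀ I, I ⊆ inEdges E v → (I \ inEdges G v).Finite → I ∈ GSet E r v

/-- The local connectivity `κ_E(r,v)`: the maximum size of an internally disjoint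
`(r,v)`-path-system. -/
noncomputable def kappa (r v : V) : ℕ :=
  sSup {n | ∃ P : Set (Dipath E), IsRVSystem E r v P ∧ P.Finite ∧ P.ncard = n}

end Defs

namespace QF

theorem lt_of_succ {l : List V} {i : ℕ} {z : V} (h : l[i+1]? = some z) : i < l.length := by
  have := (List.getElem?_eq_some_iff.1 h).1
  omega

theorem getElem?_self {l : List V} {i : ℕ} (h : i < l.length) : l[i]? = some l[i] :=
  List.getElem?_eq_getElem h

/-- `l` is the vertex list of a directed path from `a` to `b`. -/
structure LPath (E : Set (V × V)) (a b : V) (l : List V) : Prop where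
  chain : ∀ i u w, l[i]? = some u → l[i+1]? = some w → (u, w) ∈ E
  nodup : l.Nodup
  hd : l[0]? = some a
  lst : l.getLast? = some b

theorem LPath.inj {E : Set (V × V)} {a b : V} {l : List V} (h : LPath E a b l) {i j : ℕ} {u : V}
    (hi : l[i]? = some u) (hj : l[j]? = some u) : i = j := by
  have := (List.getElem?_inj (i := i) (j := j) (by grind) h.nodup).1 (hi.trans hj.symm)
  exact this

theorem LPath.mono {E E' : Set (V × V)} (hE : E ⊆ E') {a b : V} {l : List V} (h : LPath E a b l) :
    LPath E' a b l := ⟨fun i u w h1 h2 => hE (h.chain i u w h1 h2), h.nodup, h.hd, h.lst⟩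

theorem lpath_of_dipath {E : Set (V × V)} (p : Dipath E) : LPath E p.start p.last p.verts := by
  obtain ⟨s, l, hc, hn⟩ := p
  refine ⟨?_, hn, rfl, ?_⟩
  · have hc' : List.IsChain (fun a b => (a, b) ∈ E) (s :: l) := hc
    rw [List.isChain_iff_getElem] at hc'
    intro i u w h1 h2
    change (s :: l)[i]? = some u at h1
    change (s :: l)[i+1]? = some w at h2
    obtain ⟨h1', rfl⟩ := List.getElem?_eq_some_iff.1 h1
    obtain ⟨h2', rfl⟩ := List.getElem?_eq_some_iff.1 h2
    exact hc' i h2'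
  · exact List.getLast?_eq_getLast_of_ne_nil (List.cons_ne_nil _ _)

theorem LPath.exists_dipath {E : Set (V × V)} {a b : V} {l : List V} (h : LPath E a b l) :
    ∃ p : Dipath E, p.verts = l ∧ p.start = a ∧ p.last = b := by
  cases l with
  | nil => exact absurd h.hd (by simp)
  | cons s l =>
    have h1 := h.hd
    simp at h1
    subst h1
    refine ⟨⟨s, l, ?_, h.nodup⟩, rfl, rfl, ?_⟩
    · change List.IsChain (fun a b => (a, b) ∈ E) (s :: l)
      rw [List.isChain_iff_getElem]
      intro i hi
      exact h.chain i _ _ (by grind) (by grind)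
    · have := h.lst
      rw [List.getLast?_eq_getLast_of_ne_nil (List.cons_ne_nil _ _)] at this
      simpa [Dipath.last] using this

theorem edges_eq {E : Set (V × V)} (p : Dipath E) : p.edges = p.verts.zip p.verts.tail := rfl

theorem zip_tail_append (l : List V) (a b : V) :
    (l ++ [a, b]).zip (l ++ [a, b]).tail = (l ++ [a]).zip (l ++ [a]).tail ++ [(a, b)] := by
  induction l with
  | nil => simp
  | cons c l ih =>
    cases l with
    | nil => simp
    | cons d l => simpa using ih

theorem lastEdge_iff {E : Set (V × V)} (p : Dipath E) (e : V × V) :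
    p.lastEdge? = some e ↔ ∃ l', p.verts = l' ++ [e.1, e.2] := by
  unfold Dipath.lastEdge?
  rw [edges_eq]
  generalize p.verts = l
  rcases List.eq_nil_or_concat l with rfl | ⟨l, b, rfl⟩
  · simp
  · rcases List.eq_nil_or_concat l with rfl | ⟨l, a, rfl⟩
    · simp only [List.concat_eq_append, List.nil_append, List.tail_cons, List.zip_nil_right,
        List.getLast?_nil, reduceCtorEq, false_iff, not_exists]
      intro x hx
      have := congrArg List.length hx
      simp at this
    · have : l ++ [a] ++ [b] = l ++ [a, b] := by simp
      simp only [List.concat_eq_append]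
      rw [this, zip_tail_append]
      obtain ⟨e1, e2⟩ := e
      simp only [List.getLast?_append, List.getLast?_singleton, Option.some_or, Option.some.injEq,
        Prod.mk.injEq]
      constructor
      · rintro ⟨rfl, rfl⟩
        exact ⟨l, rfl⟩
      · rintro ⟨l', h⟩
        have := congrArg List.reverse h
        simp at this
        exact ⟨this.2.1, this.1⟩

/-- List version of `GSet`. -/
theorem mem_GSet_iff {E : Set (V × V)} {r v : V} {I : Set (V × V)} :
    I ∈ GSet E r v ↔ ∃ Q : Set (List V), (∀ l ∈ Q, LPath E r v l) ∧
      (∀ l ∈ Q, ∀ m ∈ Q, l ≠ m → ∀ a ∈ l, a ∈ m → a = r ∨ a = v) ∧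
      (∀ e, e ∈ I ↔ ∃ l ∈ Q, ∃ l', l = l' ++ [e.1, e.2]) := by
  constructor
  · rintro ⟨P, ⟨hP1, hP2⟩, rfl⟩
    refine ⟨Dipath.verts '' P, ?_, ?_, ?_⟩
    · rintro _ ⟨p, hp, rfl⟩
      have := lpath_of_dipath p
      rwa [(hP1 p hp).1, (hP1 p hp).2] at this
    · rintro _ ⟨p, hp, rfl⟩ _ ⟨q, hq, rfl⟩ hne a ha hb
      have := hP2 hp hq (fun h => hne (by rw [h])) (⟨ha, hb⟩ : a ∈ p.support ∩ q.support)
      simpa using this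
    · intro e
      simp only [termEdges, lastEdge_iff, Set.mem_setOf_eq]
      constructor
      · rintro ⟨p, hp, l', hl⟩
        exact ⟨_, ⟨p, hp, rfl⟩, l', hl⟩
      · rintro ⟨_, ⟨p, hp, rfl⟩, l', hl⟩
        exact ⟨p, hp, l', hl⟩
  · rintro ⟨Q, h1, h2, h3⟩
    refine ⟨{p | p.verts ∈ Q}, ⟨?_, ?_⟩, ?_⟩
    · intro p hp
      have hp' := h1 _ hp
      have hq := lpath_of_dipath p
      refine ⟨?_, ?_⟩
      · have := hp'.hd.symm.trans hq.hd; simpa using this.symm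
      · have := hp'.lst.symm.trans hq.lst; simpa using this.symm
    · intro p hp q hq hne a ⟨ha, hb⟩
      have := h2 _ hp _ hq (by
        intro h
        apply hne
        obtain ⟨s, l, _, _⟩ := p
        obtain ⟨s', l', _, _⟩ := q
        simp only [Dipath.verts, List.cons.injEq] at h
        obtain ⟨rfl, rfl⟩ := h
        rfl) a ha hb
      simpa using this
    · ext e
      rw [h3 e]
      simp only [termEdges, lastEdge_iff, Set.mem_setOf_eq]
      constructor
      · rintro ⟨p, hp, l', hl⟩
        exact ⟨_, hp, l', hl⟩
      · rintro ⟨l, hl, l', hl'⟩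
        obtain ⟨p, hp, -⟩ := (h1 l hl).exists_dipath
        exact ⟨p, by change p.verts ∈ Q; rw [hp]; exact hl, l', by rw [hp, hl']⟩

theorem GSet_mono {E E' : Set (V × V)} (hE : E ⊆ E') {r v : V} : GSet E r v ⊆ GSet E' r v := by
  intro I hI
  rw [mem_GSet_iff] at hI ⊢
  obtain ⟨Q, h1, h2, h3⟩ := hI
  exact ⟨Q, fun l hl => (h1 l hl).mono hE, h2, h3⟩

theorem GSet_subset {E : Set (V × V)} {r v : V} {I J : Set (V × V)} (hI : I ∈ GSet E r v)
    (hJ : J ⊆ I) : J ∈ GSet E r v := by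
  rw [mem_GSet_iff] at hI ⊢
  obtain ⟨Q, h1, h2, h3⟩ := hI
  refine ⟨{l ∈ Q | ∃ e ∈ J, ∃ l', l = l' ++ [e.1, e.2]}, fun l hl => h1 l hl.1,
    fun l hl m hm => h2 l hl.1 m hm.1, fun e => ⟨fun he => ?_, ?_⟩⟩
  · obtain ⟨l, hl, l', hl'⟩ := (h3 e).1 (hJ he)
    exact ⟨l, ⟨hl, e, he, l', hl'⟩, l', hl'⟩
  · rintro ⟨l, ⟨hl, e', he', m, hm⟩, l', hl'⟩
    have := congrArg List.reverse (hl'.symm.trans hm)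
    simp at this
    have : e = e' := Prod.ext this.2.1 this.1
    rwa [this]

/-- From reachability to a repetition-free chain. -/
theorem exists_nodup_chain {rel : V → V → Prop} {a b : V} (h : Relation.ReflTransGen rel a b) :
    ∃ l : List V, (∀ i u w, l[i]? = some u → l[i+1]? = some w → rel u w) ∧ l.Nodup ∧
      l[0]? = some a ∧ l.getLast? = some b := by
  induction h using Relation.ReflTransGen.head_induction_on with
  | refl => exact ⟨[b], by simp, by simp, by simp, by simp⟩
  | head hac _ ih =>
    rename_i a c _
    obtain ⟨l, h1, h2, h3, h4⟩ := ih
    by_cases ha : a ∈ l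
    · obtain ⟨s, t, rfl⟩ := List.append_of_mem ha
      refine ⟨a :: t, ?_, ?_, by simp, ?_⟩
      · intro i u w hu hw
        refine h1 (s.length + i) u w ?_ ?_
        · rw [List.getElem?_append_right (by omega)]
          simpa using hu
        · rw [List.getElem?_append_right (by omega), ← hw]
          congr 1
          omega
      · exact (List.nodup_append.1 h2).2.1
      · simpa [List.getLast?_append] using h4
    · refine ⟨a :: l, ?_, by simp [ha, h2], by simp, ?_⟩
      · intro i u w hu hw
        cases i with
        | zero =>
          simp at hu hw
          grind
        | succ i => exact h1 i u w (by simpa using hu) (by simpa using hw)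
      · cases l with
        | nil => simp at h3
        | cons x l => simpa using h4

/-- Vertices reachable from `r` avoiding `S`. -/
def Rch (E : Set (V × V)) (r : V) (S : Set V) : Set V :=
  {w | Relation.ReflTransGen (fun a b => (a, b) ∈ E ∧ b ∉ S) r w}

theorem Rch_root {E : Set (V × V)} {r : V} {S : Set V} : r ∈ Rch E r S := Relation.ReflTransGen.refl

theorem Rch_step {E : Set (V × V)} {r : V} {S : Set V} {a b : V} (ha : a ∈ Rch E r S)
    (hE : (a, b) ∈ E) (hb : b ∉ S) : b ∈ Rch E r S :=
  Relation.ReflTransGen.tail ha ⟨hE, hb⟩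

theorem Rch_ind {E : Set (V × V)} {r : V} {S : Set V} {p : V → Prop} (h0 : p r)
    (h1 : ∀ a b, a ∈ Rch E r S → p a → (a, b) ∈ E → b ∉ S → p b) {w : V} (hw : w ∈ Rch E r S) :
    p w := by
  induction hw with
  | refl => exact h0
  | tail hab hbc ih => exact h1 _ _ hab ih hbc.1 hbc.2

theorem Rch_notMem {E : Set (V × V)} {r : V} {S : Set V} (hr : r ∉ S) {w : V}
    (hw : w ∈ Rch E r S) : w ∉ S := Rch_ind (p := fun w => w ∉ S) hr (fun _ _ _ _ _ h => h) hw

/-- Follow a path from a reachable vertex. -/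
theorem Rch_follow {E : Set (V × V)} {r a b : V} {S : Set V} {l : List V} (hl : LPath E a b l)
    {i j : ℕ} (hij : i ≤ j) {u w : V} (hu : l[i]? = some u) (hw : l[j]? = some w)
    (huR : u ∈ Rch E r S) (hS : ∀ k, i < k → k ≤ j → ∀ z, l[k]? = some z → z ∉ S) :
    w ∈ Rch E r S := by
  induction j, hij using Nat.le_induction generalizing w with
  | base => grind
  | succ j hij ih =>
    have hj : j < l.length := by grind
    have h1 := ih (w := l[j]) (by grind) (fun k hk hk' => hS k hk (by omega))
    exact Rch_step h1 (hl.chain j _ _ (by grind) hw) (hS (j+1) (by omega) le_rfl _ hw)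

theorem isSeparation_iff {E : Set (V × V)} {r v : V} {S : Set V} :
    IsSeparation E r v S ↔ r ∉ S ∧ v ∉ S ∧ v ∉ Rch E r S := by
  unfold IsSeparation
  refine and_congr_right fun hr => and_congr_right fun hv => ?_
  constructor
  · intro h hvR
    obtain ⟨l, h1, h2, h3, h4⟩ := exists_nodup_chain hvR
    obtain ⟨p, hp1, hp2, hp3⟩ :=
      LPath.exists_dipath (⟨fun i u w hu hw => (h1 i u w hu hw).1, h2, h3, h4⟩ : LPath E r v l)
    obtain ⟨z, hz1, hz2⟩ := h p hp2 hp3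
    have hz : z ∈ l := by rw [← hp1]; exact hz1
    obtain ⟨i, hi⟩ := List.mem_iff_getElem?.1 hz
    cases i with
    | zero => rw [h3] at hi; simp at hi; exact hr (hi ▸ hz2)
    | succ i => exact (h1 i (l[i]'(lt_of_succ hi)) z (getElem?_self _) hi).2 hz2
  · intro h p hp1 hp2
    by_contra hne
    apply h
    have hp := lpath_of_dipath p
    have hl : p.verts[p.verts.length - 1]? = some v := by
      rw [← hp2, ← hp.lst, List.getLast?_eq_getElem?]
    refine Rch_follow hp (Nat.zero_le _) (hp.hd) hl (hp1 ▸ Rch_root) ?_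
    intro k _ _ z hz hzS
    exact hne ⟨z, List.mem_iff_getElem?.2 ⟨k, hz⟩, hzS⟩


/-- Augmentation along a repetition-free alternating chain. -/
theorem augment (f : V → V) (N : V → V → Prop) (r : V) (hfr : f r = r)
    (hinj : ∀ a b, f a = f b → f a ≠ r → a = b) (l : List V) :
    ∀ u, (∀ i a b, l[i]? = some a → l[i+1]? = some b → ∃ w, f w = a ∧ N w b) → l.Nodup →
      l[0]? = some u → l.getLast? = some r →
    ∃ f' : V → V, (∀ w, f' w ≠ f w → f w ∈ l) ∧ (∀ w, f' w = f w ∨ N w (f' w)) ∧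
      (u ≠ r → ∀ w, f' w ≠ u) ∧ (∀ a b, f' a = f' b → f' a ≠ r → a = b) ∧
      {w | f' w ≠ f w}.Finite ∧ (∀ w, f' w = r ∨ ∃ w', f' w = f w') ∧
      (u = r ∨ ∃ w, f w = u) ∧ f' r = r := by
  classical
  induction l with
  | nil => intro u _ _ h; simp at h
  | cons c l ih =>
    intro u hch hnd hhd hlast
    simp only [List.getElem?_cons_zero, Option.some.injEq] at hhd
    subst hhd
    cases l with
    | nil =>
      simp only [List.getLast?_singleton, Option.some.injEq] at hlast
      subst hlast
      exact ⟨f, fun w h => absurd rfl h, fun w => Or.inl rfl, fun h => absurd rfl h, hinj,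
        by simp, fun w => Or.inr ⟨w, rfl⟩, Or.inl rfl, hfr⟩
    | cons d l =>
      have hnd' := (List.nodup_cons.1 hnd)
      have hlast' : (d :: l).getLast? = some r := by simpa using hlast
      obtain ⟨f', h1, h2, h3, h4, h5, h6, h7, h8⟩ := ih d
        (fun i a b ha hb => hch (i+1) a b (by simpa using ha) (by simpa using hb))
        hnd'.2 rfl hlast'
      obtain ⟨w0, hw0, hN⟩ := hch 0 c d (by simp) (by simp)
      have hcr : c ≠ r := by
        rintro rfl
        exact hnd'.1 (List.mem_of_getLast? hlast')
      have hcd : d ≠ c := by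
        rintro rfl
        exact hnd'.1 (by simp)
      have hf'0 : f' w0 = c := by
        by_contra hne
        have := h1 w0 (by rw [hw0]; exact hne)
        rw [hw0] at this
        exact hnd'.1 this
      have hw0r : w0 ≠ r := by
        rintro rfl
        exact hcr (hw0.symm.trans hfr)
      refine ⟨Function.update f' w0 d, ?_, ?_, ?_, ?_, ?_, ?_, Or.inr ⟨w0, hw0⟩, ?_⟩
      · intro w hw
        by_cases h : w = w0
        · subst h; rw [hw0]; simp
        · rw [Function.update_of_ne h] at hw
          exact List.mem_cons_of_mem _ (h1 w hw)
      · intro w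
        by_cases h : w = w0
        · subst h; right; simpa using hN
        · rw [Function.update_of_ne h]; exact h2 w
      · intro _ w
        by_cases h : w = w0
        · subst h; simpa using hcd
        · rw [Function.update_of_ne h]
          intro hc
          exact h (h4 w w0 (hc.trans hf'0.symm) (by rw [hc]; exact hcr))
      · intro a b hab hr
        by_cases ha : a = w0 <;> by_cases hb : b = w0
        · rw [ha, hb]
        · subst ha
          rw [Function.update_self, Function.update_of_ne hb] at hab
          rw [Function.update_self] at hr
          exact absurd hab.symm (h3 hr b)
        · subst hb
          rw [Function.update_self, Function.update_of_ne ha] at hab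
          rw [Function.update_of_ne ha] at hr
          exact absurd hab (h3 (hab ▸ hr) a)
        · rw [Function.update_of_ne ha, Function.update_of_ne hb] at hab
          rw [Function.update_of_ne ha] at hr
          exact h4 a b hab hr
      · refine (h5.insert w0).subset ?_
        intro w hw
        by_cases h : w = w0
        · exact Or.inl h
        · right
          simpa [Function.update_of_ne h] using hw
      · intro w
        by_cases h : w = w0
        · subst h
          rw [Function.update_self]
          rcases h7 with h7 | ⟨w', hw'⟩
          · exact Or.inl h7
          · exact Or.inr ⟨w', hw'.symm⟩
        · rw [Function.update_of_ne h]; exact h6 w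
      · rw [Function.update_of_ne hw0r.symm]; exact h8

theorem iter_root {f : V → V} {r : V} (hr : f r = r) (n : ℕ) : f^[n] r = r :=
  Function.iterate_fixed hr n

theorem iter_cancel {f : V → V} {r : V} (hr : f r = r)
    (hinj : ∀ a b, f a = f b → f a ≠ r → a = b) (n : ℕ) :
    ∀ a b, f^[n] a = f^[n] b → f^[n] a ≠ r → a = b := by
  induction n with
  | zero => intro a b h _; exact h
  | succ n ih =>
    intro a b h hne
    rw [Function.iterate_succ_apply, Function.iterate_succ_apply] at h
    rw [Function.iterate_succ_apply] at hne
    have h1 := ih _ _ h hne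
    refine hinj a b h1 ?_
    intro h2
    rw [h2, iter_root hr] at hne
    exact hne rfl

/-- Orbits of points outside the range that never hit `r` are injective. -/
theorem iter_inj {f : V → V} {r t : V} (hr : f r = r)
    (hinj : ∀ a b, f a = f b → f a ≠ r → a = b) (ht : ∀ w, f w ≠ t) {i j : ℕ}
    (h : f^[i] t = f^[j] t) (hne : f^[i] t ≠ r) : i = j := by
  wlog hij : i ≤ j generalizing i j
  · exact (this h.symm (h ▸ hne) (by omega)).symm
  obtain ⟨d, rfl⟩ := Nat.exists_eq_add_of_le hij
  rw [Function.iterate_add_apply] at h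
  have := iter_cancel hr hinj i _ _ h hne
  cases d with
  | zero => rfl
  | succ d =>
    rw [Function.iterate_succ_apply'] at this
    exact absurd this.symm (ht _)

theorem iter_reaches {f f' : V → V} {r t : V} (ρ : V → ℕ) (hr : f' r = r)
    (hinj : ∀ a b, f' a = f' b → f' a ≠ r → a = b) (hfin : {w | f' w ≠ f w}.Finite)
    (hρ : ∀ w, f w ≠ w → f w ≠ r → ρ (f w) < ρ w) (ht : ∀ w, f' w ≠ t) :
    ∃ n, f'^[n] t = r := by
  by_contra! hne
  have hI : Function.Injective (fun n => f'^[n] t) :=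
    fun i j h => iter_inj hr hinj ht h (hne i)
  have h1 : ((fun n => f'^[n] t) ⁻¹' {w | f' w ≠ f w}).Finite := hfin.preimage hI.injOn
  obtain ⟨M, hM⟩ := h1.bddAbove
  have h2 : ∀ k, ρ (f'^[M + 1 + k] t) + k ≤ ρ (f'^[M + 1] t) := by
    intro k
    induction k with
    | zero => simp
    | succ k ih =>
      have h3 : f' (f'^[M + 1 + k] t) = f (f'^[M + 1 + k] t) := by
        by_contra h
        have : M + 1 + k ≤ M := hM h
        omega
      have h4 : f'^[M + 1 + (k + 1)] t = f (f'^[M + 1 + k] t) := by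
        rw [← h3]
        exact Function.iterate_succ_apply' f' (M + 1 + k) t
      have h5 := hρ (f'^[M + 1 + k] t) (by
        intro h
        rw [← h4] at h
        have := hI h
        omega) (by rw [← h4]; exact hne _)
      rw [h4]
      omega
  have := h2 (ρ (f'^[M + 1] t) + 1)
  omega

/-- The orbit of `t` up to `r`, reversed, is a path from `r` to `t`. -/
theorem orbit_path {E : Set (V × V)} {f : V → V} {r t : V} (hr : f r = r)
    (hinj : ∀ a b, f a = f b → f a ≠ r → a = b) (ht : ∀ w, f w ≠ t)
    (hE : ∀ w, f w ≠ w → (f w, w) ∈ E) (hex : ∃ n, f^[n] t = r) :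
    ∃ l, LPath E r t l ∧ ∀ a ∈ l, ∃ k, f^[k] t = a := by
  classical
  let n := Nat.find hex
  have hn : f^[n] t = r := Nat.find_spec hex
  have hmin : ∀ m, m < n → f^[m] t ≠ r := fun m hm => Nat.find_min hex hm
  have hget : ∀ i a, ((List.range (n+1)).map (fun i => f^[n-i] t))[i]? = some a ↔
      i ≤ n ∧ f^[n-i] t = a := by
    intro i a
    rw [List.getElem?_map]
    by_cases h : i < n + 1
    · rw [List.getElem?_range h]
      simp
      omega
    · rw [List.getElem?_eq_none (by simpa using h)]
      simp
      omega
  refine ⟨(List.range (n+1)).map (fun i => f^[n-i] t), ⟨?_, ?_, ?_, ?_⟩, ?_⟩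
  · intro i u w hu hw
    obtain ⟨hi, rfl⟩ := (hget _ _).1 hu
    obtain ⟨hi', rfl⟩ := (hget _ _).1 hw
    have h1 : n - i = (n - (i+1)) + 1 := by omega
    rw [h1, Function.iterate_succ_apply']
    apply hE
    intro h2
    apply hmin (n - (i+1)) (by omega)
    rw [← hn]
    have h3 : n = (i + 1) + (n - (i+1)) := by omega
    conv_rhs => rw [h3, Function.iterate_add_apply]
    exact (Function.iterate_fixed h2 _).symm
  · refine List.Nodup.map_on ?_ List.nodup_range
    intro i hi j hj hij
    simp only [List.mem_range] at hi hj
    by_cases h : f^[n-i] t = r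
    · have h1 : ¬ (n - i < n) := fun h' => hmin _ h' h
      have h2 : ¬ (n - j < n) := fun h' => hmin _ h' (hij ▸ h)
      omega
    · have := iter_inj hr hinj ht hij h
      omega
  · exact (hget _ _).2 ⟨by omega, hn⟩
  · rw [List.getLast?_eq_getElem?]
    exact (hget _ _).2 ⟨by simp, by simp⟩
  · intro a ha
    obtain ⟨i, hi⟩ := List.mem_iff_getElem?.1 ha
    exact ⟨_, ((hget _ _).1 hi).2⟩


/-- List version of an `(r,v)`-path-system. -/
structure PSys (E : Set (V × V)) (r v : V) (P : Set (List V)) : Prop where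
  path : ∀ l ∈ P, LPath E r v l
  disj : ∀ l ∈ P, ∀ m ∈ P, l ≠ m → ∀ a ∈ l, a ∈ m → a = r ∨ a = v

/-- `S` is a separation orthogonal to `P`. -/
structure OSep (E : Set (V × V)) (r v : V) (P : Set (List V)) (S : Set V) : Prop where
  hr : r ∉ S
  hv : v ∉ S
  sep : v ∉ Rch E r S
  one : ∀ l ∈ P, ∃! x, x ∈ l ∧ x ∈ S
  cov : ∀ x ∈ S, ∃ l ∈ P, x ∈ l

theorem mem_of_get {l : List V} {i : ℕ} {a : V} (h : l[i]? = some a) : a ∈ l :=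
  List.mem_iff_getElem?.2 ⟨i, h⟩

theorem OSep.idx {E : Set (V × V)} {r v : V} {P : Set (List V)} {S : Set V} (hP : PSys E r v P)
    (h : OSep E r v P S) {l : List V} (hl : l ∈ P) : ∃ (k : ℕ) (s : V), l[k]? = some s ∧ s ∈ S ∧
      (∀ (i : ℕ) u, i < k → l[i]? = some u → u ∈ Rch E r S) ∧
      (∀ (i : ℕ) u, k < i → l[i]? = some u → u ∉ Rch E r S ∧ u ∉ S) := by
  obtain ⟨s, ⟨hs1, hs2⟩, hs3⟩ := h.one l hl
  obtain ⟨k, hk⟩ := List.mem_iff_getElem?.1 hs1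
  have hp := hP.path l hl
  have hS : ∀ (i : ℕ) u, l[i]? = some u → u ∈ S → i = k := by
    intro i u hu huS
    have : u = s := hs3 u ⟨mem_of_get hu, huS⟩
    subst this
    exact hp.inj hu hk
  refine ⟨k, s, hk, hs2, ?_, ?_⟩
  · intro i u hi hu
    refine Rch_follow hp (Nat.zero_le i) hp.hd hu Rch_root ?_
    intro j _ hj z hz hzS
    have := hS j z hz hzS
    omega
  · intro i u hi hu
    refine ⟨fun huR => ?_, fun huS => ?_⟩
    · apply h.sep
      have hlast : l[l.length - 1]? = some v := by rw [← hp.lst, List.getLast?_eq_getElem?]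
      have hil : i < l.length := (List.getElem?_eq_some_iff.1 hu).1
      refine Rch_follow hp (by omega) hu hlast huR ?_
      intro j hj _ z hz hzS
      have := hS j z hz hzS
      omega
    · have := hS i u hu huS
      omega

theorem link {E : Set (V × V)} {r v : V} {P : Set (List V)} {S : Set V} (hP : PSys E r v P)
    (hS : OSep E r v P S) {x : V} (hx : x ∈ Rch E r S) (hxr : x ≠ r) :
    (∃ W : V → List V, (∀ t, t ∈ S ∨ t = x → LPath E r t (W t) ∧
        ∀ a ∈ W t, a = t ∨ a ∈ Rch E r S) ∧
      ∀ t t', (t ∈ S ∨ t = x) → (t' ∈ S ∨ t' = x) → t ≠ t' → ∀ a ∈ W t, a ∈ W t' → a = r) ∨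
    ∃ S', OSep E r v P S' ∧ x ∉ Rch E r S' := by
  classical
  set R := Rch E r S with hR
  have hRS : ∀ w, w ∈ R → w ∉ S := fun w hw => Rch_notMem hS.hr hw
  have hvRS : ∀ w, w ∈ R ∨ w ∈ S → w ≠ v := by
    rintro w (h | h) rfl
    · exact hS.sep h
    · exact hS.hv h
  let B : V → V → Prop := fun w u => w ≠ r ∧ (w ∈ R ∨ w ∈ S) ∧
    ∃ l ∈ P, ∃ i : ℕ, l[i]? = some u ∧ l[i+1]? = some w
  have hBof : ∀ w, w ≠ r → (w ∈ R ∨ w ∈ S) → ∀ l ∈ P, w ∈ l → ∃ u, B w u := by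
    intro w h1 h2 l hl hw
    obtain ⟨i, hi⟩ := List.mem_iff_getElem?.1 hw
    cases i with
    | zero =>
      rw [(hP.path l hl).hd] at hi
      exact absurd (by simpa using hi.symm) h1
    | succ i => exact ⟨l[i]'(lt_of_succ hi), h1, h2, l, hl, i, getElem?_self _, hi⟩
  have hBR : ∀ w u, B w u → u ∈ R := by
    rintro w u ⟨h1, h2, l, hl, i, hi, hi'⟩
    obtain ⟨k, s, hk1, hk2, hk3, hk4⟩ := hS.idx hP hl
    refine hk3 i u ?_ hi
    by_contra hlt
    have := hk4 (i+1) w (by omega) hi'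
    tauto
  have hBE : ∀ w u, B w u → (u, w) ∈ E := by
    rintro w u ⟨h1, h2, l, hl, i, hi, hi'⟩
    exact (hP.path l hl).chain i u w hi hi'
  have hsame : ∀ a, a ≠ r → a ≠ v → ∀ l ∈ P, ∀ m ∈ P, a ∈ l → a ∈ m → l = m := by
    intro a h1 h2 l hl m hm hal ham
    by_contra hne
    rcases hP.disj l hl m hm hne a hal ham with h | h
    · exact h1 h
    · exact h2 h
  have hBinj : ∀ w w' u, B w u → B w' u → u ≠ r → w = w' := by
    intro w w' u hw hw' hur
    have huR := hBR w u hw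
    obtain ⟨h1, h2, l, hl, i, hi, hi'⟩ := hw
    obtain ⟨h1', h2', m, hm, j, hj, hj'⟩ := hw'
    have : l = m := hsame u hur (hvRS u (Or.inl huR)) l hl m hm (mem_of_get hi) (mem_of_get hj)
    subst this
    have := (hP.path l hl).inj hi hj
    subst this
    rw [hi'] at hj'
    simpa using hj'
  have hBuni : ∀ w u u', B w u → B w u' → u = u' := by
    intro w u u' hw hw'
    obtain ⟨h1, h2, l, hl, i, hi, hi'⟩ := hw
    obtain ⟨h1', h2', m, hm, j, hj, hj'⟩ := hw'
    have : l = m := hsame w h1 (hvRS w h2) l hl m hm (mem_of_get hi') (mem_of_get hj')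
    subst this
    have := (hP.path l hl).inj hi' hj'
    have : i = j := by omega
    subst this
    rw [hi] at hj
    simpa using hj
  let f : V → V := fun w => if h : ∃ u, B w u then h.choose else w
  have f1 : ∀ w u, B w u → f w = u := by
    intro w u h
    have hex : ∃ u, B w u := ⟨u, h⟩
    have : f w = hex.choose := dif_pos hex
    rw [this]
    exact hBuni w _ _ hex.choose_spec h
  have f2 : ∀ w, (¬ ∃ u, B w u) → f w = w := fun w h => dif_neg h
  have fr : f r = r := f2 r (fun ⟨u, h⟩ => h.1 rfl)
  have fS : ∀ w ∈ S, ∃ u, B w u := by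
    intro w hw
    obtain ⟨l, hl, hwl⟩ := hS.cov w hw
    exact hBof w (fun h => hS.hr (h ▸ hw)) (Or.inr hw) l hl hwl
  have finj : ∀ a b, f a = f b → f a ≠ r → a = b := by
    intro a b hab hne
    by_cases ha : ∃ u, B a u <;> by_cases hb : ∃ u, B b u
    · obtain ⟨u, hu⟩ := ha
      obtain ⟨u', hu'⟩ := hb
      rw [f1 a u hu, f1 b u' hu'] at hab
      subst hab
      exact hBinj a b u hu hu' (by rwa [f1 a u hu] at hne)
    · exfalso
      obtain ⟨u, hu⟩ := ha
      rw [f1 a u hu] at hab hne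
      rw [f2 b hb] at hab
      subst hab
      obtain ⟨_, _, l, hl, i, hi, _⟩ := id hu
      exact hb (hBof u hne (Or.inl (hBR _ _ hu)) l hl (mem_of_get hi))
    · exfalso
      obtain ⟨u, hu⟩ := hb
      rw [hab, f1 b u hu] at hne
      rw [f1 b u hu, f2 a ha] at hab
      subst hab
      obtain ⟨_, _, l, hl, i, hi, _⟩ := id hu
      exact ha (hBof a hne (Or.inl (hBR _ _ hu)) l hl (mem_of_get hi))
    · rwa [f2 a ha, f2 b hb] at hab
  have fnS : ∀ w, f w ∉ S := by
    intro w
    by_cases h : ∃ u, B w u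
    · obtain ⟨u, hu⟩ := h
      rw [f1 w u hu]
      exact hRS u (hBR w u hu)
    · rw [f2 w h]
      exact fun hw => h (fS w hw)
  let N : V → V → Prop := fun w u => (u ∈ R ∧ (w ∈ R ∨ w ∈ S) ∧ w ≠ r ∧ (u, w) ∈ E) ∨
    (u = w ∧ w ∉ S)
  have fN : ∀ w, N w (f w) := by
    intro w
    by_cases h : ∃ u, B w u
    · obtain ⟨u, hu⟩ := h
      rw [f1 w u hu]
      exact Or.inl ⟨hBR w u hu, hu.2.1, hu.1, hBE w u hu⟩
    · rw [f2 w h]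
      exact Or.inr ⟨rfl, fun hw => h (fS w hw)⟩
  by_cases hreach : Relation.ReflTransGen (fun a b => ∃ w, f w = a ∧ N w b) x r
  · left
    obtain ⟨l, hl1, hl2, hl3, hl4⟩ := exists_nodup_chain hreach
    obtain ⟨f', -, g2, g3, g4, g5, g6, -, g8⟩ := augment f N r fr finj l x hl1 hl2 hl3 hl4
    have gN : ∀ w, N w (f' w) := by
      intro w
      rcases g2 w with h | h
      · rw [h]; exact fN w
      · exact h
    have ht : ∀ t, t ∈ S ∨ t = x → ∀ w, f' w ≠ t := by
      rintro t (h | rfl) w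
      · rintro rfl
        rcases g6 w with h' | ⟨w', h'⟩
        · rw [h'] at h; exact hS.hr h
        · rw [h'] at h; exact fnS _ h
      · exact g3 hxr w
    let ρ : V → ℕ := fun w => sInf {n : ℕ | ∃ l ∈ P, l[n]? = some w}
    have hρ : ∀ w, w ≠ r → w ≠ v → ∀ l ∈ P, ∀ n : ℕ, l[n]? = some w → ρ w = n := by
      intro w h1 h2 l hl n hn
      have : {n : ℕ | ∃ l ∈ P, l[n]? = some w} = {n} := by
        ext m
        simp only [Set.mem_setOf_eq, Set.mem_singleton_iff]
        constructor
        · rintro ⟨l', hl', hm⟩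
          have := hsame w h1 h2 l hl l' hl' (mem_of_get hn) (mem_of_get hm)
          subst this
          exact (hP.path l hl).inj hm hn
        · rintro rfl
          exact ⟨l, hl, hn⟩
      change sInf _ = n
      rw [this]
      exact csInf_singleton n
    have hρf : ∀ w, f w ≠ w → f w ≠ r → ρ (f w) < ρ w := by
      intro w hne hnr
      by_cases h : ∃ u, B w u
      · obtain ⟨u, hu⟩ := h
        rw [f1 w u hu] at hnr ⊢
        obtain ⟨h1, h2, l, hl, i, hi, hi'⟩ := id hu
        rw [hρ u hnr (hvRS u (Or.inl (hBR w u hu))) l hl i hi, hρ w h1 (hvRS w h2) l hl (i+1) hi']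
        omega
      · exact absurd (f2 w h) hne
    have hE' : ∀ w, f' w ≠ w → (f' w, w) ∈ E := by
      intro w hne
      rcases gN w with h | h
      · exact h.2.2.2
      · exact absurd h.1 hne
    have hpath : ∀ t, t ∈ S ∨ t = x → ∃ l, LPath E r t l ∧ ∀ a ∈ l, ∃ k, f'^[k] t = a :=
      fun t h => orbit_path g8 g4 (ht t h) hE' (iter_reaches ρ g8 g4 g5 hρf (ht t h))
    let W : V → List V := fun t => if h : t ∈ S ∨ t = x then (hpath t h).choose else []
    have hW : ∀ t, t ∈ S ∨ t = x → LPath E r t (W t) ∧ ∀ a ∈ W t, ∃ k, f'^[k] t = a := by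
      intro t h
      have : W t = (hpath t h).choose := dif_pos h
      rw [this]
      exact (hpath t h).choose_spec
    refine ⟨W, fun t h => ⟨(hW t h).1, ?_⟩, ?_⟩
    · intro a ha
      obtain ⟨k, rfl⟩ := (hW t h).2 a ha
      clear ha
      induction k with
      | zero => left; rfl
      | succ k ih =>
        rw [Function.iterate_succ_apply']
        rcases gN (f'^[k] t) with h' | h'
        · exact Or.inr h'.1
        · rw [h'.1]; exact ih
    · have key : ∀ t t', (t ∈ S ∨ t = x) → t ≠ t' → ∀ i j, i ≤ j →
          f'^[i] t = f'^[j] t' → f'^[i] t = r := by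
        intro t t' h hne i j hij heq
        by_contra hnr
        obtain ⟨d, rfl⟩ := Nat.exists_eq_add_of_le hij
        rw [Function.iterate_add_apply] at heq
        have := iter_cancel g8 g4 i _ _ heq hnr
        cases d with
        | zero => exact hne this
        | succ d =>
          rw [Function.iterate_succ_apply'] at this
          exact ht t h _ this.symm
      intro t t' h h' hne a ha ha'
      obtain ⟨i, hi⟩ := (hW t h).2 a ha
      obtain ⟨j, hj⟩ := (hW t' h').2 a ha'
      rcases le_total i j with hij | hij
      · rw [← hi]; exact key t t' h hne i j hij (hi.trans hj.symm)
      · rw [← hj]; exact key t' t h' hne.symm j i hij (hj.trans hi.symm)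
  · right
    let U : Set V := {u | Relation.ReflTransGen (fun a b => ∃ w, f w = a ∧ N w b) x u}
    have hrU : r ∉ U := hreach
    have hxU : x ∈ U := Relation.ReflTransGen.refl
    have hcl : ∀ w u, f w ∈ U → N w u → u ∈ U :=
      fun w u h hN => Relation.ReflTransGen.tail h ⟨w, rfl, hN⟩
    have hfR : ∀ w, f w ∈ R → w ∈ R ∨ w ∈ S := by
      intro w hw
      by_cases h : ∃ u, B w u
      · exact h.choose_spec.2.1
      · rw [f2 w h] at hw; exact Or.inl hw
    have hUR : ∀ u ∈ U, u ∈ R := by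
      intro u hu
      induction hu with
      | refl => exact hx
      | tail _ h ih =>
        obtain ⟨w, rfl, hN⟩ := h
        rcases hN with h | ⟨rfl, h⟩
        · exact h.1
        · rcases hfR _ ih with h' | h'
          · exact h'
          · exact absurd h' h
    let S' : Set V := {w | (w ∈ U ∨ w ∈ S) ∧ f w ∉ U}
    have hS'R : ∀ w ∈ S', w ∈ R ∨ w ∈ S := fun w hw => hw.1.imp (hUR w) id
    have hR' : ∀ w ∈ Rch E r S', w ∈ R ∧ w ∉ U := by
      intro w hw
      refine Rch_ind (p := fun w => w ∈ R ∧ w ∉ U) ⟨Rch_root, hrU⟩ ?_ hw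
      intro a b _ ha hab hb
      have hbUS : ¬ (b ∈ U ∨ b ∈ S) := by
        intro h
        by_cases hbr : b = r
        · subst hbr; rcases h with h | h
          · exact hrU h
          · exact hS.hr h
        · have h1 : f b ∈ U := by
            by_contra h'
            exact hb ⟨h, h'⟩
          exact ha.2 (hcl b a h1 (Or.inl ⟨ha.1, h.imp (hUR b) id, hbr, hab⟩))
      exact ⟨Rch_step ha.1 hab (fun h => hbUS (Or.inr h)), fun h => hbUS (Or.inl h)⟩
    refine ⟨S', ⟨?_, ?_, ?_, ?_, ?_⟩, fun h => (hR' x h).2 hxU⟩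
    · rintro ⟨h | h, -⟩
      · exact hrU h
      · exact hS.hr h
    · intro h
      exact hvRS v (hS'R v h) rfl
    · intro h
      exact hS.sep (hR' v h).1
    · intro l hl
      have hp := hP.path l hl
      obtain ⟨k, s, hk1, hk2, hk3, hk4⟩ := hS.idx hP hl
      have hex : ∃ j : ℕ, ∃ u, l[j]? = some u ∧ (u ∈ U ∨ u ∈ S) := ⟨k, s, hk1, Or.inr hk2⟩
      have hstep : ∀ (i : ℕ) u w, i + 1 ≤ k → l[i]? = some u → l[i+1]? = some w → f w = u := by
        intro i u w hik hu hw
        apply f1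
        refine ⟨?_, ?_, l, hl, i, hu, hw⟩
        · rintro rfl
          have := hp.inj hw hp.hd
          omega
        · rcases Nat.lt_or_ge (i+1) k with h | h
          · exact Or.inl (hk3 _ _ h hw)
          · have : i + 1 = k := by omega
            subst this
            rw [hk1] at hw
            right
            simp at hw
            exact hw ▸ hk2
      obtain ⟨u, hu, huU⟩ := Nat.find_spec hex
      have hmin : ∀ m : ℕ, m < Nat.find hex → ∀ u, l[m]? = some u → ¬ (u ∈ U ∨ u ∈ S) :=
        fun m hm u hu h => Nat.find_min hex hm ⟨u, hu, h⟩
      have hjk : Nat.find hex ≤ k := Nat.find_min' hex ⟨s, hk1, Or.inr hk2⟩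
      generalize Nat.find hex = j at hu hmin hjk
      have hup : ∀ i, j ≤ i → i < k → ∀ w, l[i]? = some w → w ∈ U := by
        intro i hji
        induction i, hji using Nat.le_induction with
        | base =>
          intro hj w hw
          rw [hu] at hw
          simp at hw
          subst hw
          rcases huU with h | h
          · exact h
          · exact absurd h (hRS _ (hk3 _ _ hj hu))
        | succ i hji ih =>
          intro hik w hw
          have h1 := ih (by omega) _ (getElem?_self (lt_of_succ hw))
          have h2 := hstep i _ w (by omega) (getElem?_self (lt_of_succ hw)) hw
          rw [← h2] at h1
          exact hcl w w h1 (Or.inr ⟨rfl, hRS _ (hk3 _ _ hik hw)⟩)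
      refine ⟨u, ⟨mem_of_get hu, huU, ?_⟩, ?_⟩
      · cases j with
        | zero =>
          rw [hp.hd] at hu
          simp at hu
          subst hu
          rw [fr]; exact hrU
        | succ j =>
          rw [hstep j _ u hjk (getElem?_self (lt_of_succ hu)) hu]
          intro h
          exact hmin j (by omega) _ (getElem?_self (lt_of_succ hu)) (Or.inl h)
      · rintro w ⟨hwl, hw1, hw2⟩
        obtain ⟨i, hi⟩ := List.mem_iff_getElem?.1 hwl
        have hij : j ≤ i := by
          by_contra hlt
          exact hmin i (by omega) w hi hw1
        have hik : i ≤ k := by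
          by_contra hlt
          have := hk4 i w (by omega) hi
          have := hS'R w ⟨hw1, hw2⟩
          tauto
        rcases Nat.eq_or_lt_of_le hij with h | h
        · subst h
          rw [hu] at hi
          simpa using hi.symm
        · exfalso
          obtain ⟨i, rfl⟩ : ∃ i', i = i' + 1 := ⟨i - 1, by omega⟩
          apply hw2
          rw [hstep i _ w hik (getElem?_self (lt_of_succ hi)) hi]
          exact hup i (by omega) (by omega) _ (getElem?_self (lt_of_succ hi))
    · rintro w ⟨h1, h2⟩
      by_contra hno
      have h3 : ¬ ∃ u, B w u := by
        rintro ⟨u, _, _, l, hl, i, _, hi⟩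
        exact hno ⟨l, hl, mem_of_get hi⟩
      rw [f2 w h3] at h2
      rcases h1 with h | h
      · exact h2 h
      · exact h3 (fS w h)

/-- The orthogonal separation closest to the root. -/
theorem exists_closest {E : Set (V × V)} {r v : V} {P : Set (List V)} (hP : PSys E r v P)
    {S₀ : Set V} (h₀ : OSep E r v P S₀) :
    ∃ S, OSep E r v P S ∧ ∀ S', OSep E r v P S' → Rch E r S ⊆ Rch E r S' := by
  classical
  let S : Set V := {z | (∃ S', OSep E r v P S' ∧ z ∈ S') ∧
    ∀ S', OSep E r v P S' → z ∈ Rch E r S' ∨ z ∈ S'}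
  have hR : ∀ w ∈ Rch E r S, ∀ S', OSep E r v P S' → w ∈ Rch E r S' := by
    intro w hw
    refine Rch_ind (p := fun w => ∀ S', OSep E r v P S' → w ∈ Rch E r S') ?_ ?_ hw
    · intro S' _; exact Rch_root
    · intro a b _ ha hab hb S' hS'
      apply Rch_step (ha S' hS') hab
      intro hbS'
      apply hb
      refine ⟨⟨S', hS', hbS'⟩, fun S'' hS'' => ?_⟩
      by_cases h : b ∈ S''
      · exact Or.inr h
      · exact Or.inl (Rch_step (ha S'' hS'') hab h)
  refine ⟨S, ⟨?_, ?_, ?_, ?_, ?_⟩, fun S' hS' w hw => hR w hw S' hS'⟩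
  · rintro ⟨⟨S', hS', h⟩, -⟩
    exact hS'.hr h
  · rintro ⟨⟨S', hS', h⟩, -⟩
    exact hS'.hv h
  · intro h
    exact h₀.sep (hR v h S₀ h₀)
  · intro l hl
    have hex : ∃ k : ℕ, ∃ S' : Set V, OSep E r v P S' ∧ ∃ z, l[k]? = some z ∧ z ∈ S' := by
      obtain ⟨k, s, hk1, hk2, -⟩ := h₀.idx hP hl
      exact ⟨k, S₀, h₀, s, hk1, hk2⟩
    obtain ⟨S₁, hS₁, z, hz, hzS₁⟩ := Nat.find_spec hex
    have hmin : ∀ S', OSep E r v P S' → ∀ (i : ℕ) w, l[i]? = some w → w ∈ S' → Nat.find hex ≤ i :=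
      fun S' hS' i w hi hw => Nat.find_min' hex ⟨S', hS', w, hi, hw⟩
    refine ⟨z, ⟨mem_of_get hz, ⟨S₁, hS₁, hzS₁⟩, ?_⟩, ?_⟩
    · intro S' hS'
      obtain ⟨k, s, hk1, hk2, hk3, -⟩ := hS'.idx hP hl
      rcases Nat.lt_or_ge (Nat.find hex) k with h | h
      · exact Or.inl (hk3 _ _ h hz)
      · have h' := hmin S' hS' k s hk1 hk2
        have : k = Nat.find hex := by omega
        rw [this, hz] at hk1
        simp at hk1
        exact Or.inr (hk1 ▸ hk2)
    · rintro w ⟨hwl, ⟨S', hS', hw1⟩, hw2⟩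
      obtain ⟨i, hi⟩ := List.mem_iff_getElem?.1 hwl
      obtain ⟨k, s, hk1, hk2, hk3, hk4⟩ := hS₁.idx hP hl
      have hk : k = Nat.find hex := by
        by_contra hne
        rcases Nat.lt_or_ge k (Nat.find hex) with h | h
        · have := hmin S₁ hS₁ k s hk1 hk2
          omega
        · exact Rch_notMem hS₁.hr (hk3 _ _ (by omega) hz) hzS₁
      have h1 := hmin S' hS' i w hi hw1
      have h2 : i ≤ k := by
        by_contra h
        have := hk4 i w (by omega) hi
        have := hw2 S₁ hS₁
        tauto
      have : i = Nat.find hex := by omega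
      rw [this, hz] at hi
      simpa using hi.symm
  · rintro w ⟨⟨S', hS', hw1⟩, -⟩
    exact hS'.cov w hw1


theorem chain_iff {E : Set (V × V)} {l : List V} :
    (∀ (i : ℕ) u w, l[i]? = some u → l[i+1]? = some w → (u, w) ∈ E) ↔
      List.IsChain (fun a b => (a, b) ∈ E) l := by
  rw [List.isChain_iff_getElem]
  constructor
  · intro h i hi
    exact h i _ _ (getElem?_self _) (getElem?_self _)
  · intro h i u w h1 h2
    obtain ⟨h1', rfl⟩ := List.getElem?_eq_some_iff.1 h1
    obtain ⟨h2', rfl⟩ := List.getElem?_eq_some_iff.1 h2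
    exact h i h2'

theorem LPath.suffix {E : Set (V × V)} {a b h : V} {s t : List V}
    (hp : LPath E a b (s ++ h :: t)) : LPath E h b (h :: t) := by
  refine ⟨chain_iff.2 ?_, (List.nodup_append.1 hp.nodup).2.1, rfl, ?_⟩
  · exact (List.isChain_split.1 (chain_iff.1 hp.chain)).2
  · simpa [List.getLast?_append] using hp.lst

theorem LPath.eq_concat {E : Set (V × V)} {a b : V} {l : List V} (hp : LPath E a b l) :
    ∃ s, l = s ++ [b] := by
  have := hp.lst
  rw [List.getLast?_eq_some_iff] at this
  exact this

theorem LPath.append {E : Set (V × V)} {a b h : V} {l t : List V} (h1 : LPath E a h l)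
    (h2 : LPath E h b (h :: t)) (hd : ∀ z ∈ l, z ∉ t) : LPath E a b (l ++ t) := by
  obtain ⟨s, rfl⟩ := h1.eq_concat
  refine ⟨chain_iff.2 ?_, ?_, ?_, ?_⟩
  · have : s ++ [h] ++ t = s ++ h :: t := by simp
    rw [this]
    exact List.isChain_split.2 ⟨chain_iff.1 h1.chain, chain_iff.1 h2.chain⟩
  · refine List.nodup_append.2 ⟨h1.nodup, (List.nodup_cons.1 h2.nodup).2, ?_⟩
    rintro z hz w hw rfl
    exact hd z hz hw
  · rw [List.getElem?_append_left (by simp)]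
    exact h1.hd
  · have : s ++ [h] ++ t = s ++ h :: t := by simp
    rw [this, List.getLast?_append, h2.lst]
    rfl

theorem ends_iff {s t : List V} {h a b : V} (ht : t ≠ []) :
    (∃ l', s ++ h :: t = l' ++ [a, b]) ↔ ∃ l', h :: t = l' ++ [a, b] := by
  constructor
  · rintro ⟨l', hl⟩
    have h1 : [a, b] <:+ s ++ h :: t := ⟨l', hl.symm⟩
    have h2 : (h :: t) <:+ s ++ h :: t := ⟨s, rfl⟩
    have h3 : [a, b].length ≤ (h :: t).length := by
      have := List.length_pos_iff.2 ht
      simp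
      omega
    obtain ⟨m, hm⟩ := List.suffix_of_suffix_length_le h1 h2 h3
    exact ⟨m, hm.symm⟩
  · rintro ⟨l', hl⟩
    exact ⟨s ++ l', by rw [hl, List.append_assoc]⟩

theorem last_split {T : Set V} {q : List V} (h : ∃ a ∈ q, a ∈ T) :
    ∃ s a t, q = s ++ a :: t ∧ a ∈ T ∧ ∀ b ∈ t, b ∉ T := by
  induction q with
  | nil => simp at h
  | cons c q ih =>
    by_cases h' : ∃ a ∈ q, a ∈ T
    · obtain ⟨s, a, t, h1, h2, h3⟩ := ih h'
      exact ⟨c :: s, a, t, by simp [h1], h2, h3⟩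
    · refine ⟨[], c, q, rfl, ?_, fun b hb hbT => h' ⟨b, hb, hbT⟩⟩
      obtain ⟨a, ha, haT⟩ := h
      rcases List.mem_cons.1 ha with rfl | ha
      · exact haT
      · exact absurd ⟨a, ha, haT⟩ h'

theorem extend {Z : Set (V × V)} {r v x y : V} {S : Set V} (hrS : r ∉ S)
    (hx : x ∈ Rch (Z \ {(r, v)}) r S) (hxr : x ≠ r)
    (hyR : y ∉ Rch (Z \ {(r, v)}) r S) (hyS : y ∉ S)
    {W : V → List V} (hW1 : ∀ t, t ∈ S ∨ t = x → LPath (Z \ {(r, v)}) r t (W t) ∧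
        ∀ a ∈ W t, a = t ∨ a ∈ Rch (Z \ {(r, v)}) r S)
    (hW2 : ∀ t t', (t ∈ S ∨ t = x) → (t' ∈ S ∨ t' = x) → t ≠ t' → ∀ a ∈ W t, a ∈ W t' → a = r)
    {I : Set (V × V)} (hI : I ∈ GSet Z r y) :
    insert (x, y) I ∈ GSet (insert (x, y) Z) r y := by
  classical
  set R := Rch (Z \ {(r, v)}) r S with hR
  have hRS : ∀ w, w ∈ R → w ∉ S := fun w hw => Rch_notMem hrS hw
  have hrR : r ∈ R := Rch_root
  rw [mem_GSet_iff] at hI ⊢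
  obtain ⟨Q, q1, q2, q3⟩ := hI
  have hsplit : ∀ q : List V, q ∈ Q → ∃ s h t, q = s ++ h :: t ∧ (h ∈ S ∨ h = r) ∧ t ≠ [] ∧
      ∀ b ∈ t, b ∉ R ∧ b ∉ S := by
    intro q hq
    have hp := q1 q hq
    obtain ⟨s, h, t, rfl, h1, h2⟩ := last_split (T := R ∪ S) (q := q)
      ⟨r, mem_of_get hp.hd, Or.inl hrR⟩
    have h2' : ∀ b ∈ t, b ∉ R ∧ b ∉ S := fun b hb => by simpa using h2 b hb
    have hsuf := hp.suffix
    cases t with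
    | nil =>
      have := hsuf.lst
      simp at this
      subst this
      rcases h1 with h1 | h1
      · exact absurd h1 hyR
      · exact absurd h1 hyS
    | cons b t =>
      refine ⟨s, h, b :: t, rfl, ?_, by simp, h2'⟩
      rcases h1 with h1 | h1
      · right
        have hE : (h, b) ∈ Z := hsuf.chain 0 h b rfl rfl
        have hb := h2' b (by simp)
        by_contra hne
        exact hb.1 (Rch_step h1 ⟨hE, fun hc => hne (by simpa using congrArg Prod.fst hc)⟩ hb.2)
      · exact Or.inl h1
  let W' : V → List V := fun t => if t = r then [r] else W t
  have W'r : W' r = [r] := if_pos rfl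
  have W'n : ∀ t, t ≠ r → W' t = W t := fun t h => if_neg h
  have hW'1 : ∀ t, t ∈ S ∨ t = x ∨ t = r → LPath Z r t (W' t) ∧ ∀ a ∈ W' t, a ∈ R ∨ a ∈ S := by
    intro t ht
    by_cases htr : t = r
    · subst htr
      rw [W'r]
      refine ⟨⟨by simp, by simp, rfl, rfl⟩, fun a ha => ?_⟩
      rw [List.mem_singleton] at ha
      subst ha
      exact Or.inl hrR
    · have ht' : t ∈ S ∨ t = x := by tauto
      rw [W'n t htr]
      refine ⟨(hW1 t ht').1.mono Set.diff_subset, fun a ha => ?_⟩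
      rcases (hW1 t ht').2 a ha with rfl | h
      · rcases ht' with h | rfl
        · exact Or.inr h
        · exact Or.inl hx
      · exact Or.inl h
  have hW'2 : ∀ t t', (t ∈ S ∨ t = x ∨ t = r) → (t' ∈ S ∨ t' = x ∨ t' = r) → (t ≠ t' ∨ t = r) →
      ∀ a ∈ W' t, a ∈ W' t' → a = r := by
    intro t t' ht ht' hne a ha ha'
    by_cases h1 : t = r
    · subst h1
      rw [W'r] at ha
      simpa using ha
    · by_cases h2 : t' = r
      · subst h2
        rw [W'r] at ha'
        simpa using ha'
      · rw [W'n t h1] at ha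
        rw [W'n t' h2] at ha'
        exact hW2 t t' (by tauto) (by tauto) (by tauto) a ha ha'
  let Q' : Set (List V) := {m | ∃ s h t, s ++ h :: t ∈ Q ∧ (h ∈ S ∨ h = r) ∧ t ≠ [] ∧
      (∀ b ∈ t, b ∉ R ∧ b ∉ S) ∧ m = W' h ++ t}
  have hxy : LPath (insert (x, y) Z) x y [x, y] := by
    refine ⟨chain_iff.2 (by simp), ?_, rfl, rfl⟩
    have : x ≠ y := fun h => hyR (h ▸ hx)
    simp [this]
  have hcross : ∀ (s t : List V) (h : V), s ++ h :: t ∈ Q → (h ∈ S ∨ h = r) →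
      (∀ b ∈ t, b ∉ R ∧ b ∉ S) → ∀ a ∈ W' h ++ t, a ∈ W' x ++ [y] → a = r ∨ a = y := by
    intro s t h hq hh ht a ha hb
    rcases List.mem_append.1 hb with hb | hb
    · rcases List.mem_append.1 ha with ha | ha
      · left
        refine hW'2 h x (by tauto) (by tauto) (Or.inl ?_) a ha hb
        rintro rfl
        rcases hh with hh | hh
        · exact hRS _ hx hh
        · exact hxr hh
      · have h1 := ht a ha
        have h2 := (hW'1 x (by tauto)).2 a hb
        tauto
    · right
      simpa using hb
  refine ⟨insert (W' x ++ [y]) Q', ?_, ?_, ?_⟩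
  · rintro l (rfl | ⟨s, h, t, hq, hh, -, ht, rfl⟩)
    · refine ((hW'1 x (by tauto)).1.mono (Set.subset_insert _ _)).append hxy ?_
      intro z hz hzy
      have h2 := (hW'1 x (by tauto)).2 z hz
      rw [List.mem_singleton] at hzy
      subst hzy
      tauto
    · have hh' : h ∈ S ∨ h = x ∨ h = r := by tauto
      refine ((hW'1 h hh').1.append (q1 _ hq).suffix ?_).mono (Set.subset_insert _ _)
      intro z hz hzt
      have h1 := ht z hzt
      have h2 := (hW'1 h hh').2 z hz
      tauto
  · rintro l (rfl | ⟨s, h, t, hq, hh, -, ht, rfl⟩) m (rfl | ⟨s', h', t', hq', hh', -, ht', rfl⟩) hne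
    · exact absurd rfl hne
    · intro a ha hb
      exact hcross s' t' h' hq' hh' ht' a hb ha
    · exact hcross s t h hq hh ht
    · have k1 := hW'1 h (by tauto)
      have k2 := hW'1 h' (by tauto)
      intro a ha hb
      by_cases hqq : s ++ h :: t = s' ++ h' :: t'
      · exfalso
        apply hne
        have hTS : h ∈ R ∪ S ∧ h' ∈ R ∪ S := by
          constructor
          · rcases hh with hh | rfl
            · exact Or.inr hh
            · exact Or.inl hrR
          · rcases hh' with hh' | rfl
            · exact Or.inr hh'
            · exact Or.inl hrR
        have hn1 : h ∉ t' := fun hc => by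
          have := ht' h hc
          have := hTS.1
          simp at this
          tauto
        have hn2 : h' ∉ t := fun hc => by
          have := ht h' hc
          have := hTS.2
          simp at this
          tauto
        rcases List.append_eq_append_iff.1 hqq with ⟨c, hc1, hc2⟩ | ⟨c, hc1, hc2⟩
        · cases c with
          | nil => simp at hc2; rw [hc2.1, hc2.2]
          | cons d c =>
            simp at hc2
            exact absurd (by rw [hc2.2]; simp) hn2
        · cases c with
          | nil => simp at hc2; rw [hc2.1, hc2.2]
          | cons d c =>
            simp at hc2
            exact absurd (by rw [hc2.2]; simp) hn1
      · have hdis := q2 _ hq _ hq' hqq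
        rcases List.mem_append.1 ha with ha | ha <;> rcases List.mem_append.1 hb with hb | hb
        · left
          refine hW'2 h h' (by tauto) (by tauto) ?_ a ha hb
          by_contra hcon
          push Not at hcon
          obtain ⟨rfl, hhr⟩ := hcon
          have hhS : h ∈ S := by tauto
          rcases hdis h (by simp) (by simp) with e | e
          · exact hhr e
          · exact hyS (e ▸ hhS)
        · have := k1.2 a ha
          have := ht' a hb
          tauto
        · have := k2.2 a hb
          have := ht a ha
          tauto
        · exact hdis a (by simp [ha]) (by simp [hb])
  · have hsuf : ∀ (h : V) (t : List V) (a b : V), (h ∈ S ∨ h = x ∨ h = r) → t ≠ [] →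
        ((∃ l', W' h ++ t = l' ++ [a, b]) ↔ ∃ l', h :: t = l' ++ [a, b]) := by
      intro h t a b hh ht
      obtain ⟨s, hs⟩ := (hW'1 h hh).1.eq_concat
      have : W' h ++ t = s ++ h :: t := by rw [hs]; simp
      rw [this]
      exact ends_iff ht
    rintro ⟨e1, e2⟩
    constructor
    · rintro (he | he)
      · refine ⟨_, Set.mem_insert _ _, ?_⟩
        rw [hsuf x [y] _ _ (by tauto) (by simp)]
        simp only [Prod.mk.injEq] at he
        exact ⟨[], by simp [he.1, he.2]⟩
      · obtain ⟨q, hq, hl⟩ := (q3 _).1 he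
        obtain ⟨s, h, t, rfl, hh, htn, ht⟩ := hsplit q hq
        refine ⟨W' h ++ t, Or.inr ⟨s, h, t, hq, hh, htn, ht, rfl⟩, ?_⟩
        rw [hsuf h t _ _ (by tauto) htn]
        exact (ends_iff htn).1 hl
    · rintro ⟨m, rfl | ⟨s, h, t, hq, hh, htn, ht, rfl⟩, hl⟩
      · rw [hsuf x [y] _ _ (by tauto) (by simp)] at hl
        obtain ⟨l', hl'⟩ := hl
        left
        cases l' with
        | nil => simp at hl'; simp [hl'.1, hl'.2]
        | cons c l' =>
          have := congrArg List.length hl'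
          simp at this
      · right
        rw [hsuf h t _ _ (by tauto) htn] at hl
        exact (q3 _).2 ⟨_, hq, (ends_iff htn).2 hl⟩

theorem extend_root {Z : Set (V × V)} {r y : V} (hy : y ≠ r)
    {I : Set (V × V)} (hI : I ∈ GSet Z r y) :
    insert (r, y) I ∈ GSet (insert (r, y) Z) r y := by
  rw [mem_GSet_iff] at hI ⊢
  obtain ⟨Q, q1, q2, q3⟩ := hI
  refine ⟨insert [r, y] Q, ?_, ?_, ?_⟩
  · rintro l (rfl | hl)
    · exact ⟨chain_iff.2 (by simp), by simp [hy.symm], rfl, rfl⟩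
    · exact (q1 l hl).mono (Set.subset_insert _ _)
  · rintro l (rfl | hl) m (rfl | hm) hne a ha hb
    · simpa using ha
    · simpa using ha
    · simpa using hb
    · exact q2 l hl m hm hne a ha hb
  · rintro ⟨e1, e2⟩
    constructor
    · rintro (he | he)
      · simp only [Prod.mk.injEq] at he
        exact ⟨_, Set.mem_insert _ _, [], by simp [he.1, he.2]⟩
      · obtain ⟨l, hl, h⟩ := (q3 _).1 he
        exact ⟨l, Or.inr hl, h⟩
    · rintro ⟨l, rfl | hl, h⟩
      · obtain ⟨l', hl'⟩ := h
        left
        cases l' with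
        | nil => simp at hl'; simp [hl'.1, hl'.2]
        | cons c l' =>
          have := congrArg List.length hl'
          simp at this
      · exact Or.inr ((q3 _).2 ⟨l, hl, h⟩)

theorem quasi_insert {Z F : Set (V × V)} {r x y : V} (hZ : QuasiFlame Z r F)
    (hxy : ∀ I, I ∈ GSet Z r y → insert (x, y) I ∈ GSet (insert (x, y) Z) r y) :
    QuasiFlame (insert (x, y) Z) r F := by
  intro w hw I hI hfin
  have hsub := Set.subset_insert (x, y) Z
  by_cases hmem : (x, y) ∈ I
  · have hwy : y = w := (hI hmem).2
    subst hwy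
    have h0 : I \ {(x, y)} ∈ GSet Z r y := by
      refine hZ y hw _ ?_ (hfin.subset ?_)
      · rintro e ⟨he, hne⟩
        obtain ⟨h1 | h1, h2⟩ := hI he
        · exact absurd h1 hne
        · exact ⟨h1, h2⟩
      · exact Set.diff_subset_diff_left Set.diff_subset
    have := hxy _ h0
    rwa [Set.insert_diff_singleton, Set.insert_eq_of_mem hmem] at this
  · refine GSet_mono hsub (hZ w hw I ?_ hfin)
    intro e he
    obtain ⟨h1 | h1, h2⟩ := hI he
    · exact absurd (h1 ▸ he) hmem
    · exact ⟨h1, h2⟩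

theorem exists_max {E F : Set (V × V)} {r : V} (hFE : F ⊆ E) (hF : IsFlame F r) :
    ∃ Z, F ⊆ Z ∧ Z ⊆ E ∧ QuasiFlame Z r F ∧
      ∀ e ∈ E, QuasiFlame (insert e Z) r F → e ∈ Z := by
  let T : Set (Set (V × V)) := {Z | F ⊆ Z ∧ Z ⊆ E ∧ QuasiFlame Z r F}
  have hFT : F ∈ T := ⟨subset_rfl, hFE, fun v hv I hI _ => GSet_subset (hF v hv) hI⟩
  obtain ⟨Z, hFZ, hZ⟩ := zorn_subset_nonempty T (by
    intro c hc hch hne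
    refine ⟨⋃₀ c, ⟨?_, ?_, ?_⟩, fun s hs => Set.subset_sUnion_of_mem hs⟩
    · obtain ⟨Z, hZ⟩ := hne
      exact (hc hZ).1.trans (Set.subset_sUnion_of_mem hZ)
    · exact Set.sUnion_subset fun Z hZ => (hc hZ).2.1
    · intro v hv I hI hfin
      obtain ⟨Z, hZ, hsub⟩ := DirectedOn.exists_mem_subset_of_finite_of_subset_sUnion hne
        hch.directedOn hfin (fun e he => (hI he.1).1)
      refine GSet_mono (Set.subset_sUnion_of_mem hZ) ((hc hZ).2.2 v hv I ?_ hfin)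
      intro e he
      refine ⟨?_, (hI he).2⟩
      by_cases h : e ∈ inEdges F v
      · exact (hc hZ).1 h.1
      · exact hsub ⟨he, h⟩) F hFT
  refine ⟨Z, hZ.prop.1, hZ.prop.2.1, hZ.prop.2.2, fun e he hq => ?_⟩
  have : insert e Z ∈ T :=
    ⟨hZ.prop.1.trans (Set.subset_insert _ _), Set.insert_subset he hZ.prop.2.1, hq⟩
  exact hZ.le_of_ge this (Set.subset_insert _ _) (Set.mem_insert _ _)

end QF

open QF
/-- For every vertex-flame `F` in `D` there is an `F`-quasi-flame `Z` between `F` and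
`D` such that every `Z`-large subdigraph of `Z` is `D`-large. -/
theorem stmt15 {V : Type u} (E : Set (V × V)) (r : V)
    (F : Set (V × V)) (hFE : F ⊆ E) (hF : IsFlame F r) :
    ∃ Z : Set (V × V), F ⊆ Z ∧ Z ⊆ E ∧ QuasiFlame Z r F ∧
      ∀ L ⊆ Z, Large Z r L → Large E r L := by
  obtain ⟨Z, hFZ, hZE, hQ, hmax⟩ := exists_max hFE hF
  refine ⟨Z, hFZ, hZE, hQ, ?_⟩
  intro L hLZ hL v hv
  have hroot : ∀ w, w ≠ r → (r, w) ∈ E → (r, w) ∈ Z := fun w hw hE =>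
    hmax _ hE (quasi_insert hQ fun I hI => extend_root hw hI)
  obtain ⟨hL1, P, ⟨⟨hP1, hP2⟩, S₀, hS₀, hO1, hO2⟩, hPL⟩ := hL v hv
  refine ⟨fun h => hL1 (hroot v hv h), ?_⟩
  let P' : Set (List V) := Dipath.verts '' P
  have hPS : PSys (Z \ {(r, v)}) r v P' := by
    refine ⟨?_, ?_⟩
    · rintro _ ⟨p, hp, rfl⟩
      have := lpath_of_dipath p
      rwa [(hP1 p hp).1, (hP1 p hp).2] at this
    · rintro _ ⟨p, hp, rfl⟩ _ ⟨q, hq, rfl⟩ hne a ha hb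
      have := hP2 hp hq (fun h => hne (by rw [h])) (⟨ha, hb⟩ : a ∈ p.support ∩ q.support)
      simpa using this
  have h₀ : OSep (Z \ {(r, v)}) r v P' S₀ := by
    have hs := isSeparation_iff.1 hS₀
    refine ⟨hs.1, hs.2.1, hs.2.2, ?_, ?_⟩
    · rintro _ ⟨p, hp, rfl⟩
      exact hO1 p hp
    · intro x hx
      obtain ⟨p, hp, hxp⟩ := hO2 x hx
      exact ⟨_, ⟨p, hp, rfl⟩, hxp⟩
  obtain ⟨S, hS, hclose⟩ := exists_closest hPS h₀
  have hsep : Rch (E \ {(r, v)}) r S ⊆ Rch (Z \ {(r, v)}) r S := by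
    intro w hw
    refine Rch_ind (p := fun w => w ∈ Rch (Z \ {(r, v)}) r S) Rch_root ?_ hw
    rintro x y - hx ⟨hxy, hne⟩ hyS
    by_contra hyR
    have hyr : y ≠ r := fun h => hyR (h ▸ Rch_root)
    have hxyZ : (x, y) ∉ Z := fun h => hyR (Rch_step hx ⟨h, hne⟩ hyS)
    have hxr : x ≠ r := by
      rintro rfl
      exact hxyZ (hroot y hyr hxy)
    rcases link hPS hS hx hxr with ⟨W, hW1, hW2⟩ | ⟨S', hS', hxS'⟩
    · exact hxyZ (hmax _ hxy (quasi_insert hQ fun I hI =>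
        extend hS.hr hx hxr hyR hyS hW1 hW2 hI))
    · exact hxS' (hclose S' hS' hx)
  have hmem : ∀ p' : Dipath (E \ {(r, v)}), (∃ p ∈ P, p'.verts = p.verts) →
      p'.verts ∈ P' := by
    rintro p' ⟨p, hp, h⟩
    exact ⟨p, hp, h.symm⟩
  refine ⟨{p' | ∃ p ∈ P, p'.verts = p.verts}, ⟨⟨?_, ?_⟩, S, ?_, ?_, ?_⟩, ?_⟩
  · intro p' hp'
    have h1 := hPS.path _ (hmem p' hp')
    have h2 := lpath_of_dipath p'
    refine ⟨?_, ?_⟩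
    · have := h1.hd.symm.trans h2.hd; simpa using this.symm
    · have := h1.lst.symm.trans h2.lst; simpa using this.symm
  · intro p hp q hq hne a ⟨ha, hb⟩
    have := hPS.disj _ (hmem p hp) _ (hmem q hq) (by
      intro h
      apply hne
      obtain ⟨s, l, _, _⟩ := p
      obtain ⟨s', l', _, _⟩ := q
      simp only [Dipath.verts, List.cons.injEq] at h
      obtain ⟨rfl, rfl⟩ := h
      rfl) a ha hb
    simpa using this
  · exact isSeparation_iff.2 ⟨hS.hr, hS.hv, fun h => hS.sep (hsep h)⟩
  · intro p' hp'
    exact hS.one _ (hmem p' hp')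
  · intro x hx
    obtain ⟨_, ⟨p, hp, rfl⟩, hxp⟩ := hS.cov x hx
    have h1 := (lpath_of_dipath p).mono (Set.diff_subset_diff_left (t := {(r, v)}) hZE)
    obtain ⟨p', hp', -⟩ := h1.exists_dipath
    exact ⟨p', ⟨p, hp, hp'⟩, by change x ∈ p'.verts; rw [hp']; exact hxp⟩
  · rintro p' ⟨p, hp, h⟩ e he
    apply hPL p hp
    change e ∈ p.edges
    have he' : e ∈ p'.edges := he
    rw [edges_eq] at he' ⊢
    rwa [h] at he'
end

section
/- Let D be a countable rooted digraph that is a G-quasi-flame for some spanning subdigraph G ⊆ D, and let v ≠ r be a vertex. Then there exists I* ∈ 𝒢_D(v) with in_G(v) ⊆ I* such that the restriction D↾_v I* (the digraph obtained from D by deleting all ingoing edges of v not in I*) is again a G-quasi-flame. -/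
/-!  Common framework: digraphs as edge sets on a vertex type, directed paths,
path-systems, separations, flames and largeness. -/

universe u

variable {V : Type u}

namespace QFW
open Set

/-- `σ` has no injective infinite orbit outside `Y`. -/
def NoRay (Y : Set V) (σ : V → V) : Prop :=
  ∀ x : ℕ → V, Function.Injective x → (∀ n, x n ∉ Y) → (∀ n, x (n+1) = σ (x n)) → False

lemma NoRay.eventually {Y : Set V} {σ : V → V} (h : NoRay Y σ) (x : ℕ → V)
    (hx : Function.Injective x) (hY : ∀ n, x n ∉ Y) (n0 : ℕ)
    (h0 : ∀ n, n0 ≤ n → x (n+1) = σ (x n)) : False := by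
  refine h (fun n => x (n0 + n)) (fun a b hab => by have := hx hab; omega) (fun n => hY _) ?_
  intro n
  exact h0 (n0 + n) (by omega)

lemma NoRay.congr_finite {Y : Set V} {σ σ' : V → V} (h : NoRay Y σ)
    (hf : {x | σ' x ≠ σ x}.Finite) : NoRay Y σ' := by
  intro x hx hY hs
  have h1 : (x ⁻¹' {x | σ' x ≠ σ x}).Finite := hf.preimage hx.injOn
  obtain ⟨b, hb⟩ := h1.bddAbove
  refine h.eventually x hx hY (b+1) ?_
  intro n hn
  by_contra hc
  have : n ∈ x ⁻¹' {x | σ' x ≠ σ x} := by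
    simp only [mem_preimage, mem_ofPred_eq]
    rw [← hs n]; exact hc
  have := hb this
  omega

/-- a linkage of `C` to `Y`, encoded by a matching. -/
structure Lk (N : V → V → Prop) (Y C : Set V) (σ : V → V) : Prop where
  inj : InjOn σ Yᶜ
  adj : ∀ x, x ∉ Y → N x (σ x)
  avoid : ∀ x, x ∉ Y → σ x ∉ C
  noray : NoRay Y σ

def Jn (N : V → V → Prop) (Y C : Set V) : Prop := ∃ σ, Lk N Y C σ

lemma Lk.mono {N : V → V → Prop} {Y C C' : Set V} {σ : V → V} (h : Lk N Y C σ) (hC : C' ⊆ C) :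
    Lk N Y C' σ := ⟨h.inj, h.adj, fun x hx hc => h.avoid x hx (hC hc), h.noray⟩

lemma Jn.mono {N : V → V → Prop} {Y C C' : Set V} (h : Jn N Y C) (hC : C' ⊆ C) : Jn N Y C' := by
  obtain ⟨σ, h⟩ := h
  exact ⟨σ, h.mono hC⟩

open Classical in
theorem aug {N : V → V → Prop} {D : Set V} {u0 : V} (hu0 : u0 ∈ D) (n : ℕ) :
    ∀ (σ : V → V) (w : V) (x : ℕ → V), x 0 = u0 → InjOn σ (D \ {u0}) →
    (∀ i < n, x (i+1) ∈ D ∧ x (i+1) ≠ u0 ∧ N (x i) (σ (x (i+1)))) → N (x n) w →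
    (∀ y ∈ D, y ≠ u0 → σ y ≠ w) →
    ∃ σ', InjOn σ' D ∧ {y | σ' y ≠ σ y}.Finite ∧ (∀ y ∈ D, σ' y = σ y ∨ N y (σ' y)) ∧
      N u0 (σ' u0) ∧ ∀ y ∈ D, σ' y = w ∨ ∃ z ∈ D, z ≠ u0 ∧ σ' y = σ z := by
  induction n using Nat.strong_induction_on with
  | _ n ih =>
    intro σ w x hx0 hinj hw hN hni
    rcases n with _ | n
    · refine ⟨Function.update σ u0 w, ?_, ?_, ?_, ?_, ?_⟩
      · intro a ha b hb hab
        by_cases h1 : a = u0 <;> by_cases h2 : b = u0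
        · rw [h1, h2]
        · subst h1
          simp [Function.update_of_ne h2] at hab
          exact absurd hab.symm (hni b hb h2)
        · subst h2
          simp [Function.update_of_ne h1] at hab
          exact absurd hab (hni a ha h1)
        · simp [Function.update_of_ne h1, Function.update_of_ne h2] at hab
          exact hinj ⟨ha, h1⟩ ⟨hb, h2⟩ hab
      · apply (finite_singleton u0).subset
        intro y hy
        by_contra hc
        exact hy (Function.update_of_ne hc _ _)
      · intro y hy
        by_cases h1 : y = u0
        · right; subst h1; simp; rwa [hx0] at hN
        · left; exact Function.update_of_ne h1 _ _
      · simp; rw [hx0] at hN; exact hN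
      · intro y hy
        by_cases h1 : y = u0
        · left; subst h1; simp
        · right; exact ⟨y, hy, h1, Function.update_of_ne h1 _ _⟩
    · by_cases hrep : ∃ i < n+1, x i = x (n+1)
      · obtain ⟨i, hi, hxi⟩ := hrep
        exact ih i hi σ w x hx0 hinj (fun j hj => hw j (by omega)) (by rw [hxi]; exact hN) hni
      · push Not at hrep
        obtain ⟨hD, hne, hNn⟩ := hw n (by omega)
        set z := x (n+1) with hz
        have hni1 : ∀ y ∈ D, y ≠ u0 → Function.update σ z w y ≠ σ z := by
          intro y hy hyu
          by_cases h1 : y = z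
          · subst h1; simp; exact (hni _ hy hyu).symm
          · rw [Function.update_of_ne h1]
            intro h; exact h1 (hinj ⟨hy, hyu⟩ ⟨hD, hne⟩ h)
        obtain ⟨σ', a1, a2, a3, a4, a5⟩ := ih n (by omega) (Function.update σ z w) (σ z) x hx0
          (by
            intro a ha b hb hab
            by_cases h1 : a = z <;> by_cases h2 : b = z
            · rw [h1, h2]
            · subst h1
              simp only [Function.update_self, Function.update_of_ne h2] at hab
              exact absurd hab.symm (hni b hb.1 hb.2)
            · subst h2
              simp only [Function.update_self, Function.update_of_ne h1] at hab
              exact absurd hab (hni a ha.1 ha.2)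
            · simp only [Function.update_of_ne h1, Function.update_of_ne h2] at hab
              exact hinj ha hb hab)
          (by
            intro i hi
            obtain ⟨b1, b2, b3⟩ := hw i (by omega)
            refine ⟨b1, b2, ?_⟩
            rw [Function.update_of_ne (hrep (i+1) (by omega))]; exact b3)
          hNn hni1
        refine ⟨σ', a1, ?_, ?_, a4, ?_⟩
        · apply (a2.union (finite_singleton z)).subset
          intro y hy
          by_cases h1 : y = z
          · right; exact h1
          · left; simp only [mem_ofPred_eq, Function.update_of_ne h1]; exact hy
        · intro y hy
          rcases a3 y hy with h | h
          · by_cases h1 : y = z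
            · right; rw [h, h1]; simpa using hN
            · left; rw [h, Function.update_of_ne h1]
          · right; exact h
        · intro y hy
          rcases a5 y hy with h | ⟨q, hq, hqu, h⟩
          · right; exact ⟨z, hD, hne, h⟩
          · by_cases h1 : q = z
            · left; rw [h, h1]; simp
            · right; exact ⟨q, hq, hqu, by rw [h, Function.update_of_ne h1]⟩

/-- vertices reachable from the hole `u0` by alternating walks -/
def Rch (N : V → V → Prop) (D : Set V) (u0 : V) (σ : V → V) : Set V :=
  {y | ∃ (n : ℕ) (x : ℕ → V), x 0 = u0 ∧ x n = y ∧
    ∀ i < n, x (i+1) ∈ D ∧ x (i+1) ≠ u0 ∧ N (x i) (σ (x (i+1)))}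

lemma Rch.base {N : V → V → Prop} {D : Set V} {u0 : V} {σ : V → V} : u0 ∈ Rch N D u0 σ :=
  ⟨0, fun _ => u0, rfl, rfl, fun i hi => by omega⟩

lemma Rch.sub {N : V → V → Prop} {D : Set V} {u0 : V} {σ : V → V} (h0 : u0 ∈ D) :
    Rch N D u0 σ ⊆ D := by
  rintro y ⟨n, x, hx0, hxn, hw⟩
  rcases n with _ | n
  · rw [← hxn, hx0]; exact h0
  · rw [← hxn]; exact (hw n (by omega)).1

lemma Rch.step {N : V → V → Prop} {D : Set V} {u0 : V} {σ : V → V} {y z : V}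
    (hy : y ∈ Rch N D u0 σ) (hz : z ∈ D) (hz0 : z ≠ u0) (h : N y (σ z)) : z ∈ Rch N D u0 σ := by
  obtain ⟨n, x, hx0, hxn, hw⟩ := hy
  refine ⟨n+1, fun i => if i ≤ n then x i else z, by simp [hx0], by simp, ?_⟩
  intro i hi
  by_cases h1 : i < n
  · have h2 : i + 1 ≤ n := h1
    have h3 : i ≤ n := by omega
    simp only [h2, h3, if_true]
    exact hw i h1
  · have h2 : i = n := by omega
    subst h2
    simp [hz, hz0, hxn, h]

theorem Rch.aug {N : V → V → Prop} {D : Set V} {u0 : V} (hu0 : u0 ∈ D) {σ : V → V} {w y : V}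
    (hinj : InjOn σ (D \ {u0})) (hy : y ∈ Rch N D u0 σ) (hN : N y w)
    (hw : ∀ y ∈ D, y ≠ u0 → σ y ≠ w) :
    ∃ σ', InjOn σ' D ∧ {y | σ' y ≠ σ y}.Finite ∧ (∀ y ∈ D, σ' y = σ y ∨ N y (σ' y)) ∧
      N u0 (σ' u0) ∧ ∀ y ∈ D, σ' y = w ∨ ∃ z ∈ D, z ≠ u0 ∧ σ' y = σ z := by
  obtain ⟨n, x, hx0, hxn, hww⟩ := hy
  exact QFW.aug hu0 n σ w x hx0 hinj hww (by rw [hxn]; exact hN) hw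

end QFW

namespace QFW
open Set

theorem exch {N : V → V → Prop} {Y C : Set V} {σ : V → V} (h : Lk N Y C σ) {e : V} (he : e ∉ C)
    (hn : ¬ Jn N Y (insert e C)) :
    ∃ A : Set V, A ⊆ Yᶜ ∧ (∀ x ∈ A, ∀ w, N x w → w ∉ C → ∃ x' ∈ A, σ x' = w) ∧
      (∃ x ∈ A, N x e) ∧ (∀ c ∈ C, ∀ x ∈ A, N x c → Jn N Y (insert e (C \ {c}))) := by
  have h1 : ∃ x0, x0 ∉ Y ∧ σ x0 = e := by
    by_contra hc
    push Not at hc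
    refine hn ⟨σ, h.inj, h.adj, ?_, h.noray⟩
    intro x hx hx'
    rcases hx' with h1 | h1
    · exact hc x hx h1
    · exact h.avoid x hx h1
  obtain ⟨x0, hx0, hxe⟩ := h1
  have hinj : InjOn σ (Yᶜ \ {x0}) := h.inj.mono sdiff_subset
  -- the general augmentation
  have key : ∀ x ∈ Rch (fun a b => N a b ∧ b ≠ e) Yᶜ x0 σ, ∀ w, N x w → w ≠ e →
      (∀ y ∈ Yᶜ, y ≠ x0 → σ y ≠ w) → Jn N Y (insert e (C \ {w})) := by
    intro x hx w hw hwe hi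
    obtain ⟨σ', a1, a2, a3, a4, a5⟩ := Rch.aug (N := fun a b => N a b ∧ b ≠ e) hx0 hinj hx
      ⟨hw, hwe⟩ hi
    refine ⟨σ', a1, ?_, ?_, h.noray.congr_finite a2⟩
    · intro y hy
      rcases a3 y hy with h2 | h2
      · rw [h2]; exact h.adj y hy
      · exact h2.1
    · intro y hy hc
      rcases a5 y hy with h2 | ⟨z, hz, hz0, h2⟩
      · rw [h2] at hc
        rcases hc with h3 | h3
        · exact hwe h3
        · exact h3.2 rfl
      · rw [h2] at hc
        rcases hc with h3 | h3
        · exact hz0 (h.inj hz hx0 (h3.trans hxe.symm))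
        · exact h.avoid z hz h3.1
  refine ⟨Rch (fun a b => N a b ∧ b ≠ e) Yᶜ x0 σ, Rch.sub hx0, ?_, ?_, ?_⟩
  · intro x hx w hw hwC
    by_cases hwe : w = e
    · exact ⟨x0, Rch.base, hxe.trans hwe.symm⟩
    by_cases hi : ∀ y ∈ Yᶜ, y ≠ x0 → σ y ≠ w
    · exfalso
      apply hn
      have := key x hx w hw hwe hi
      rwa [sdiff_singleton_eq_self hwC] at this
    · push Not at hi
      obtain ⟨y, hy, hy0, hyw⟩ := hi
      exact ⟨y, Rch.step hx hy hy0 (by rw [hyw]; exact ⟨hw, hwe⟩), hyw⟩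
  · exact ⟨x0, Rch.base, hxe ▸ h.adj x0 hx0⟩
  · intro c hc x hx hxc
    refine key x hx c hxc (fun hce => he (hce ▸ hc)) ?_
    intro y hy _ hyc
    exact h.avoid y hy (hyc ▸ hc)

open Classical in
theorem cut {N : V → V → Prop} (hN : ∀ x, N x x) {Y C C' : Set V} {σ τ : V → V} (h : Lk N Y C σ)
    {A : Set V} (hAY : A ⊆ Yᶜ)
    (hA : ∀ x ∈ A, ∀ w, N x w → w ∉ C → ∃ x' ∈ A, σ x' = w) (h' : Lk N Y C' τ) :
    Jn N Y ({c ∈ C' | ∃ x ∈ A, N x c} ∪ {c ∈ C | ¬ ∃ x ∈ A, N x c}) := by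
  have hst : ∀ x ∉ Y, x ∉ A → ¬ ∃ y ∈ A, N y (σ x) := by
    rintro x hx hxA ⟨y, hy, hyx⟩
    obtain ⟨x', hx', he⟩ := hA y hy _ hyx (h.avoid x hx)
    exact hxA (h.inj (hAY hx') hx he ▸ hx')
  refine ⟨fun x => if x ∈ A then τ x else σ x, ?_, ?_, ?_, ?_⟩
  · intro a ha b hb hab
    by_cases h1 : a ∈ A <;> by_cases h2 : b ∈ A <;> simp only [h1, h2, if_true, if_false] at hab
    · exact h'.inj ha hb hab
    · exact absurd ⟨a, h1, hab ▸ h'.adj a ha⟩ (hst b hb h2)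
    · exact absurd ⟨b, h2, hab ▸ h'.adj b hb⟩ (hst a ha h1)
    · exact h.inj ha hb hab
  · intro x hx
    by_cases h1 : x ∈ A <;> simp only [h1, if_true, if_false]
    · exact h'.adj x hx
    · exact h.adj x hx
  · intro x hx
    by_cases h1 : x ∈ A <;> simp only [h1, if_true, if_false]
    · rintro (h2 | h2)
      · exact h'.avoid x hx h2.1
      · exact h2.2 ⟨x, h1, h'.adj x hx⟩
    · rintro (h2 | h2)
      · exact hst x hx h1 h2.2
      · exact h.avoid x hx h2.1
  · intro x hx hY hs
    by_cases hall : ∀ n, x n ∈ A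
    · exact h'.noray x hx hY (fun n => by rw [hs n]; simp [hall n])
    · push Not at hall
      obtain ⟨n0, hn0⟩ := hall
      have hoff : ∀ n, n0 ≤ n → x n ∉ A := by
        intro n hn
        induction n, hn using Nat.le_induction with
        | base => exact hn0
        | succ n hn ih =>
          intro hc
          have := hs n
          simp only [ih, if_false] at this
          exact hst (x n) (hY n) ih ⟨x (n+1), hc, this ▸ hN _⟩
      refine h.noray.eventually x hx hY n0 ?_
      intro n hn
      rw [hs n]; simp [hoff n hn]

theorem augm {N : V → V → Prop} (hN : ∀ x, N x x) {Y : Set V} (k : ℕ) : ∀ {C1 C2 : Set V},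
    Jn N Y C1 → Jn N Y C2 → (C1 \ C2).Finite → (C2 \ C1).Finite → (C1 \ C2).ncard = k →
    (C1 \ C2).ncard < (C2 \ C1).ncard → ∃ e ∈ C2 \ C1, Jn N Y (insert e C1) := by
  induction k with
  | zero =>
    intro C1 C2 h1 h2 f1 f2 hk hlt
    rw [ncard_eq_zero f1, sdiff_eq_empty] at hk
    have : (C2 \ C1).Nonempty := by
      rw [← ncard_pos f2]; omega
    obtain ⟨e, he⟩ := this
    exact ⟨e, he, h2.mono (insert_subset he.1 hk)⟩
  | succ k ih =>
    intro C1 C2 h1 h2 f1 f2 hk hlt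
    have : (C1 \ C2).Nonempty := by
      rw [← ncard_pos f1]; omega
    obtain ⟨d, hd⟩ := this
    have e1 : C1 \ insert d C2 = (C1 \ C2) \ {d} := by
      ext x; simp only [mem_sdiff, mem_insert_iff, mem_singleton_iff]; tauto
    have c1 : (C1 \ insert d C2).ncard = k := by
      rw [e1, ncard_sdiff_singleton_of_mem hd]; omega
    by_cases hj : Jn N Y (insert d C2)
    · have e2 : insert d C2 \ C1 = C2 \ C1 := by
        ext x; simp only [mem_sdiff, mem_insert_iff]
        constructor
        · rintro ⟨rfl | h, h'⟩
          · exact absurd hd.1 h'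
          · exact ⟨h, h'⟩
        · rintro ⟨h, h'⟩; exact ⟨Or.inr h, h'⟩
      obtain ⟨e, he, hje⟩ := ih h1 hj (f1.subset (by rw [e1]; exact sdiff_subset)) (e2 ▸ f2) c1
        (by rw [e2]; omega)
      exact ⟨e, e2 ▸ he, hje⟩
    · obtain ⟨σ, hσ⟩ := h2
      obtain ⟨A, hAY, hA, ⟨a, ha, had⟩, hex⟩ := exch hσ hd.2 hj
      by_cases hc : ∃ c ∈ C2, (∃ x ∈ A, N x c) ∧ c ∉ C1
      · obtain ⟨c, hc2, ⟨x, hx, hxc⟩, hc1⟩ := hc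
        have hj' := hex c hc2 x hx hxc
        have e3 : C1 \ insert d (C2 \ {c}) = C1 \ insert d C2 := by
          ext y; simp only [mem_sdiff, mem_insert_iff, mem_singleton_iff]
          constructor
          · rintro ⟨h, h'⟩
            refine ⟨h, fun h3 => h' ?_⟩
            rcases h3 with h3 | h3
            · exact Or.inl h3
            · exact Or.inr ⟨h3, fun h4 => hc1 (h4 ▸ h)⟩
          · rintro ⟨h, h'⟩
            exact ⟨h, fun h3 => h' (h3.imp id And.left)⟩
        have e4 : insert d (C2 \ {c}) \ C1 = (C2 \ C1) \ {c} := by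
          ext y; simp only [mem_sdiff, mem_insert_iff, mem_singleton_iff]
          constructor
          · rintro ⟨rfl | h, h'⟩
            · exact absurd hd.1 h'
            · exact ⟨⟨h.1, h'⟩, h.2⟩
          · rintro ⟨⟨h, h'⟩, h''⟩; exact ⟨Or.inr ⟨h, h''⟩, h'⟩
        have c4 : (insert d (C2 \ {c}) \ C1).ncard = (C2 \ C1).ncard - 1 := by
          rw [e4, ncard_sdiff_singleton_of_mem (show c ∈ C2 \ C1 from ⟨hc2, hc1⟩)]
        obtain ⟨e, he, hje⟩ := ih h1 hj' (f1.subset (by rw [e3, e1]; exact sdiff_subset))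
          (f2.subset (by rw [e4]; exact sdiff_subset)) (by rw [e3]; exact c1)
          (by rw [e3, c4]; omega)
        rw [e4] at he
        exact ⟨e, he.1, hje⟩
      · exfalso
        push Not at hc
        obtain ⟨τ, hτ⟩ := h1
        apply hj
        refine (cut hN hσ hAY hA hτ).mono ?_
        intro y hy
        rcases hy with rfl | hy
        · exact Or.inl ⟨hd.1, a, ha, had⟩
        · by_cases h3 : ∃ x ∈ A, N x y
          · exact Or.inl ⟨hc y hy h3, h3⟩
          · exact Or.inr ⟨hy, h3⟩

end QFW

namespace QFW
open Set

/-- the orbit of `c` under `σ` until it reaches `Y` -/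
def Orb (Y : Set V) (σ : V → V) (c : V) : Set V :=
  {y | ∃ i, y = σ^[i] c ∧ ∀ j < i, σ^[j] c ∉ Y}

lemma Orb.base {Y : Set V} {σ : V → V} {c : V} : c ∈ Orb Y σ c := ⟨0, rfl, fun j hj => by omega⟩

lemma Orb.step {Y : Set V} {σ : V → V} {c y : V} (hy : y ∈ Orb Y σ c) (hyY : y ∉ Y) :
    σ y ∈ Orb Y σ c := by
  obtain ⟨i, rfl, hi⟩ := hy
  refine ⟨i+1, by rw [Function.iterate_succ_apply'], ?_⟩
  intro j hj
  rcases Nat.lt_succ_iff_lt_or_eq.1 hj with h | h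
  · exact hi j h
  · rw [h]; exact hyY

lemma Lk.back {N : V → V → Prop} {Y C : Set V} {σ : V → V} (h : Lk N Y C σ) {c x : V} (hc : c ∈ C)
    (hx : x ∉ Y) (hxo : σ x ∈ Orb Y σ c) : x ∈ Orb Y σ c := by
  obtain ⟨i, he, hi⟩ := hxo
  rcases i with _ | i
  · exact absurd (he ▸ hc) (h.avoid x hx)
  · rw [Function.iterate_succ_apply'] at he
    exact ⟨i, h.inj hx (hi i (by omega)) he, fun j hj => hi j (by omega)⟩

lemma Lk.orb_eq {N : V → V → Prop} {Y C : Set V} {σ : V → V} (h : Lk N Y C σ) {c d y : V}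
    (hc : c ∈ C) (hd : d ∈ C) (h1 : y ∈ Orb Y σ c) (h2 : y ∈ Orb Y σ d) : c = d := by
  obtain ⟨i, he, hi⟩ := h1
  induction i generalizing y with
  | zero =>
    obtain ⟨j, hj, hj'⟩ := h2
    simp at he
    subst he
    rcases j with _ | j
    · simpa using hj
    · rw [Function.iterate_succ_apply'] at hj
      exact absurd (hj ▸ hc) (h.avoid _ (hj' j (by omega)))
  | succ i ih =>
    rw [Function.iterate_succ_apply'] at he
    refine ih (y := σ^[i] c) (h.back hd (hi i (by omega)) (he ▸ h2)) rfl (fun j hj => hi j (by omega))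

lemma Lk.orb_C {N : V → V → Prop} {Y C : Set V} {σ : V → V} (h : Lk N Y C σ) {c y : V}
    (hc : c ∈ C) (h1 : y ∈ Orb Y σ c) (hy : y ∈ C) : y = c := h.orb_eq hy hc Orb.base h1

lemma Lk.reach {N : V → V → Prop} {Y C : Set V} {σ : V → V} (h : Lk N Y C σ) {c : V}
    (hc : c ∈ C) : ∃ i, σ^[i] c ∈ Y := by
  by_contra hcon
  push Not at hcon
  have aux : ∀ i k : ℕ, σ^[i] c = σ^[i+k] c → k = 0 := by
    intro i
    induction i with
    | zero =>
      intro k hk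
      rcases k with _ | k
      · rfl
      · rw [Nat.zero_add, Function.iterate_succ_apply'] at hk
        simp at hk
        exact absurd (hk ▸ hc) (h.avoid _ (hcon k))
    | succ i ih =>
      intro k hk
      rw [show i + 1 + k = (i + k) + 1 by omega, Function.iterate_succ_apply',
        Function.iterate_succ_apply'] at hk
      exact ih k (h.inj (hcon _) (hcon _) hk)
  refine h.noray (fun n => σ^[n] c) ?_ hcon (fun n => Function.iterate_succ_apply' _ _ _)
  intro a b hab
  rcases le_total a b with hle | hle
  · have := aux a (b - a) (by rw [show a + (b - a) = b by omega]; exact hab)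
    omega
  · have := aux b (a - b) (by rw [show b + (a - b) = a by omega]; exact hab.symm)
    omega

lemma Lk.orb_fin {N : V → V → Prop} {Y C : Set V} {σ : V → V} (h : Lk N Y C σ) {c : V}
    (hc : c ∈ C) : (Orb Y σ c).Finite := by
  obtain ⟨i, hi⟩ := h.reach hc
  apply ((finite_Iic i).image (fun j => σ^[j] c)).subset
  rintro y ⟨j, rfl, hj⟩
  refine ⟨j, ?_, rfl⟩
  by_contra hcon
  simp at hcon
  exact hj i hcon hi

/-- deleting a vertex set from a web -/
def Nd (N : V → V → Prop) (S : Set V) (a b : V) : Prop := a = b ∨ (N a b ∧ a ∉ S ∧ b ∉ S)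

lemma Nd_refl (N : V → V → Prop) (S : Set V) (x : V) : Nd N S x x := Or.inl rfl

lemma Nd_Nd (N : V → V → Prop) (S R : Set V) : Nd (Nd N S) R = Nd N (S ∪ R) := by
  funext a b
  simp only [Nd, mem_union, eq_iff_iff]
  tauto

lemma Nd_empty {N : V → V → Prop} (hN : ∀ x, N x x) : Nd N ∅ = N := by
  funext a b
  simp only [Nd, mem_empty_iff_false, not_false_eq_true, and_true, eq_iff_iff]
  constructor
  · rintro (rfl | h)
    · exact hN _
    · exact h
  · exact Or.inr

lemma Lk.disj {N : V → V → Prop} {Y C S : Set V} {σ : V → V} (h : Lk (Nd N S) (Y \ S) C σ) :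
    Disjoint C S := by
  rw [Set.disjoint_left]
  intro c hc hcS
  have h0 : c ∉ Y \ S := fun h => h.2 hcS
  rcases h.adj c h0 with h1 | h1
  · exact h.avoid c h0 (h1 ▸ hc)
  · exact h1.2.1 hcS

lemma Lk.orb_disj {N : V → V → Prop} {Y C S : Set V} {σ : V → V} (h : Lk (Nd N S) (Y \ S) C σ)
    {c : V} (hc : c ∈ C) : Disjoint (Orb (Y \ S) σ c) S := by
  rw [Set.disjoint_left]
  rintro y ⟨i, rfl, hi⟩
  induction i with
  | zero => exact Set.disjoint_left.1 h.disj hc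
  | succ i ih =>
    have h0 := ih (fun j hj => hi j (by omega))
    rw [Function.iterate_succ_apply']
    rcases h.adj _ (hi i (by omega)) with h1 | h1
    · rw [← h1]; exact h0
    · exact h1.2.2

open Classical in
theorem Lk.restrict {N : V → V → Prop} {Y C K R : Set V} {σ : V → V} (h : Lk N Y C σ) (hK : K ⊆ C)
    (hR : ∀ c ∈ K, Disjoint (Orb Y σ c) R) : Jn (Nd N R) (Y \ R) K := by
  set U : Set V := {y | ∃ c ∈ K, y ∈ Orb Y σ c} with hU
  have UR : ∀ y ∈ U, y ∉ R := fun y ⟨c, hc, hy⟩ => Set.disjoint_left.1 (hR c hc) hy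
  have UY : ∀ y ∈ U, y ∉ Y \ R → y ∉ Y := fun y hy h1 h2 => h1 ⟨h2, UR y hy⟩
  have US : ∀ y ∈ U, y ∉ Y → σ y ∈ U := fun y ⟨c, hc, hy⟩ h1 => ⟨c, hc, Orb.step hy h1⟩
  have KU : K ⊆ U := fun c hc => ⟨c, hc, Orb.base⟩
  refine ⟨fun y => if y ∈ U then σ y else y, ?_, ?_, ?_, ?_⟩
  · intro a ha b hb hab
    by_cases h1 : a ∈ U <;> by_cases h2 : b ∈ U <;> simp only [h1, h2, if_true, if_false] at hab
    · exact h.inj (UY a h1 ha) (UY b h2 hb) hab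
    · exact absurd (hab ▸ US a h1 (UY a h1 ha)) h2
    · exact absurd (hab ▸ US b h2 (UY b h2 hb)) h1
    · exact hab
  · intro x hx
    by_cases h1 : x ∈ U <;> simp only [h1, if_true, if_false]
    · have h2 := UY x h1 hx
      exact Or.inr ⟨h.adj x h2, UR x h1, UR _ (US x h1 h2)⟩
    · exact Or.inl rfl
  · intro x hx
    by_cases h1 : x ∈ U <;> simp only [h1, if_true, if_false]
    · exact fun h3 => h.avoid x (UY x h1 hx) (hK h3)
    · exact fun h3 => h1 (KU h3)
  · intro x hx hY hs
    have hall : ∀ n, x n ∈ U := by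
      intro n
      by_contra hc
      have := hs n
      simp only [hc, if_false] at this
      have := hx this
      omega
    exact h.noray x hx (fun n => UY _ (hall n) (hY n)) (fun n => by rw [hs n]; simp [hall n])

/-- finite extendability of `J` into the pool `X`. -/
def FE (N : V → V → Prop) (Y J X : Set V) : Prop :=
  ∀ H : Finset V, ↑H ⊆ X → Jn N Y (J ∪ ↑H)

end QFW

namespace QFW
open Set

open Classical in
theorem freeze_a {N : V → V → Prop} {Y J X : Set V} (hFE : FE N Y J X)
    (hJX : Disjoint J X) {x : V} (hx : x ∈ J) {R : Set V} (hRf : R.Finite) (hxR : x ∈ R)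
    (hJ' : Jn (Nd N R) (Y \ R) (J \ {x})) (H : Finset V) (hH : ↑H ⊆ X) :
    ∃ I : Finset V, I ⊆ H ∧ Jn (Nd N R) (Y \ R) (J \ {x} ∪ ↑I) ∧ H.card ≤ I.card + R.ncard := by
  obtain ⟨σ, hσ⟩ := hFE H hH
  set Bad : Set V := {c ∈ J ∪ ↑H | ¬ Disjoint (Orb Y σ c) R} with hBad
  have hb : ∀ c ∈ Bad, ∃ y ∈ R, y ∈ Orb Y σ c := by
    rintro c ⟨_, hc⟩
    rw [Set.not_disjoint_iff] at hc
    obtain ⟨y, h1, h2⟩ := hc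
    exact ⟨y, h2, h1⟩
  choose! f hfR hfO using hb
  have hfinj : InjOn f Bad := by
    intro c hc d hd hcd
    exact hσ.orb_eq hc.1 hd.1 (hfO c hc) (hcd ▸ hfO d hd)
  have hBadf : Bad.Finite := Set.Finite.of_injOn hfR hfinj hRf
  have hBadc : Bad.ncard ≤ R.ncard := Set.ncard_le_ncard_of_injOn f hfR hfinj hRf
  have hxB : x ∈ Bad := ⟨Or.inl hx, fun hd => Set.disjoint_left.1 hd Orb.base hxR⟩
  have hK : Jn (Nd N R) (Y \ R) ((J ∪ ↑H) \ Bad) := by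
    refine hσ.restrict sdiff_subset ?_
    rintro c ⟨hc, hcb⟩
    by_contra hcon
    exact hcb ⟨hc, hcon⟩
  -- a largest I
  obtain ⟨I, hI, hImax⟩ := Finset.exists_max_image
    (H.powerset.filter (fun I : Finset V => Jn (Nd N R) (Y \ R) (J \ {x} ∪ ↑I))) Finset.card
    ⟨∅, by simp [hJ']⟩
  rw [Finset.mem_filter, Finset.mem_powerset] at hI
  refine ⟨I, hI.1, hI.2, ?_⟩
  by_contra hlt
  push Not at hlt
  have hXJ : ∀ y ∈ H, y ∉ J := fun y hy hyJ => Set.disjoint_left.1 hJX hyJ (hH hy)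
  have hIH : ∀ y ∈ I, y ∈ H := hI.1
  have e1 : (J \ {x} ∪ ↑I) \ ((J ∪ ↑H) \ Bad) = (J \ {x} ∪ ↑I) ∩ Bad := by
    ext y
    have := hIH y
    simp only [mem_sdiff, mem_union, mem_inter_iff, mem_singleton_iff, Finset.mem_coe]
    tauto
  have e2 : ((J ∪ ↑H) \ Bad) \ (J \ {x} ∪ ↑I) = (↑(H \ I) : Set V) \ Bad := by
    ext y
    have := hIH y
    have := hXJ y
    simp only [mem_sdiff, mem_union, mem_singleton_iff, Finset.mem_coe, Finset.mem_sdiff]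
    constructor
    · rintro ⟨⟨h1, h2⟩, h3⟩
      have : y ≠ x := fun h => h2 (h ▸ hxB)
      tauto
    · tauto
  have f2 : ((↑(H \ I) : Set V)).Finite := Finset.finite_toSet _
  have c1 : ((↑(H \ I) : Set V) \ Bad).ncard + ((↑(H \ I) : Set V) ∩ Bad).ncard
      = H.card - I.card := by
    rw [← Finset.card_sdiff_of_subset hI.1, ← Set.ncard_coe_finset, add_comm]
    exact Set.ncard_inter_add_ncard_sdiff_eq_ncard _ _ f2
  have c2 : ((↑(H \ I) : Set V) ∩ Bad).ncard + ((J \ {x} ∪ ↑I) ∩ Bad).ncard ≤ Bad.ncard := by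
    rw [← Set.ncard_union_eq _ (hBadf.subset inter_subset_right) (hBadf.subset inter_subset_right)]
    · exact Set.ncard_le_ncard (union_subset inter_subset_right inter_subset_right) hBadf
    · rw [Set.disjoint_left]
      rintro y ⟨h1, _⟩ ⟨h2, _⟩
      have := hXJ y
      simp only [mem_sdiff, mem_union, mem_singleton_iff, Finset.mem_coe, Finset.mem_sdiff] at h1 h2
      tauto
  obtain ⟨e, he, hje⟩ := augm (Nd_refl N R) _ hI.2 hK (by rw [e1]; exact hBadf.subset inter_subset_right)
    (by rw [e2]; exact f2.subset sdiff_subset) rfl (by rw [e1, e2]; omega)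
  rw [e2] at he
  have he' := he.1
  simp only [Finset.mem_coe, Finset.mem_sdiff] at he'
  have := hImax (insert e I) (by
    rw [Finset.mem_filter, Finset.mem_powerset]
    refine ⟨Finset.insert_subset he'.1 hI.1, hje.mono ?_⟩
    rw [Finset.coe_insert, Set.union_insert])
  rw [Finset.card_insert_of_notMem he'.2] at this
  omega

open Classical in
theorem freeze_b {N : V → V → Prop} {Y J' X : Set V} (hN : ∀ x, N x x) (hJX : Disjoint J' X)
    (k : ℕ)
    (ha : ∀ H : Finset V, ↑H ⊆ X → ∃ I : Finset V, I ⊆ H ∧ Jn N Y (J' ∪ ↑I) ∧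
      H.card ≤ I.card + k) :
    ∃ Z : Finset V, ↑Z ⊆ X ∧ FE N Y J' (X \ ↑Z) := by
  set Pair : Finset V → Finset V → Prop := fun H I => I ⊆ H ∧ ↑H ⊆ X ∧ Jn N Y (J' ∪ ↑I) ∧
    ∀ z ∈ H \ I, ¬ Jn N Y (insert z (J' ∪ ↑I)) with hPair
  have hb : ∀ H I, Pair H I → (H \ I).card ≤ k := by
    rintro H I ⟨h1, h2, h3, h4⟩
    rw [Finset.card_sdiff_of_subset h1]
    obtain ⟨I', g1, g2, g3⟩ := ha H h2
    by_contra hcon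
    have hXJ : ∀ y ∈ H, y ∉ J' := fun y hy hyJ => Set.disjoint_left.1 hJX hyJ (h2 hy)
    have e1 : (J' ∪ ↑I) \ (J' ∪ ↑I') = (↑(I \ I') : Set V) := by
      ext y
      have := hXJ y
      have := @h1 y
      simp only [mem_sdiff, mem_union, Finset.mem_coe, Finset.mem_sdiff]
      tauto
    have e2 : (J' ∪ ↑I') \ (J' ∪ ↑I) = (↑(I' \ I) : Set V) := by
      ext y
      have := hXJ y
      have := @g1 y
      simp only [mem_sdiff, mem_union, Finset.mem_coe, Finset.mem_sdiff]
      tauto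
    have k1 := Finset.card_sdiff_add_card_inter I I'
    have k2 := Finset.card_sdiff_add_card_inter I' I
    rw [Finset.inter_comm] at k2
    obtain ⟨e, he, hje⟩ := augm hN _ h3 g2 (by rw [e1]; exact Finset.finite_toSet _)
      (by rw [e2]; exact Finset.finite_toSet _) rfl
      (by rw [e1, e2, Set.ncard_coe_finset, Set.ncard_coe_finset]; omega)
    rw [e2] at he
    simp only [Finset.mem_coe, Finset.mem_sdiff] at he
    exact h4 e (by rw [Finset.mem_sdiff]; exact ⟨g1 he.1, he.2⟩) hje
  have h00 : Pair ∅ ∅ := by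
    refine ⟨by simp, by simp, ?_, by simp⟩
    obtain ⟨I, _, h, _⟩ := ha ∅ (by simp)
    exact h.mono (by simp)
  -- the maximal defect
  have hmax : ∃ H I, Pair H I ∧ ∀ H' I', Pair H' I' → (H' \ I').card ≤ (H \ I).card := by
    by_contra hcon
    push Not at hcon
    have : ∀ n, ∃ H I, Pair H I ∧ n ≤ (H \ I).card := by
      intro n
      induction n with
      | zero => exact ⟨∅, ∅, h00, by simp⟩
      | succ n ih =>
        obtain ⟨H, I, h1, h2⟩ := ih
        obtain ⟨H', I', h3, h4⟩ := hcon H I h1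
        exact ⟨H', I', h3, by omega⟩
    obtain ⟨H, I, h1, h2⟩ := this (k+1)
    have := hb H I h1
    omega
  obtain ⟨H0, I0, h0, hm⟩ := hmax
  refine ⟨H0 \ I0, fun y hy => h0.2.1 (by simp at hy; exact hy.1), ?_⟩
  intro H hH
  obtain ⟨I, hI, hImax⟩ := Finset.exists_max_image
    ((H ∪ H0).powerset.filter (fun I : Finset V => I0 ⊆ I ∧ Jn N Y (J' ∪ ↑I))) Finset.card
    ⟨I0, by
      rw [Finset.mem_filter, Finset.mem_powerset]
      exact ⟨h0.1.trans Finset.subset_union_right, subset_rfl, h0.2.2.1⟩⟩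
  rw [Finset.mem_filter, Finset.mem_powerset] at hI
  have hp : Pair (H ∪ H0) I := by
    refine ⟨hI.1, ?_, hI.2.2, ?_⟩
    · rw [Finset.coe_union]; exact union_subset (fun y hy => (hH hy).1) h0.2.1
    · intro z hz hj
      rw [Finset.mem_sdiff] at hz
      have := hImax (insert z I) (by
        rw [Finset.mem_filter, Finset.mem_powerset]
        refine ⟨Finset.insert_subset hz.1 hI.1, hI.2.1.trans (Finset.subset_insert _ _), hj.mono ?_⟩
        rw [Finset.coe_insert, Set.union_insert])
      rw [Finset.card_insert_of_notMem hz.2] at this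
      omega
  have hZ : H0 \ I0 ⊆ (H ∪ H0) \ I := by
    intro z hz
    have hz' := Finset.mem_sdiff.1 hz
    rw [Finset.mem_sdiff, Finset.mem_union]
    refine ⟨Or.inr hz'.1, fun hzI => h0.2.2.2 z hz (hI.2.2.mono ?_)⟩
    intro y hy
    rcases hy with rfl | hy | hy
    · exact Or.inr hzI
    · exact Or.inl hy
    · exact Or.inr (hI.2.1 hy)
  have hZe := Finset.eq_of_subset_of_card_le hZ (hm _ _ hp)
  refine hI.2.2.mono (union_subset_union_right _ ?_)
  intro y hy
  by_contra hyI
  exact (hH hy).2 (by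
    rw [hZe]
    simp only [Finset.coe_sdiff, Finset.coe_union, mem_sdiff, mem_union]
    exact ⟨Or.inl hy, hyI⟩)

/-- a finite vertex set containing a path from `x` to `Y` -/
def PS (N : V → V → Prop) (Y : Set V) (x : V) (R : Set V) : Prop :=
  ∃ σ : V → V, x ∈ R ∧ InjOn σ (R \ Y) ∧ ∀ y ∈ R, y ∉ Y → N y (σ y) ∧ σ y ∈ R ∧ σ y ≠ x

theorem freeze {N : V → V → Prop} (hN : ∀ x, N x x) {Y S J X : Set V}
    (hFE : FE (Nd N S) (Y \ S) J X) (hJX : Disjoint J X) {x : V} (hx : x ∈ J) :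
    ∃ (R : Set V) (Z : Finset V), R.Finite ∧ Disjoint R S ∧ PS N Y x R ∧
      FE (Nd N (S ∪ R)) (Y \ (S ∪ R)) (J \ {x}) (X \ ↑Z) := by
  obtain ⟨σ, hσ⟩ := hFE ∅ (by simp)
  simp only [Finset.coe_empty, union_empty] at hσ
  have hRf := hσ.orb_fin hx
  have hd := hσ.orb_disj hx
  have hJ' : Jn (Nd (Nd N S) (Orb (Y \ S) σ x)) ((Y \ S) \ Orb (Y \ S) σ x) (J \ {x}) := by
    refine hσ.restrict sdiff_subset ?_
    intro c hc
    rw [Set.disjoint_left]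
    intro y h1 h2
    exact hc.2 (hσ.orb_eq hc.1 hx h1 h2)
  obtain ⟨Z, hZ, hZF⟩ := freeze_b (Nd_refl (Nd N S) (Orb (Y \ S) σ x))
    (hJX.mono_left sdiff_subset) _ (freeze_a hFE hJX hx hRf Orb.base hJ')
  refine ⟨Orb (Y \ S) σ x, Z, hRf, hd, ⟨σ, Orb.base, ?_, ?_⟩, ?_⟩
  · refine hσ.inj.mono ?_
    rintro y ⟨h1, h2⟩ h3
    exact h2 h3.1
  · intro y hy hyY
    have h3 : y ∉ Y \ S := fun h => hyY h.1
    refine ⟨?_, Orb.step hy h3, fun h => hσ.avoid y h3 (h ▸ hx)⟩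
    rcases hσ.adj y h3 with h | h
    · rw [← h]; exact hN y
    · exact h.1
  · rw [Nd_Nd, Set.sdiff_sdiff] at hZF
    exact hZF

end QFW

namespace QFW
open Set

open Classical in
theorem glue {N : V → V → Prop} (hN : ∀ x, N x x) {Y : Set V} {ι : Type*} (x : ι → V)
    (R : ι → Set V) (hf : ∀ i, (R i).Finite) (hd : ∀ i j, i ≠ j → Disjoint (R i) (R j))
    (hP : ∀ i, PS N Y (x i) (R i)) : Jn N Y (range x) := by
  choose σ hx hinj hs using hP
  have huniq : ∀ i j y, y ∈ R i → y ∈ R j → i = j := by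
    intro i j y h1 h2
    by_contra hc
    exact Set.disjoint_left.1 (hd i j hc) h1 h2
  set ρ : V → V := fun y => if h : ∃ i, y ∈ R i then σ h.choose y else y with hρ
  have hρ1 : ∀ i y, y ∈ R i → ρ y = σ i y := by
    intro i y hy
    have h : ∃ i, y ∈ R i := ⟨i, hy⟩
    simp only [hρ, h, dif_pos]
    rw [huniq _ _ _ h.choose_spec hy]
  have hρ2 : ∀ y, (¬ ∃ i, y ∈ R i) → ρ y = y := by
    intro y h
    simp only [hρ, h, dif_neg, not_false_eq_true]
  refine ⟨ρ, ?_, ?_, ?_, ?_⟩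
  · intro a ha b hb hab
    by_cases h1 : ∃ i, a ∈ R i <;> by_cases h2 : ∃ i, b ∈ R i
    · obtain ⟨i, hi⟩ := h1
      obtain ⟨j, hj⟩ := h2
      rw [hρ1 i a hi, hρ1 j b hj] at hab
      have : i = j := huniq i j _ (hs i a hi ha).2.1 (hab ▸ (hs j b hj hb).2.1)
      subst this
      exact hinj i ⟨hi, ha⟩ ⟨hj, hb⟩ hab
    · obtain ⟨i, hi⟩ := h1
      rw [hρ1 i a hi, hρ2 b h2] at hab
      exact absurd ⟨i, hab ▸ (hs i a hi ha).2.1⟩ h2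
    · obtain ⟨i, hi⟩ := h2
      rw [hρ1 i b hi, hρ2 a h1] at hab
      exact absurd ⟨i, hab ▸ (hs i b hi hb).2.1⟩ h1
    · rwa [hρ2 a h1, hρ2 b h2] at hab
  · intro y hy
    by_cases h1 : ∃ i, y ∈ R i
    · obtain ⟨i, hi⟩ := h1
      rw [hρ1 i y hi]; exact (hs i y hi hy).1
    · rw [hρ2 y h1]; exact hN y
  · rintro y hy ⟨j, hj⟩
    by_cases h1 : ∃ i, y ∈ R i
    · obtain ⟨i, hi⟩ := h1
      rw [hρ1 i y hi] at hj
      have : i = j := huniq i j _ (hs i y hi hy).2.1 (hj ▸ hx j)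
      subst this
      exact (hs i y hi hy).2.2 hj.symm
    · rw [hρ2 y h1] at hj
      exact h1 ⟨j, hj ▸ hx j⟩
  · intro u hu hY hstep
    by_cases h1 : ∃ i, u 0 ∈ R i
    · obtain ⟨i, hi⟩ := h1
      have hall : ∀ n, u n ∈ R i := by
        intro n
        induction n with
        | zero => exact hi
        | succ n ih => rw [hstep n, hρ1 i _ ih]; exact (hs i _ ih (hY n)).2.1
      exact Set.infinite_of_injective_forall_mem hu hall (hf i)
    · have := hstep 0
      rw [hρ2 _ h1] at this
      have := hu this
      omega

/-- states of the recursion -/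
structure St (N : V → V → Prop) (Y : Set V) (Q : ℕ → Prop) (B : ℕ → Set V) where
  S : Set V
  J : Set V
  X : Set V
  fin : S.Finite
  fe : FE (Nd N S) (Y \ S) J X
  dis : Disjoint J X
  inf : ∀ l, Q l → (B l ∩ X).Infinite

theorem FE.move {N : V → V → Prop} {Y J X F : Set V} (h : FE N Y J X) (hF : F.Finite)
    (hFX : F ⊆ X) : FE N Y (J ∪ F) (X \ F) := by
  classical
  intro H hH
  refine (h (hF.toFinset ∪ H) ?_).mono ?_
  · rw [Finset.coe_union, Set.Finite.coe_toFinset]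
    exact union_subset hFX (hH.trans sdiff_subset)
  · rw [Finset.coe_union, Set.Finite.coe_toFinset, union_assoc]

theorem FE.mono {N : V → V → Prop} {Y J X J' X' : Set V} (h : FE N Y J X) (hJ : J' ⊆ J)
    (hX : X' ⊆ X) : FE N Y J' X' := fun H hH => (h H (hH.trans hX)).mono
      (union_subset_union_left _ hJ)

theorem St.next {N : V → V → Prop} (hN : ∀ x, N x x) {Y : Set V} {Q : ℕ → Prop} {B : ℕ → Set V}
    (s : St N Y Q B) (x : V) (l : ℕ) : ∃ (t : St N Y Q B) (R F : Set V), R.Finite ∧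
    Disjoint R s.S ∧ (x ∈ s.J → PS N Y x R) ∧ t.S = s.S ∪ R ∧ t.J = s.J \ {x} ∪ F ∧ F ⊆ s.X ∧
    (Q l → (B l ∩ F).Nonempty) ∧ t.X ⊆ s.X := by
  have h1 : ∃ (R : Set V) (Z : Finset V), R.Finite ∧ Disjoint R s.S ∧ (x ∈ s.J → PS N Y x R) ∧
      FE (Nd N (s.S ∪ R)) (Y \ (s.S ∪ R)) (s.J \ {x}) (s.X \ ↑Z) := by
    by_cases hx : x ∈ s.J
    · obtain ⟨R, Z, a, b, c, d⟩ := freeze hN s.fe s.dis hx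
      exact ⟨R, Z, a, b, fun _ => c, d⟩
    · refine ⟨∅, ∅, finite_empty, by simp, fun h => absurd h hx, ?_⟩
      rw [union_empty]
      exact s.fe.mono sdiff_subset sdiff_subset
  obtain ⟨R, Z, a, b, c, d⟩ := h1
  have h2 : ∃ F : Set V, F.Finite ∧ F ⊆ s.X \ ↑Z ∧ (Q l → (B l ∩ F).Nonempty) := by
    by_cases hQ : Q l
    · have := ((s.inf l hQ).sdiff Z.finite_toSet).nonempty
      obtain ⟨f, hf, hfZ⟩ := this
      exact ⟨{f}, finite_singleton f, by simpa using ⟨hf.2, hfZ⟩, fun _ => ⟨f, hf.1, rfl⟩⟩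
    · exact ⟨∅, finite_empty, by simp, fun h => absurd h hQ⟩
  obtain ⟨F, f1, f2, f3⟩ := h2
  refine ⟨⟨s.S ∪ R, s.J \ {x} ∪ F, (s.X \ ↑Z) \ F, s.fin.union a, d.move f1 f2, ?_, ?_⟩, R, F, a, b,
    c, rfl, rfl, f2.trans sdiff_subset, f3, sdiff_subset.trans sdiff_subset⟩
  · rw [Set.disjoint_left]
    rintro y (h | h) h'
    · exact Set.disjoint_left.1 s.dis h.1 h'.1.1
    · exact h'.2 h
  · intro m hm
    refine (((s.inf m hm).sdiff Z.finite_toSet).sdiff f1).mono ?_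
    rintro y ⟨⟨h, h'⟩, h''⟩
    exact ⟨h.1, ⟨h.2, h'⟩, h''⟩

lemma exists_enum [Countable V] [Nonempty V] : ∃ en : ℕ → V, ∀ v n, ∃ m, n ≤ m ∧ en m = v := by
  obtain ⟨f, hf⟩ := exists_surjective_nat V
  refine ⟨fun m => f (Nat.unpair m).1, fun v n => ?_⟩
  obtain ⟨k, hk⟩ := hf v
  exact ⟨Nat.pair k n, Nat.right_le_pair _ _, by simp [hk]⟩

theorem hitting [Countable V] [Nonempty V] {N : V → V → Prop} (hN : ∀ x, N x x) {Y J X : Set V}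
    (hFE : FE N Y J X) (hJX : Disjoint J X) (Q : ℕ → Prop) (B : ℕ → Set V)
    (hB : ∀ l, Q l → (B l ∩ X).Infinite) :
    ∃ I : Set V, J ⊆ I ∧ I ⊆ J ∪ X ∧ Jn N Y I ∧ ∀ l, Q l → (B l ∩ I).Nonempty := by
  obtain ⟨en, hen⟩ := exists_enum (V := V)
  choose nxt Rn Fn h1 h2 h3 h4 h5 h6 h7 h8 using
    fun (s : St N Y Q B) (x : V) (l : ℕ) => St.next hN s x l
  let s0 : St N Y Q B := ⟨∅, J, X, finite_empty, by rw [Nd_empty hN, sdiff_empty]; exact hFE,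
    hJX, hB⟩
  let st : ℕ → St N Y Q B := fun n => Nat.rec s0 (fun n s => nxt s (en n) n) n
  have st0 : st 0 = s0 := rfl
  have sts : ∀ n, st (n+1) = nxt (st n) (en n) n := fun n => rfl
  have hX : ∀ n, (st n).X ⊆ X := by
    intro n
    induction n with
    | zero => exact subset_rfl
    | succ n ih => rw [sts]; exact (h8 _ _ _).trans ih
  have hJ : ∀ n, (st n).J ⊆ J ∪ X := by
    intro n
    induction n with
    | zero => exact subset_union_left
    | succ n ih =>
      rw [sts, h5]
      exact union_subset (sdiff_subset.trans ih) ((h6 _ _ _).trans ((hX n).trans subset_union_right))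
  have hS : ∀ n m, n ≤ m → (st n).S ⊆ (st m).S := by
    intro n m hnm
    induction m, hnm using Nat.le_induction with
    | base => exact subset_rfl
    | succ m _ ih => rw [sts, h4]; exact ih.trans subset_union_left
  have hJs : ∀ n, (st n).J \ {en n} ⊆ (st (n+1)).J := by
    intro n
    rw [sts, h5]; exact subset_union_left
  let ι := {n : ℕ // en n ∈ (st n).J}
  have hgl := glue hN (Y := Y) (fun i : ι => en i.1) (fun i : ι => Rn (st i.1) (en i.1) i.1)
    (fun i => h1 _ _ _) (by
      have key : ∀ a b : ℕ, a < b → Disjoint (Rn (st a) (en a) a) (Rn (st b) (en b) b) := by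
        intro a b hab
        refine (h2 (st b) (en b) b).symm.mono_left ?_
        refine Subset.trans ?_ (hS (a+1) b hab)
        rw [sts, h4]; exact subset_union_right
      intro i j hij
      rcases lt_trichotomy i.1 j.1 with h | h | h
      · exact key _ _ h
      · exact absurd (Subtype.ext h) hij
      · exact (key _ _ h).symm) (fun i => h3 _ _ _ i.2)
  have hcov : ∀ n, (st n).J ⊆ range (fun i : ι => en i.1) := by
    intro n y hy
    obtain ⟨m, hm, hme⟩ := hen y n
    have : ∀ k n, n + k = m → y ∈ (st n).J → y ∈ range (fun i : ι => en i.1) := by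
      intro k
      induction k with
      | zero =>
        intro n hn hy
        have : n = m := by omega
        subst this
        exact ⟨⟨n, by rw [hme]; exact hy⟩, hme⟩
      | succ k ih =>
        intro n hn hy
        by_cases he : y = en n
        · exact ⟨⟨n, he ▸ hy⟩, he.symm⟩
        · exact ih (n+1) (by omega) (hJs n ⟨hy, he⟩)
    exact this (m - n) n (by omega) hy
  refine ⟨_, hcov 0, ?_, hgl, ?_⟩
  · rintro _ ⟨i, rfl⟩
    exact hJ _ i.2
  · intro l hl
    obtain ⟨f, hf, hf'⟩ := h7 (st l) (en l) l hl
    refine ⟨f, hf, hcov (l+1) ?_⟩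
    rw [sts, h5]; exact Or.inr hf'

end QFW

namespace QFW
open Set

/-- an honest pair for `(A, f)` -/
structure Honest (N : V → V → Prop) (Y A : Set V) (f : V) (T : Set V) (τ : V → V) : Prop where
  inj : InjOn τ (Yᶜ \ T)
  adj : ∀ x, x ∉ Y → x ∉ T → N x (τ x)
  avoid : ∀ x, x ∉ Y → x ∉ T → τ x ∉ A
  sep : ∀ x, x ∉ Y → x ∉ T → ∀ t ∈ T, ¬ N t (τ x)
  sepf : ∀ t ∈ T, ¬ N t f
  noray : NoRay Y τ

open Classical in
theorem nested [Countable V] {N : V → V → Prop} (hN : ∀ x, N x x) {Y C L : Set V}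
    (hC : Jn N Y C) (hL : ∀ f ∈ L, ∃ T τ, Honest N Y (C ∪ L) f T τ) : Jn N Y (C ∪ L) := by
  obtain ⟨P, hP⟩ := hC
  choose! T τ hT using hL
  obtain ⟨e, he⟩ := exists_injective_nat V
  have hg : ∀ y, (∃ f ∈ L, y ∉ T f) → ∃ f, (f ∈ L ∧ y ∉ T f) ∧ ∀ f', (f' ∈ L ∧ y ∉ T f') → e f ≤ e f' := by
    intro y hy
    obtain ⟨f, h1, h2⟩ := hy
    have := WellFounded.has_min (measure e).wf {f | f ∈ L ∧ y ∉ T f} ⟨f, h1, h2⟩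
    obtain ⟨f, hf, hmin⟩ := this
    exact ⟨f, hf, fun f' hf' => not_lt.1 (hmin f' hf')⟩
  choose! g hg1 hg2 using hg
  set cl : V → Prop := fun y => ∃ f ∈ L, y ∉ T f with hcl
  set ρ : V → V := fun y => if cl y then τ (g y) y else P y with hρ
  have r1 : ∀ y, cl y → ρ y = τ (g y) y := fun y hy => by simp only [hρ, hy, if_true]
  have r2 : ∀ y, ¬ cl y → ρ y = P y := fun y hy => by simp only [hρ, hy, if_false]
  have hadj : ∀ y, y ∉ Y → N y (ρ y) := by
    intro y hy
    by_cases h : cl y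
    · rw [r1 y h]; exact (hT _ (hg1 y h).1).adj y hy (hg1 y h).2
    · rw [r2 y h]; exact hP.adj y hy
  have hsep : ∀ y, y ∉ Y → cl y → ∀ t ∈ T (g y), ¬ N t (ρ y) := by
    intro y hy h t ht
    rw [r1 y h]; exact (hT _ (hg1 y h).1).sep y hy (hg1 y h).2 t ht
  refine ⟨ρ, ?_, hadj, ?_, ?_⟩
  · have aux : ∀ a b, a ∉ Y → b ∉ Y → ρ a = ρ b → cl a → b ∉ T (g a) := by
      intro a b ha hb hab hca hc
      exact hsep a ha hca b hc (hab ▸ hadj b hb)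
    intro a ha b hb hab
    by_cases h1 : cl a
    · have h2 : b ∉ T (g a) := aux a b ha hb hab h1
      have hcb : cl b := ⟨g a, (hg1 a h1).1, h2⟩
      have h3 : a ∉ T (g b) := aux b a hb ha hab.symm hcb
      have : g a = g b := he (le_antisymm (hg2 a h1 _ ⟨(hg1 b hcb).1, h3⟩)
        (hg2 b hcb _ ⟨(hg1 a h1).1, h2⟩))
      rw [r1 a h1, r1 b hcb, this] at hab
      exact (hT _ (hg1 b hcb).1).inj ⟨ha, h3⟩ ⟨hb, (hg1 b hcb).2⟩ hab
    · by_cases h2 : cl b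
      · exact absurd ⟨g b, (hg1 b h2).1, aux b a hb ha hab.symm h2⟩ h1
      · rw [r2 a h1, r2 b h2] at hab
        exact hP.inj ha hb hab
  · intro y hy
    by_cases h : cl y
    · rw [r1 y h]; exact (hT _ (hg1 y h).1).avoid y hy (hg1 y h).2
    · rw [r2 y h]
      rintro (h1 | h1)
      · exact hP.avoid y hy h1
      · have : y ∈ T (P y) := by
          by_contra hc
          exact h ⟨_, h1, hc⟩
        exact (hT _ h1).sepf y this (hP.adj y hy)
  · intro x hx hY hs
    have hstep : ∀ n, cl (x n) → x (n+1) ∉ T (g (x n)) := by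
      intro n hn hc
      exact hsep (x n) (hY n) hn _ hc (hs n ▸ hN _)
    by_cases h0 : ∃ n, cl (x n)
    · obtain ⟨n0, hn0⟩ := h0
      have hcl' : ∀ n, n0 ≤ n → cl (x n) := by
        intro n hn
        induction n, hn using Nat.le_induction with
        | base => exact hn0
        | succ n hn ih => exact ⟨g (x n), (hg1 _ ih).1, hstep n ih⟩
      have hle : ∀ n, n0 ≤ n → e (g (x (n+1))) ≤ e (g (x n)) := fun n hn =>
        hg2 _ (hcl' (n+1) (by omega)) _ ⟨(hg1 _ (hcl' n hn)).1, hstep n (hcl' n hn)⟩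
      have hanti : Antitone (fun k => e (g (x (n0 + k)))) :=
        antitone_nat_of_succ_le (fun k => hle (n0 + k) (by omega))
      obtain ⟨_, ⟨k, rfl⟩, hk⟩ := WellFounded.has_min (wellFounded_lt (α := ℕ))
        (range (fun k => e (g (x (n0 + k))))) ⟨_, 0, rfl⟩
      have hconst : ∀ n, n0 + k ≤ n → g (x n) = g (x (n0 + k)) := by
        intro n hn
        apply he
        obtain ⟨j, rfl⟩ : ∃ j, n = n0 + j := ⟨n - n0, by omega⟩
        exact le_antisymm (hanti (show k ≤ j by omega)) (not_lt.1 (hk _ ⟨j, rfl⟩))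
      have hkL := (hg1 _ (hcl' (n0 + k) (by omega))).1
      refine (hT _ hkL).noray.eventually x hx hY (n0 + k) ?_
      intro n hn
      rw [hs n, r1 _ (hcl' n (by omega)), hconst n hn]
    · push Not at h0
      exact hP.noray x hx hY (fun n => by rw [hs n, r2 _ (h0 n)])

/-- states of the selection recursion -/
structure Se (X : Set V) (F : ℕ → Set V) (QF : ℕ → Prop) where
  L : Set V
  Δ : Set V
  Lfin : L.Finite
  Δfin : Δ.Finite
  LX : L ⊆ X
  dis : Disjoint L Δ
  ne : ∀ m, QF m → (F m \ Δ).Nonempty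
  one : ∀ f ∈ L, ∃ m, QF m ∧ F m \ Δ = {f}

theorem Se.next {X : Set V} {F : ℕ → Set V} {QF : ℕ → Prop} (hF : ∀ m, QF m → (F m).Finite)
    (hFX : ∀ m, QF m → F m ⊆ X) (B : ℕ → Set V) (QB : ℕ → Prop) (s : Se X F QF) (m : ℕ) :
    ∃ t : Se X F QF, s.L ⊆ t.L ∧ s.Δ ⊆ t.Δ ∧ (QF m → (F m ∩ t.L).Nonempty) ∧
      ∀ l, QB l → Disjoint (B l) t.L → ∀ y ∈ B l, y ∈ t.Δ → y ∉ s.Δ →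
        ∃ l' < l, QB l' ∧ Disjoint (B l') s.L ∧ (B l' ∩ t.L).Nonempty := by
  by_cases hm : QF m ∧ Disjoint (F m) s.L
  swap
  · refine ⟨s, subset_rfl, subset_rfl, ?_, fun l _ _ y _ h1 h2 => absurd h1 h2⟩
    intro hq
    by_contra hc
    exact hm ⟨hq, Set.disjoint_iff_inter_eq_empty.2 (Set.not_nonempty_iff_eq_empty.1 hc)⟩
  obtain ⟨hq, hd⟩ := hm
  obtain ⟨k, ⟨hk, hkm⟩, hmin⟩ := WellFounded.has_min
    (measure (fun k => (F k \ s.Δ).ncard)).wf {k | QF k ∧ F k \ s.Δ ⊆ F m \ s.Δ}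
    ⟨m, hq, subset_rfl⟩
  have hmin' : ∀ k', QF k' → F k' \ s.Δ ⊆ F m \ s.Δ → (F k \ s.Δ).ncard ≤ (F k' \ s.Δ).ncard :=
    fun k' h1 h2 => not_lt.1 (hmin k' ⟨h1, h2⟩)
  have hGfin : (F k \ s.Δ).Finite := (hF k hk).subset sdiff_subset
  have hch : ∃ f ∈ F k \ s.Δ, ∀ l, QB l → Disjoint (B l) s.L → (B l ∩ (F k \ s.Δ)).Nonempty →
      ∃ l' ≤ l, QB l' ∧ Disjoint (B l') s.L ∧ f ∈ B l' := by
    by_cases h : ∃ l, QB l ∧ Disjoint (B l) s.L ∧ (B l ∩ (F k \ s.Δ)).Nonempty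
    · classical
      obtain ⟨h1, h2, f, h3, h4⟩ := Nat.find_spec h
      exact ⟨f, h4, fun l a b c => ⟨Nat.find h, Nat.find_min' h ⟨a, b, c⟩, h1, h2, h3⟩⟩
    · obtain ⟨f, hf⟩ := s.ne k hk
      exact ⟨f, hf, fun l a b c => absurd ⟨l, a, b, c⟩ h⟩
  obtain ⟨f, hf, hfl⟩ := hch
  have hGL : ∀ y ∈ F k \ s.Δ, y ∉ s.L := fun y hy h => Set.disjoint_left.1 hd (hkm hy).1 h
  refine ⟨⟨insert f s.L, s.Δ ∪ ((F k \ s.Δ) \ {f}), s.Lfin.insert f,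
    s.Δfin.union (hGfin.subset sdiff_subset), insert_subset (hFX k hk hf.1) s.LX, ?_, ?_, ?_⟩,
    subset_insert _ _, subset_union_left, fun _ => ⟨f, (hkm hf).1, mem_insert _ _⟩, ?_⟩
  · rw [Set.disjoint_left]
    rintro y (rfl | hy) (h | h)
    · exact hf.2 h
    · exact h.2 rfl
    · exact Set.disjoint_left.1 s.dis hy h
    · exact hGL y h.1 hy
  · intro j hj
    by_contra hc
    rw [Set.not_nonempty_iff_eq_empty, sdiff_eq_empty] at hc
    have hsub : F j \ s.Δ ⊆ (F k \ s.Δ) \ {f} := by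
      rintro y ⟨h1, h2⟩
      rcases hc h1 with h3 | h3
      · exact absurd h3 h2
      · exact h3
    have h1 := hmin' j hj ((hsub.trans sdiff_subset).trans hkm)
    have h2 := ncard_le_ncard hsub (hGfin.subset sdiff_subset)
    rw [ncard_sdiff_singleton_of_mem hf] at h2
    have h3 : 0 < (F k \ s.Δ).ncard := (ncard_pos hGfin).2 ⟨f, hf⟩
    omega
  · intro y hy
    rcases hy with rfl | hy
    · refine ⟨k, hk, ?_⟩
      ext z
      simp only [mem_sdiff, mem_union, mem_singleton_iff]
      constructor
      · rintro ⟨h1, h2⟩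
        by_contra hc
        tauto
      · rintro rfl
        exact ⟨hf.1, fun h => h.elim hf.2 (fun h => h.2 rfl)⟩
    · obtain ⟨j, hj, hje⟩ := s.one y hy
      refine ⟨j, hj, ?_⟩
      rw [← Set.sdiff_sdiff, hje]
      ext z
      simp only [mem_sdiff, mem_singleton_iff]
      constructor
      · exact fun h => h.1
      · rintro rfl
        exact ⟨rfl, fun h => hGL z h.1 hy⟩
  · intro l hl hdl y hy hyt hys
    have hyG : y ∈ F k \ s.Δ := by
      rcases hyt with h | h
      · exact absurd h hys
      · exact h.1
    obtain ⟨l', h1, h2, h3, h4⟩ := hfl l hl (hdl.mono_right (subset_insert _ _)) ⟨y, hy, hyG⟩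
    refine ⟨l', lt_of_le_of_ne h1 ?_, h2, h3, f, h4, mem_insert _ _⟩
    rintro rfl
    exact Set.disjoint_left.1 hdl h4 (mem_insert _ _)

end QFW

namespace QFW
open Set

theorem selection [Countable V] [Nonempty V] {N : V → V → Prop} (hN : ∀ x, N x x) {Y X X' : Set V}
    (hX' : X' ⊆ X) (hFE : FE N Y X' X) (F : ℕ → Set V) (QF : ℕ → Prop)
    (hF : ∀ m, QF m → (F m).Finite) (hFne : ∀ m, QF m → (F m).Nonempty)
    (hFX : ∀ m, QF m → F m ⊆ X)
    (hon : ∀ m, QF m → ∀ A f, A ⊆ X → A ∩ F m = {f} → ∃ T τ, Honest N Y A f T τ)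
    (B : ℕ → Set V) (QB : ℕ → Prop) (hB : ∀ l, QB l → (B l).Infinite) (hBX : ∀ l, QB l → B l ⊆ X) :
    ∃ I : Set V, X' ⊆ I ∧ I ⊆ X ∧ Jn N Y I ∧ (∀ m, QF m → (F m ∩ I).Nonempty) ∧
      ∀ l, QB l → (B l ∩ I).Nonempty := by
  set Q' : ℕ → Prop := fun m => QF m ∧ Disjoint (F m) X' with hQ'
  choose nxt n1 n2 n3 n4 using fun (s : Se X F Q') (m : ℕ) =>
    Se.next (fun m hm => hF m hm.1) (fun m hm => hFX m hm.1) B QB s m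
  let s0 : Se X F Q' := ⟨∅, ∅, finite_empty, finite_empty, empty_subset _, by simp,
    fun m hm => by simpa using hFne m hm.1, by simp⟩
  let st : ℕ → Se X F Q' := fun n => Nat.rec s0 (fun n s => nxt s n) n
  have sts : ∀ n, st (n+1) = nxt (st n) n := fun n => rfl
  have mL : ∀ n m, n ≤ m → (st n).L ⊆ (st m).L := by
    intro n m h
    induction m, h using Nat.le_induction with
    | base => exact subset_rfl
    | succ m _ ih => exact ih.trans (n1 _ _)
  have mΔ : ∀ n m, n ≤ m → (st n).Δ ⊆ (st m).Δ := by
    intro n m h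
    induction m, h using Nat.le_induction with
    | base => exact subset_rfl
    | succ m _ ih => exact ih.trans (n2 _ _)
  set L : Set V := ⋃ n, (st n).L with hLdef
  set Δ : Set V := ⋃ n, (st n).Δ with hΔdef
  have LX : L ⊆ X := iUnion_subset (fun n => (st n).LX)
  have LΔ : Disjoint L Δ := by
    rw [Set.disjoint_left]
    intro y h1 h2
    obtain ⟨a, ha⟩ := mem_iUnion.1 h1
    obtain ⟨b, hb⟩ := mem_iUnion.1 h2
    exact Set.disjoint_left.1 (st (max a b)).dis (mL a _ (le_max_left _ _) ha)
      (mΔ b _ (le_max_right _ _) hb)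
  have one : ∀ f ∈ L, ∃ m, Q' m ∧ F m \ Δ = {f} := by
    intro f hf
    obtain ⟨a, ha⟩ := mem_iUnion.1 hf
    obtain ⟨m, hm, he⟩ := (st a).one f ha
    refine ⟨m, hm, ?_⟩
    apply Subset.antisymm
    · rw [← he]
      exact sdiff_subset_sdiff_right (subset_iUnion (fun n => (st n).Δ) a)
    · rw [singleton_subset_iff]
      have : f ∈ F m \ (st a).Δ := by rw [he]; rfl
      exact ⟨this.1, Set.disjoint_left.1 LΔ hf⟩
  have hitL : ∀ m, Q' m → (F m ∩ L).Nonempty := by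
    intro m hm
    obtain ⟨f, h1, h2⟩ := n3 (st m) m hm
    exact ⟨f, h1, mem_iUnion.2 ⟨m+1, h2⟩⟩
  have hfin : ∀ l, QB l → Disjoint (B l) L → (B l ∩ Δ).Finite := by
    intro l hl hd
    have h0 : ∀ k, ∃ n0, ∀ l' < k, (B l' ∩ L).Nonempty → (B l' ∩ (st n0).L).Nonempty := by
      intro k
      induction k with
      | zero => exact ⟨0, fun l' h => by omega⟩
      | succ k ih =>
        obtain ⟨n0, hn0⟩ := ih
        by_cases hk : (B k ∩ L).Nonempty
        · obtain ⟨y, hy, hyL⟩ := hk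
          obtain ⟨b, hb⟩ := mem_iUnion.1 hyL
          refine ⟨max n0 b, fun l' hl' hne => ?_⟩
          rcases Nat.lt_succ_iff_lt_or_eq.1 hl' with h | h
          · exact (hn0 l' h hne).mono (inter_subset_inter_right _ (mL _ _ (le_max_left _ _)))
          · subst h
            exact ⟨y, hy, mL _ _ (le_max_right _ _) hb⟩
        · refine ⟨n0, fun l' hl' hne => ?_⟩
          rcases Nat.lt_succ_iff_lt_or_eq.1 hl' with h | h
          · exact hn0 l' h hne
          · subst h; exact absurd hne hk
    obtain ⟨n0, hn0⟩ := h0 l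
    refine (st n0).Δfin.subset ?_
    rintro y ⟨hy, hyΔ⟩
    obtain ⟨b, hb⟩ := mem_iUnion.1 hyΔ
    have : ∀ n, n0 ≤ n → y ∈ (st n).Δ → y ∈ (st n0).Δ := by
      intro n hn
      induction n, hn using Nat.le_induction with
      | base => exact id
      | succ n hn ih =>
        intro hyn
        apply ih
        by_contra hc
        obtain ⟨l', h1, h2, h3, z, h4, h5⟩ := n4 (st n) n l hl
          (hd.mono_right (subset_iUnion (fun n => (st n).L) (n+1))) y hy hyn hc
        obtain ⟨w, hw1, hw2⟩ := hn0 l' h1 ⟨z, h4, mem_iUnion.2 ⟨n+1, h5⟩⟩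
        exact Set.disjoint_left.1 h3 hw1 (mL _ _ hn hw2)
    exact this (max n0 b) (le_max_left _ _) (mΔ _ _ (le_max_right _ _) hb)
  have hFE2 : FE N Y (X' ∪ L) ((X \ Δ) \ (X' ∪ L)) := by
    intro H hH
    have h1 : Jn N Y (X' ∪ ↑H) := hFE H (fun y hy => (hH hy).1.1)
    refine (nested hN h1 (L := L) ?_).mono ?_
    · intro f hf
      obtain ⟨m, hm, he⟩ := one f hf
      refine hon m hm.1 _ f ?_ ?_
      · exact union_subset (union_subset hX' (fun y hy => (hH hy).1.1)) LX
      · apply Subset.antisymm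
        · rintro y ⟨h2, h3⟩
          rw [← he]
          refine ⟨h3, fun h4 => ?_⟩
          rcases h2 with (h2 | h2) | h2
          · exact Set.disjoint_left.1 hm.2 h3 h2
          · exact (hH h2).1.2 h4
          · exact Set.disjoint_left.1 LΔ h2 h4
        · rw [singleton_subset_iff]
          have : f ∈ F m \ Δ := by rw [he]; rfl
          exact ⟨Or.inr hf, this.1⟩
    · intro y hy
      simp only [mem_union] at hy ⊢
      tauto
  obtain ⟨I, i1, i2, i3, i4⟩ := hitting hN hFE2 disjoint_sdiff_self_right
    (fun l => QB l ∧ Disjoint (B l) (X' ∪ L)) B (by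
      rintro l ⟨hl, hd⟩
      have h1 := hfin l hl (hd.mono_right subset_union_right)
      refine ((hB l hl).sdiff h1).mono ?_
      rintro y ⟨hy, hy'⟩
      exact ⟨hy, ⟨hBX l hl hy, fun h => hy' ⟨hy, h⟩⟩, Set.disjoint_left.1 hd hy⟩)
  refine ⟨I, subset_union_left.trans i1, ?_, i3, ?_, ?_⟩
  · exact i2.trans (union_subset (union_subset hX' LX) (sdiff_subset.trans sdiff_subset))
  · intro m hm
    by_cases hd : Disjoint (F m) X'
    · exact (hitL m ⟨hm, hd⟩).mono (inter_subset_inter_right _ (subset_union_right.trans i1))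
    · rw [Set.not_disjoint_iff_nonempty_inter] at hd
      exact hd.mono (inter_subset_inter_right _ (subset_union_left.trans i1))
  · intro l hl
    by_cases hd : Disjoint (B l) (X' ∪ L)
    · exact i4 l ⟨hl, hd⟩
    · rw [Set.not_disjoint_iff_nonempty_inter] at hd
      exact hd.mono (inter_subset_inter_right _ i1)

lemma enum_family {𝓕 : Set (Set V)} (h : 𝓕.Countable) :
    ∃ (F : ℕ → Set V) (Q : ℕ → Prop), (∀ m, Q m → F m ∈ 𝓕) ∧ ∀ S ∈ 𝓕, ∃ m, Q m ∧ F m = S := by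
  obtain ⟨F, hF⟩ := (h.insert ∅).exists_eq_range ⟨∅, mem_insert _ _⟩
  refine ⟨F, fun m => F m ∈ 𝓕, fun m h => h, fun S hS => ?_⟩
  have : S ∈ range F := hF ▸ mem_insert_of_mem _ hS
  obtain ⟨m, rfl⟩ := this
  exact ⟨m, hS, rfl⟩

theorem selection' [Countable V] [Nonempty V] {N : V → V → Prop} (hN : ∀ x, N x x) {Y X X' : Set V}
    (hX' : X' ⊆ X) (hFE : FE N Y X' X) (𝓕 : Set (Set V)) (h𝓕 : 𝓕.Countable)
    (hF : ∀ F ∈ 𝓕, F.Finite ∧ F.Nonempty ∧ F ⊆ X ∧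
      ∀ A f, A ⊆ X → A ∩ F = {f} → ∃ T τ, Honest N Y A f T τ)
    (𝓑 : Set (Set V)) (h𝓑 : 𝓑.Countable) (hB : ∀ B ∈ 𝓑, B.Infinite ∧ B ⊆ X) :
    ∃ I : Set V, X' ⊆ I ∧ I ⊆ X ∧ Jn N Y I ∧ (∀ F ∈ 𝓕, (F ∩ I).Nonempty) ∧
      ∀ B ∈ 𝓑, (B ∩ I).Nonempty := by
  obtain ⟨F, QF, f1, f2⟩ := enum_family h𝓕
  obtain ⟨B, QB, b1, b2⟩ := enum_family h𝓑
  obtain ⟨I, i1, i2, i3, i4, i5⟩ := selection hN hX' hFE F QF (fun m hm => (hF _ (f1 m hm)).1)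
    (fun m hm => (hF _ (f1 m hm)).2.1) (fun m hm => (hF _ (f1 m hm)).2.2.1)
    (fun m hm => (hF _ (f1 m hm)).2.2.2) B QB (fun l hl => (hB _ (b1 l hl)).1)
    (fun l hl => (hB _ (b1 l hl)).2)
  refine ⟨I, i1, i2, i3, ?_, ?_⟩
  · intro S hS
    obtain ⟨m, hm, rfl⟩ := f2 S hS
    exact i4 m hm
  · intro S hS
    obtain ⟨m, hm, rfl⟩ := b2 S hS
    exact i5 m hm

end QFW

namespace QFW
open Set

/-- the (reversed) web of the digraph `E` with the vertex `w` isolated. -/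
def Rw (E : Set (V × V)) (w a b : V) : Prop := a = b ∨ ((b, a) ∈ E ∧ a ≠ w ∧ b ≠ w)

def Yr (E : Set (V × V)) (r : V) : Set V := {y | y = r ∨ (r, y) ∈ E}

lemma Rw_refl (E : Set (V × V)) (w x : V) : Rw E w x x := Or.inl rfl

lemma Rw_right {E : Set (V × V)} {w x : V} (h : Rw E w x w) : x = w := by
  rcases h with h | h
  · exact h
  · exact absurd rfl h.2.2

lemma Rw_left {E : Set (V × V)} {w x : V} (h : Rw E w w x) : x = w := by
  rcases h with h | h
  · exact h.symm
  · exact absurd rfl h.2.1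

/-- possible successors of `v` in linkages of `O`. -/
def Bs (E : Set (V × V)) (w : V) (Y : Set V) (v : V) (O : Set V) : Set V :=
  {b | ∃ σ, Lk (Rw E w) Y O σ ∧ σ v = b}

theorem honest_core {E : Set (V × V)} {Y A O : Set V} {v w f : V} (hvY : v ∉ Y) (hwv : w ≠ v)
    (hvv : (v, v) ∉ E) (hA : A ⊆ {x | (x, v) ∈ E}) (hBf : Bs E w Y v O ∩ A = {f})
    (hvB : v ∉ Bs E w Y v O) {π : V → V} (hπ : Lk (Rw E w) Y O π) (hπv : π v = f) :
    ∃ T : Set V, v ∉ T ∧ w ∉ T ∧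
      (∀ y, y ∉ Y → y ∉ T → y ≠ v → y ≠ w → π y ≠ v ∧ π y ≠ w ∧ π y ∉ A ∧
        ∀ t ∈ T, ¬ Rw E v t (π y)) ∧
      (∀ t ∈ T, ¬ Rw E v t f ∧ ¬ Rw E v t v) ∧
      ∀ z, z ≠ w → z ∉ O → (∀ y, y ∉ Y → π y ≠ z) → z ∉ A ∧ ∀ t ∈ T, ¬ Rw E v t z := by
  have hfA : f ∈ A := by
    have : f ∈ Bs E w Y v O ∩ A := by rw [hBf]; rfl
    exact this.2
  have hvA : v ∉ A := fun h => hvv (hA h)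
  have hfv : f ≠ v := fun h => hvA (h ▸ hfA)
  have hfw : f ≠ w := by
    intro h
    have h1 := hπ.adj v hvY
    rw [hπv, h] at h1
    exact hwv (Rw_right h1).symm
  have hfO : f ∉ O := hπv ▸ hπ.avoid v hvY
  set N' : V → V → Prop := fun a b => Rw E w a b ∧ (a = v → b ∈ A \ {f} ∨ b = v) with hN'
  set Ar := Rch N' Yᶜ v π with hAr
  have hArY : Ar ⊆ Yᶜ := Rch.sub hvY
  have hclos : ∀ a, a ∈ Ar → a ≠ w → ∀ b, N' a b → b ∉ O →
      ∃ a' ∈ Ar \ {v, w}, π a' = b := by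
    intro a ha haw b hab hb
    by_cases hi : ∀ y ∈ Yᶜ, y ≠ v → π y ≠ b
    · exfalso
      obtain ⟨σ, s1, s2, s3, s4, s5⟩ := Rch.aug (u0 := v) (D := Yᶜ) hvY
        (hπ.inj.mono sdiff_subset) ha hab hi
      have hσ : Lk (Rw E w) Y O σ := by
        refine ⟨s1, ?_, ?_, hπ.noray.congr_finite s2⟩
        · intro y hy
          rcases s3 y hy with h | h
          · rw [h]; exact hπ.adj y hy
          · exact h.1
        · intro y hy
          rcases s5 y hy with h | ⟨z, hz, _, h⟩
          · rw [h]; exact hb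
          · rw [h]; exact hπ.avoid z hz
      rcases s4.2 rfl with h | h
      · have : σ v ∈ Bs E w Y v O ∩ A := ⟨⟨σ, hσ, rfl⟩, h.1⟩
        rw [hBf] at this
        exact h.2 this
      · exact hvB ⟨σ, hσ, h⟩
    · push Not at hi
      obtain ⟨y, hy, hyv, hyb⟩ := hi
      refine ⟨y, ⟨Rch.step ha hy hyv (by rw [hyb]; exact hab), ?_⟩, hyb⟩
      rintro (h | h)
      · exact hyv h
      · have h' : y = w := h
        have h1 := hπ.adj y hy
        rw [h'] at h1
        have h2 := Rw_left h1
        rw [h', h2] at hyb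
        have h3 := hab.1
        rw [← hyb] at h3
        exact haw (Rw_right h3)
  have hcT : ∀ t ∈ Ar \ {v, w}, ∀ b, b ≠ w → Rw E v t b → b ∉ O → ∃ a' ∈ Ar \ {v, w}, π a' = b := by
    intro t ht b hbw htb hb
    have htv : t ≠ v := fun h => ht.2 (Or.inl h)
    have htw : t ≠ w := fun h => ht.2 (Or.inr h)
    refine hclos t ht.1 htw b ⟨?_, fun h => absurd h htv⟩ hb
    rcases htb with h | h
    · exact Or.inl h
    · exact Or.inr ⟨h.1, htw, hbw⟩
  have hcA : ∀ b ∈ A, b ≠ f → b ≠ w → b ∉ O → ∃ a' ∈ Ar \ {v, w}, π a' = b := by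
    intro b hb hbf hbw hbO
    exact hclos v Rch.base hwv.symm b ⟨Or.inr ⟨hA hb, hwv.symm, hbw⟩, fun _ => Or.inl ⟨hb, hbf⟩⟩ hbO
  refine ⟨Ar \ {v, w}, fun h => h.2 (Or.inl rfl), fun h => h.2 (Or.inr rfl), ?_, ?_, ?_⟩
  · intro y hy hyT hyv hyw
    have hno : ∀ a' ∈ Ar \ {v, w}, π a' ≠ π y := by
      intro a' ha' h
      exact hyT (hπ.inj (hArY ha'.1) hy h ▸ ha')
    have hyO := hπ.avoid y hy
    have hyw' : π y ≠ w := by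
      intro h
      have h1 := hπ.adj y hy
      rw [h] at h1
      exact hyw (Rw_right h1)
    refine ⟨?_, hyw', ?_, ?_⟩
    · intro h
      obtain ⟨a', h1, h2⟩ := hclos v Rch.base hwv.symm v ⟨Or.inl rfl, fun _ => Or.inr rfl⟩
        (h ▸ hyO)
      exact hno a' h1 (h2.trans h.symm)
    · intro h
      have hyf : π y ≠ f := fun h1 => hyv (hπ.inj hy hvY (h1.trans hπv.symm))
      obtain ⟨a', h1, h2⟩ := hcA _ h hyf hyw' hyO
      exact hno a' h1 h2
    · intro t ht h
      obtain ⟨a', h1, h2⟩ := hcT t ht _ hyw' h hyO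
      exact hno a' h1 h2
  · intro t ht
    constructor
    · intro h
      obtain ⟨a', h1, h2⟩ := hcT t ht _ hfw h hfO
      exact h1.2 (Or.inl (hπ.inj (hArY h1.1) hvY (h2.trans hπv.symm)))
    · intro h
      exact ht.2 (Or.inl (Rw_right h))
  · intro z hzw hzO hzi
    constructor
    · intro h
      obtain ⟨a', h1, h2⟩ := hcA z h (fun h1 => hzi v hvY (hπv.trans h1.symm)) hzw hzO
      exact hzi a' (hArY h1.1) h2
    · intro t ht h
      obtain ⟨a', h1, h2⟩ := hcT t ht z hzw h hzO
      exact hzi a' (hArY h1.1) h2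

open Classical in
theorem honest {E : Set (V × V)} {Y A O : Set V} {v w f : V} (hvY : v ∉ Y) (hwv : w ≠ v)
    (hww : (w, w) ∉ E) (hvv : (v, v) ∉ E) (hA : A ⊆ {x | (x, v) ∈ E})
    (hBf : Bs E w Y v O ∩ A = {f}) (hvB : v ∉ Bs E w Y v O)
    (hz : ∀ z, (z, w) ∈ E → f ∈ Bs E w Y v (insert z O)) :
    ∃ T τ, Honest (Rw E v) Y A f T τ := by
  have hfB : f ∈ Bs E w Y v O ∩ A := by rw [hBf]; rfl
  have hvA : v ∉ A := fun h => hvv (hA h)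
  have hadj : ∀ {π : V → V} {y : V}, Rw E w y (π y) → y ≠ v → π y ≠ v → Rw E v y (π y) := by
    intro π y h h1 h2
    rcases h with h | h
    · exact Or.inl h
    · exact Or.inr ⟨h.1, h1, h2⟩
  by_cases hcase : ∃ z, (z, w) ∈ E ∧ z ≠ v ∧ z ∉ O
  · obtain ⟨z, hzE, hzv, hzO⟩ := hcase
    have hzw : z ≠ w := fun h => hww (h ▸ hzE)
    obtain ⟨π, hπ, hπv⟩ := hz z hzE
    obtain ⟨T, hvT, hwT, c1, c2, c3⟩ := honest_core hvY hwv hvv hA hBf hvB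
      (hπ.mono (subset_insert _ _)) hπv
    have hzi : ∀ y, y ∉ Y → π y ≠ z := fun y hy h => hπ.avoid y hy (h ▸ mem_insert _ _)
    obtain ⟨d1, d2⟩ := c3 z hzw hzO hzi
    set τ : V → V := fun y => if y = w then z else if y = v then v else π y with hτ
    have tw : τ w = z := by simp [hτ]
    have tv : τ v = v := by simp [hτ, hwv.symm]
    have tq : ∀ y, y ≠ v → y ≠ w → τ y = π y := fun y h1 h2 => by simp [hτ, h1, h2]
    refine ⟨T, τ, ?_, ?_, ?_, ?_, fun t ht => (c2 t ht).1, hπ.noray.congr_finite ?_⟩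
    · rintro a ⟨ha, haT⟩ b ⟨hb, hbT⟩ hab
      by_cases a1 : a = w
      · by_cases b1 : b = w
        · rw [a1, b1]
        · by_cases b2 : b = v
          · rw [a1, b2, tw, tv] at hab; exact absurd hab hzv
          · rw [a1, tw, tq b b2 b1] at hab; exact absurd hab.symm (hzi b hb)
      · by_cases a2 : a = v
        · by_cases b1 : b = w
          · rw [a2, b1, tw, tv] at hab; exact absurd hab.symm hzv
          · by_cases b2 : b = v
            · rw [a2, b2]
            · rw [a2, tv, tq b b2 b1] at hab; exact absurd hab.symm (c1 b hb hbT b2 b1).1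
        · by_cases b1 : b = w
          · rw [b1, tw, tq a a2 a1] at hab; exact absurd hab (hzi a ha)
          · by_cases b2 : b = v
            · rw [b2, tv, tq a a2 a1] at hab; exact absurd hab (c1 a ha haT a2 a1).1
            · rw [tq a a2 a1, tq b b2 b1] at hab; exact hπ.inj ha hb hab
    · intro y hy hyT
      by_cases a1 : y = w
      · rw [a1, tw]; exact Or.inr ⟨hzE, hwv, hzv⟩
      · by_cases a2 : y = v
        · rw [a2, tv]; exact Or.inl rfl
        · rw [tq y a2 a1]; exact hadj (hπ.adj y hy) a2 (c1 y hy hyT a2 a1).1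
    · intro y hy hyT
      by_cases a1 : y = w
      · rw [a1, tw]; exact d1
      · by_cases a2 : y = v
        · rw [a2, tv]; exact hvA
        · rw [tq y a2 a1]; exact (c1 y hy hyT a2 a1).2.2.1
    · intro y hy hyT
      by_cases a1 : y = w
      · rw [a1, tw]; exact d2
      · by_cases a2 : y = v
        · rw [a2, tv]; exact fun t ht => (c2 t ht).2
        · rw [tq y a2 a1]; exact (c1 y hy hyT a2 a1).2.2.2
    · apply ((finite_singleton w).insert v).subset
      intro y hy
      by_contra hc
      simp only [mem_insert_iff, mem_singleton_iff, not_or] at hc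
      exact hy (tq y hc.1 hc.2)
  · push Not at hcase
    obtain ⟨π, hπ, hπv⟩ := hfB.1
    obtain ⟨T, hvT, hwT, c1, c2, c3⟩ := honest_core hvY hwv hvv hA hBf hvB hπ hπv
    set τ : V → V := fun y => if y = v then v else π y with hτ
    have tv : τ v = v := by simp [hτ]
    have tq : ∀ y, y ≠ v → τ y = π y := fun y h1 => by simp [hτ, h1]
    refine ⟨insert w T, τ, ?_, ?_, ?_, ?_, ?_, hπ.noray.congr_finite ?_⟩
    · rintro a ⟨ha, haT⟩ b ⟨hb, hbT⟩ hab
      simp only [mem_insert_iff, not_or] at haT hbT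
      by_cases a2 : a = v
      · by_cases b2 : b = v
        · rw [a2, b2]
        · rw [a2, tv, tq b b2] at hab; exact absurd hab.symm (c1 b hb hbT.2 b2 hbT.1).1
      · by_cases b2 : b = v
        · rw [b2, tv, tq a a2] at hab; exact absurd hab (c1 a ha haT.2 a2 haT.1).1
        · rw [tq a a2, tq b b2] at hab; exact hπ.inj ha hb hab
    · intro y hy hyT
      simp only [mem_insert_iff, not_or] at hyT
      by_cases a2 : y = v
      · rw [a2, tv]; exact Or.inl rfl
      · rw [tq y a2]; exact hadj (hπ.adj y hy) a2 (c1 y hy hyT.2 a2 hyT.1).1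
    · intro y hy hyT
      simp only [mem_insert_iff, not_or] at hyT
      by_cases a2 : y = v
      · rw [a2, tv]; exact hvA
      · rw [tq y a2]; exact (c1 y hy hyT.2 a2 hyT.1).2.2.1
    · intro y hy hyT
      simp only [mem_insert_iff, not_or] at hyT
      rintro t (rfl | ht) h
      · by_cases a2 : y = v
        · rw [a2, tv] at h; exact hwv (Rw_right h)
        · rw [tq y a2] at h
          have h4 := c1 y hy hyT.2 a2 hyT.1
          rcases h with h | h
          · exact h4.2.1 h.symm
          · exact hπ.avoid y hy (hcase _ h.1 h.2.2)
      · by_cases a2 : y = v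
        · rw [a2, tv] at h; exact (c2 t ht).2 h
        · rw [tq y a2] at h; exact (c1 y hy hyT.2 a2 hyT.1).2.2.2 t ht h
    · rintro t (rfl | ht) h
      · have hfO : f ∉ O := hπv ▸ hπ.avoid v hvY
        rcases h with h | h
        · have h1 := hπ.adj v hvY
          rw [hπv, ← h] at h1
          exact hwv (Rw_right h1).symm
        · exact hfO (hcase _ h.1 h.2.2)
      · exact (c2 t ht).1 h
    · apply (finite_singleton v).subset
      intro y hy
      by_contra hc
      exact hy (tq y hc)

end QFW

namespace QFW
open Set

section paths
variable {E : Set (V × V)}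

lemma dp_edge (p : Dipath E) {i : ℕ} {a b : V} (h1 : p.verts[i]? = some a)
    (h2 : p.verts[i+1]? = some b) : (a, b) ∈ E := by
  have hc : List.IsChain (fun a b => (a, b) ∈ E) p.verts := p.chain
  rw [List.isChain_iff_getElem] at hc
  rw [List.getElem?_eq_some_iff] at h1 h2
  obtain ⟨h1, rfl⟩ := h1
  obtain ⟨h2, rfl⟩ := h2
  exact hc i h2

lemma dp_inj (p : Dipath E) {i j : ℕ} {a : V} (h1 : p.verts[i]? = some a)
    (h2 : p.verts[j]? = some a) : i = j := by
  have hn : p.verts.Nodup := p.nodup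
  have hi : i < p.verts.length := (List.getElem?_eq_some_iff.1 h1).1
  exact (List.getElem?_inj hi hn).1 (h1.trans h2.symm)

lemma dp_len (p : Dipath E) : p.verts.length = p.rest.length + 1 := by
  simp [Dipath.verts]

lemma dp_start (p : Dipath E) : p.verts[0]? = some p.start := by simp [Dipath.verts]

lemma dp_last (p : Dipath E) : p.verts[p.rest.length]? = some p.last := by
  unfold Dipath.last Dipath.verts
  rw [← List.getLast?_eq_some_getLast, List.getLast?_eq_getElem?]
  simp

lemma dp_lastEdge (p : Dipath E) (a b : V) : p.lastEdge? = some (a, b) ↔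
    ∃ n, p.rest.length = n + 1 ∧ p.verts[n]? = some a ∧ p.verts[n+1]? = some b := by
  have hl : p.edges.length = p.rest.length := by
    simp [Dipath.edges, List.length_zip, dp_len]
  have hr : ∀ n, p.verts[n+1]? = p.rest[n]? := fun n => by simp [Dipath.verts]
  unfold Dipath.lastEdge?
  rw [List.getLast?_eq_getElem?, hl]
  unfold Dipath.edges
  rw [List.getElem?_zip_eq_some]
  constructor
  · rintro ⟨h1, h2⟩
    have h3 := (List.getElem?_eq_some_iff.1 h2).1
    refine ⟨p.rest.length - 1, by omega, h1, ?_⟩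
    rw [hr]; exact h2
  · rintro ⟨n, hn, h1, h2⟩
    rw [hn]
    rw [hr] at h2
    exact ⟨h1, h2⟩

lemma dp_supp (p : Dipath E) {i : ℕ} {a : V} (h1 : p.verts[i]? = some a) : a ∈ p.support :=
  List.mem_of_getElem? h1

end paths

open Classical in
theorem toLk {E : Set (V × V)} {r w : V} (hwr : w ≠ r) {I : Set (V × V)} (hI : I ∈ GSet E r w) :
    Jn (Rw E w) (Yr E r) {o | (o, w) ∈ I} := by
  obtain ⟨P, ⟨hP1, hP2⟩, rfl⟩ := hI
  have hdis : ∀ p ∈ P, ∀ q ∈ P, ∀ a, a ∈ p.support → a ∈ q.support → a ≠ r → a ≠ w → p = q := by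
    intro p hp q hq a h1 h2 har haw
    by_contra hpq
    rcases hP2 hp hq hpq ⟨h1, h2⟩ with h | h
    · exact har h
    · exact haw h
  -- predecessor relation
  set Pr : Dipath E → V → V → Prop := fun p a b =>
    ∃ i, p.verts[i]? = some a ∧ p.verts[i+1]? = some b with hPr
  have prE : ∀ p a b, Pr p a b → (a, b) ∈ E := fun p a b ⟨i, h1, h2⟩ => dp_edge p h1 h2
  have prw : ∀ p ∈ P, ∀ a b, Pr p a b → a ≠ w := by
    rintro p hp a b ⟨i, h1, h2⟩ rfl
    have h3 := dp_last p
    rw [(hP1 p hp).2] at h3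
    have h4 := dp_inj p h1 h3
    have h5 := (List.getElem?_eq_some_iff.1 h2).1
    rw [dp_len] at h5
    omega
  have prex : ∀ p ∈ P, ∀ b ∈ p.support, b ≠ r → ∃ a, Pr p a b := by
    intro p hp b hb hbr
    obtain ⟨i, hi⟩ := List.mem_iff_getElem?.1 hb
    rcases i with _ | i
    · rw [dp_start, (hP1 p hp).1] at hi
      exact absurd (Option.some.inj hi).symm hbr
    · have h1 := (List.getElem?_eq_some_iff.1 hi).1
      exact ⟨p.verts[i], i, List.getElem?_eq_getElem (by omega), hi⟩
  have pr1 : ∀ p a b, Pr p a b → a ∈ p.support := fun p a b ⟨i, h1, h2⟩ => dp_supp p h1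
  have pr2 : ∀ p a b, Pr p a b → b ∈ p.support := fun p a b ⟨i, h1, h2⟩ => dp_supp p h2
  have prinj : ∀ p ∈ P, ∀ q ∈ P, ∀ a b c, Pr p a b → Pr q a c → a ≠ r → b = c := by
    intro p hp q hq a b c h1 h2 har
    have := hdis p hp q hq a (pr1 _ _ _ h1) (pr1 _ _ _ h2) har (prw p hp a b h1)
    subst this
    obtain ⟨i, h3, h4⟩ := h1
    obtain ⟨j, h5, h6⟩ := h2
    have := dp_inj p h3 h5
    subst this
    exact Option.some.inj (h4.symm.trans h6)
  set M : V → V → Prop := fun a b => b ≠ w ∧ ∃ p ∈ P, Pr p a b with hM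
  set σ : V → V := fun b => if h : ∃ a, M a b then h.choose else b with hσ
  have s1 : ∀ b, (∃ a, M a b) → M (σ b) b := by
    intro b h
    simp only [hσ, h, dif_pos]
    exact h.choose_spec
  have s2 : ∀ b, (¬ ∃ a, M a b) → σ b = b := by
    intro b h
    simp only [hσ, h, dif_neg, not_false_eq_true]
  have hnr : ∀ a b, M a b → b ∉ Yr E r → a ≠ r := by
    rintro a b ⟨_, p, hp, h⟩ hb rfl
    exact hb (Or.inr (prE _ _ _ h))
  have hback : ∀ a b, M a b → b ∉ Yr E r → ∃ c, M c a := by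
    intro a b hab hb
    have har := hnr a b hab hb
    obtain ⟨_, p, hp, h⟩ := hab
    obtain ⟨c, hc⟩ := prex p hp a (pr1 _ _ _ h) har
    exact ⟨c, prw p hp a b h, p, hp, hc⟩
  refine ⟨σ, ?_, ?_, ?_, ?_⟩
  · intro a ha b hb hab
    by_cases h1 : ∃ c, M c a <;> by_cases h2 : ∃ c, M c b
    · have m1 := s1 a h1
      have m2 := s1 b h2
      have har := hnr _ _ m1 ha
      rw [← hab] at m2
      obtain ⟨_, p, hp, h3⟩ := m1
      obtain ⟨_, q, hq, h4⟩ := m2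
      exact prinj p hp q hq _ _ _ h3 h4 har
    · have m1 := s1 a h1
      rw [hab, s2 b h2] at m1
      exact absurd (hback _ _ m1 ha) h2
    · have m2 := s1 b h2
      rw [← hab, s2 a h1] at m2
      exact absurd (hback _ _ m2 hb) h1
    · rwa [s2 a h1, s2 b h2] at hab
  · intro b hb
    by_cases h1 : ∃ c, M c b
    · obtain ⟨h3, p, hp, h⟩ := s1 b h1
      exact Or.inr ⟨prE _ _ _ h, h3, prw p hp _ _ h⟩
    · rw [s2 b h1]; exact Or.inl rfl
  · rintro b hb ⟨p, hp, hpe⟩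
    rw [dp_lastEdge] at hpe
    obtain ⟨n, _, hn⟩ := hpe
    have hpr : Pr p (σ b) w := ⟨n, hn⟩
    by_cases h1 : ∃ c, M c b
    · have m1 := s1 b h1
      have har := hnr _ _ m1 hb
      obtain ⟨h3, q, hq, h⟩ := m1
      exact h3 (prinj q hq p hp _ _ _ h hpr har)
    · rw [s2 b h1] at hpr
      obtain ⟨c, hc⟩ := prex p hp b (pr1 _ _ _ hpr) (fun h => hb (Or.inl h))
      exact h1 ⟨c, prw p hp _ _ hpr, p, hp, hc⟩
  · intro x hx hY hs
    have hall : ∀ n, ∃ c, M c (x n) := by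
      intro n
      by_contra hc
      have := hs n
      rw [s2 _ hc] at this
      have := hx this
      omega
    obtain ⟨h3, p, hp, h⟩ := s1 _ (hall 0)
    have hsup : ∀ n, x n ∈ p.support := by
      intro n
      induction n with
      | zero => exact pr2 _ _ _ h
      | succ n ih =>
        obtain ⟨h4, q, hq, h'⟩ := s1 _ (hall n)
        have := hdis p hp q hq _ ih (pr2 _ _ _ h') (fun h => hY n (Or.inl h)) h4
        subst this
        rw [hs n]; exact pr1 _ _ _ h'
    exact Set.infinite_of_injective_forall_mem hx hsup (List.finite_toSet p.verts)

end QFW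

namespace QFW
open Set

lemma mk_path {E : Set (V × V)} {r w o : V} {l m : List V}
    (hc : List.IsChain (fun a b => (a, b) ∈ E) (r :: l)) (hn : (r :: l).Nodup)
    (hm : r :: l = m ++ [o, w]) :
    ∃ p : Dipath E, p.start = r ∧ p.last = w ∧ p.lastEdge? = some (o, w) ∧
      p.support = {x | x ∈ r :: l} := by
  let p : Dipath E := ⟨r, l, hc, hn⟩
  have hv : p.verts = m ++ [o, w] := hm
  have hl : p.rest.length = m.length + 1 := by
    have h1 := dp_len p
    rw [hv] at h1
    simp at h1
    omega
  have h2 : p.verts[m.length + 1]? = some w := by rw [hv]; simp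
  refine ⟨p, rfl, ?_, ?_, rfl⟩
  · have h1 := dp_last p
    rw [hl, h2] at h1
    exact (Option.some.inj h1).symm
  · rw [dp_lastEdge]
    refine ⟨m.length, hl, ?_, h2⟩
    rw [hv]; simp

lemma path_seq {E : Set (V × V)} {r w o : V} (f : ℕ → V) (k : ℕ) (hf0 : f 0 = o)
    (hinj : ∀ i ≤ k, ∀ j ≤ k, f i = f j → i = j) (hw : ∀ i ≤ k, f i ≠ w) (hr : ∀ i ≤ k, f i ≠ r)
    (hE : ∀ i < k, (f (i+1), f i) ∈ E) (how : (o, w) ∈ E) (hrk : (r, f k) ∈ E) (hwr : w ≠ r) :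
    ∃ p : Dipath E, p.start = r ∧ p.last = w ∧ p.lastEdge? = some (o, w) ∧
      ∀ x ∈ p.support, x = r ∨ x = w ∨ ∃ i ≤ k, x = f i := by
  have key : ∀ i ≤ k, ∃ l m : List V, List.IsChain (fun a b => (a, b) ∈ E) (f i :: l) ∧
      (f i :: l).Nodup ∧ f i :: l = m ++ [o, w] ∧ ∀ x ∈ f i :: l, x = w ∨ ∃ j ≤ i, x = f j := by
    intro i
    induction i with
    | zero =>
      intro _
      refine ⟨[w], [], ?_, ?_, ?_, ?_⟩
      · rw [hf0]; simpa using how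
      · have := hw 0 (by omega)
        simpa using this
      · simp [hf0]
      · intro x hx
        simp at hx
        rcases hx with h | h
        · exact Or.inr ⟨0, le_rfl, h⟩
        · exact Or.inl h
    | succ i ih =>
      intro hi
      obtain ⟨l, m, h1, h2, h3, h4⟩ := ih (by omega)
      refine ⟨f i :: l, f (i+1) :: m, ?_, ?_, ?_, ?_⟩
      · exact List.isChain_cons_cons.2 ⟨hE i (by omega), h1⟩
      · refine List.nodup_cons.2 ⟨?_, h2⟩
        intro hx
        rcases h4 _ hx with h | ⟨j, hj, h⟩
        · exact hw _ hi h
        · have := hinj _ hi _ (by omega) h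
          omega
      · rw [h3]; rfl
      · intro x hx
        rcases List.mem_cons.1 hx with h | h
        · exact Or.inr ⟨i+1, le_rfl, h⟩
        · rcases h4 x h with h | ⟨j, hj, h⟩
          · exact Or.inl h
          · exact Or.inr ⟨j, by omega, h⟩
  obtain ⟨l, m, h1, h2, h3, h4⟩ := key k le_rfl
  have hn : (r :: f k :: l).Nodup := by
    refine List.nodup_cons.2 ⟨?_, h2⟩
    intro hx
    rcases h4 _ hx with h | ⟨j, hj, h⟩
    · exact hwr h.symm
    · exact hr j hj h.symm
  obtain ⟨p, hp1, hp2, hp3, hp4⟩ := mk_path (m := r :: m) (List.isChain_cons_cons.2 ⟨hrk, h1⟩) hn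
    (by rw [h3]; rfl)
  refine ⟨p, hp1, hp2, hp3, ?_⟩
  intro x hx
  rw [hp4] at hx
  rcases List.mem_cons.1 hx with h | h
  · exact Or.inl h
  · exact Or.inr (h4 x h)

open Classical in
lemma orb_path {E : Set (V × V)} {r w o : V} {O : Set V} {σ : V → V} (hwr : w ≠ r)
    (hww : (w, w) ∉ E) (h : Lk (Rw E w) (Yr E r) O σ) (ho : o ∈ O) (how : (o, w) ∈ E) :
    ∃ p : Dipath E, p.start = r ∧ p.last = w ∧ p.lastEdge? = some (o, w) ∧
      ∀ x ∈ p.support, x = r ∨ x = w ∨ x ∈ Orb (Yr E r) σ o := by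
  by_cases hor : o = r
  · subst hor
    obtain ⟨p, hp1, hp2, hp3, hp4⟩ := mk_path (E := E) (r := o) (w := w) (o := o) (l := [w]) (m := [])
      (by simpa using how) (by simpa using hwr.symm) rfl
    refine ⟨p, hp1, hp2, hp3, ?_⟩
    intro x hx
    rw [hp4] at hx
    simp at hx
    tauto
  have hex := h.reach ho
  have hlt : ∀ j < Nat.find hex, σ^[j] o ∉ Yr E r := fun j hj => Nat.find_min hex hj
  have hk : σ^[Nat.find hex] o ∈ Yr E r := Nat.find_spec hex
  generalize Nat.find hex = k at hlt hk
  have how' : o ≠ w := by rintro rfl; exact hww how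
  have hadj : ∀ i < k, Rw E w (σ^[i] o) (σ^[i+1] o) := by
    intro i hi
    rw [Function.iterate_succ_apply']
    exact h.adj _ (hlt i hi)
  have hinj : ∀ i j, i < j → j ≤ k → σ^[i] o ≠ σ^[j] o := by
    intro i
    induction i with
    | zero =>
      intro j hj hjk he
      obtain ⟨j, rfl⟩ : ∃ j', j = j' + 1 := ⟨j - 1, by omega⟩
      rw [Function.iterate_succ_apply'] at he
      exact h.avoid _ (hlt j (by omega)) (he ▸ ho)
    | succ i ih =>
      intro j hj hjk he
      obtain ⟨j, rfl⟩ : ∃ j', j = j' + 1 := ⟨j - 1, by omega⟩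
      rw [Function.iterate_succ_apply', Function.iterate_succ_apply'] at he
      exact ih j (by omega) (by omega) (h.inj (hlt i (by omega)) (hlt j (by omega)) he)
  have hw : ∀ i ≤ k, σ^[i] o ≠ w := by
    intro i
    induction i with
    | zero => intro _; exact how'
    | succ i ih =>
      intro hi he
      have := hadj i (by omega)
      rw [he] at this
      exact ih (by omega) (Rw_right this)
  have hr : ∀ i ≤ k, σ^[i] o ≠ r := by
    intro i hi
    rcases i with _ | i
    · exact hor
    · intro he
      have := hadj i (by omega)
      rw [he] at this
      rcases this with h1 | ⟨h1, _⟩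
      · exact hlt i (by omega) (Or.inl h1)
      · exact hlt i (by omega) (Or.inr h1)
  obtain ⟨p, hp1, hp2, hp3, hp4⟩ := path_seq (E := E) (r := r) (w := w) (o := o)
    (fun i => σ^[i] o) k rfl
    (by
      intro i hi j hj he
      by_contra hne
      rcases lt_or_gt_of_ne hne with h1 | h1
      · exact hinj i j h1 hj he
      · exact hinj j i h1 hi he.symm) hw hr
    (by
      intro i hi
      rcases hadj i hi with h1 | ⟨h1, _⟩
      · exact absurd h1 (hinj i (i+1) (by omega) (by omega))
      · exact h1) how
    (by
      rcases hk with h1 | h1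
      · exact absurd h1 (hr k le_rfl)
      · exact h1) hwr
  refine ⟨p, hp1, hp2, hp3, ?_⟩
  intro x hx
  rcases hp4 x hx with h1 | h1 | ⟨i, hi, h1⟩
  · exact Or.inl h1
  · exact Or.inr (Or.inl h1)
  · exact Or.inr (Or.inr ⟨i, h1, fun j hj => hlt j (by omega)⟩)

theorem ofLk {E : Set (V × V)} {r w : V} {O : Set V} (hwr : w ≠ r)
    (hww : (w, w) ∉ E) (h : Jn (Rw E w) (Yr E r) O) (hO : ∀ o ∈ O, (o, w) ∈ E) :
    {e | ∃ o ∈ O, e = (o, w)} ∈ GSet E r w := by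
  obtain ⟨σ, h⟩ := h
  have hp : ∀ o : O, ∃ p : Dipath E, p.start = r ∧ p.last = w ∧ p.lastEdge? = some (o.1, w) ∧
      ∀ x ∈ p.support, x = r ∨ x = w ∨ x ∈ Orb (Yr E r) σ o.1 :=
    fun o => orb_path hwr hww h o.2 (hO o.1 o.2)
  choose p hp1 hp2 hp3 hp4 using hp
  refine ⟨range p, ⟨?_, ?_⟩, ?_⟩
  · rintro _ ⟨o, rfl⟩
    exact ⟨hp1 o, hp2 o⟩
  · rintro _ ⟨o, rfl⟩ _ ⟨o', rfl⟩ hne x ⟨hx1, hx2⟩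
    rcases hp4 o x hx1 with h1 | h1 | h1
    · exact Or.inl h1
    · exact Or.inr h1
    rcases hp4 o' x hx2 with h2 | h2 | h2
    · exact Or.inl h2
    · exact Or.inr h2
    exact absurd (congrArg p (Subtype.ext (h.orb_eq o.2 o'.2 h1 h2))) hne
  · ext e
    constructor
    · rintro ⟨_, ⟨o, rfl⟩, he⟩
      rw [hp3] at he
      exact ⟨o.1, o.2, (Option.some.inj he).symm⟩
    · rintro ⟨o, ho, rfl⟩
      exact ⟨p ⟨o, ho⟩, ⟨_, rfl⟩, hp3 _⟩

lemma noloop {E G : Set (V × V)} {r : V} (h : QuasiFlame E r G) {w : V} (hw : w ≠ r) :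
    (w, w) ∉ E := by
  intro hE
  obtain ⟨P, _, h2⟩ := h w hw {(w, w)} (by rintro _ rfl; exact ⟨hE, rfl⟩)
    ((finite_singleton _).subset sdiff_subset)
  have : (w, w) ∈ termEdges P := by rw [h2]; rfl
  obtain ⟨p, _, hp⟩ := this
  rw [dp_lastEdge] at hp
  obtain ⟨n, _, h3, h4⟩ := hp
  have := dp_inj p h3 h4
  omega

end QFW

namespace QFW
open Set

theorem finish {E G : Set (V × V)} {r v : V} (hGE : G ⊆ E) (hQF : QuasiFlame E r G) (hv : v ≠ r)
    {I : Set V} (hIX : ∀ x ∈ I, (x, v) ∈ E) (hGI : ∀ x, (x, v) ∈ G → x ∈ I)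
    (hJ : Jn (Rw E v) (Yr E r) I) (hrI : (r, v) ∈ E → r ∈ I)
    (hmain : ∀ w, w ≠ r → w ≠ v → ∀ H : Finset V, (∀ x ∈ H, (x, w) ∈ E) →
      ∃ σ, Lk (Rw E w) (Yr E r) ({o | (o, w) ∈ G} ∪ ↑H) σ ∧
        (v ∈ Yr E r ∨ σ v = v ∨ σ v ∈ I)) :
    ∃ Istar ∈ GSet E r v, inEdges G v ⊆ Istar ∧
      QuasiFlame (E \ (inEdges E v \ Istar)) r G := by
  classical
  refine ⟨{e | ∃ o ∈ I, e = (o, v)}, ofLk hv (noloop hQF hv) hJ hIX, ?_, ?_⟩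
  · rintro ⟨a, b⟩ ⟨h1, rfl⟩
    exact ⟨a, hGI a h1, rfl⟩
  set E' := E \ (inEdges E v \ {e | ∃ o ∈ I, e = (o, v)}) with hE'
  have mem : ∀ a b, (a, b) ∈ E' ↔ (a, b) ∈ E ∧ (b = v → a ∈ I) := by
    intro a b
    constructor
    · rintro ⟨h1, h2⟩
      refine ⟨h1, ?_⟩
      rintro rfl
      by_contra hc
      refine h2 ⟨⟨h1, rfl⟩, ?_⟩
      rintro ⟨o, ho, he⟩
      exact hc ((Prod.mk.inj he).1 ▸ ho)
    · rintro ⟨h1, h2⟩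
      refine ⟨h1, ?_⟩
      rintro ⟨⟨_, h3⟩, h4⟩
      simp at h3
      subst h3
      exact h4 ⟨a, h2 rfl, rfl⟩
  have hY : Yr E' r = Yr E r := by
    ext y
    simp only [Yr, mem_ofPred_eq, mem]
    constructor
    · rintro (h | h)
      · exact Or.inl h
      · exact Or.inr h.1
    · rintro (h | h)
      · exact Or.inl h
      · refine Or.inr ⟨h, ?_⟩
        rintro rfl
        exact hrI h
  intro w hw K hK hfin
  have hK' : K = {e | ∃ o ∈ {o | (o, w) ∈ K}, e = (o, w)} := by
    ext ⟨a, b⟩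
    constructor
    · intro h
      have := (hK h).2
      simp at this
      subst this
      exact ⟨a, h, rfl⟩
    · rintro ⟨o, ho, he⟩
      rw [he]; exact ho
  rw [hK']
  refine ofLk hw (fun h => noloop hQF hw ((mem _ _).1 h).1) ?_ (fun o ho => (hK ho).1)
  rw [hY]
  by_cases hwv : w = v
  · subst hwv
    obtain ⟨σ, h⟩ := hJ
    refine ⟨σ, h.inj, ?_, ?_, h.noray⟩
    · intro x hx
      rcases h.adj x hx with h1 | ⟨h1, h2, h3⟩
      · exact Or.inl h1
      · exact Or.inr ⟨(mem _ _).2 ⟨h1, fun h => absurd h h2⟩, h2, h3⟩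
    · intro x hx hc
      exact h.avoid x hx (((mem _ _).1 (hK hc).1).2 rfl)
  have hHf : {o | (o, w) ∈ K ∧ (o, w) ∉ G}.Finite := by
    have : {o | (o, w) ∈ K ∧ (o, w) ∉ G} ⊆ Prod.fst '' (K \ inEdges G w) := by
      rintro o ⟨h1, h2⟩
      exact ⟨(o, w), ⟨h1, fun h => h2 h.1⟩, rfl⟩
    exact (hfin.image _).subset this
  obtain ⟨σ, h, hs⟩ := hmain w hw hwv hHf.toFinset (by
    intro x hx
    rw [Finite.mem_toFinset] at hx
    exact ((mem _ _).1 (hK hx.1).1).1)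
  refine ⟨σ, h.inj, ?_, ?_, h.noray⟩
  · intro x hx
    rcases h.adj x hx with h1 | ⟨h1, h2, h3⟩
    · exact Or.inl h1
    · by_cases hxv : x = v
      · subst hxv
        rcases hs with h4 | h4 | h4
        · exact absurd h4 hx
        · exact Or.inl h4.symm
        · exact Or.inr ⟨(mem _ _).2 ⟨h1, fun _ => h4⟩, h2, h3⟩
      · exact Or.inr ⟨(mem _ _).2 ⟨h1, fun h => absurd h hxv⟩, h2, h3⟩
  · intro x hx hc
    refine h.avoid x hx ?_
    by_cases hg : (σ x, w) ∈ G
    · exact Or.inl hg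
    · refine Or.inr ?_
      rw [Finite.coe_toFinset]
      exact ⟨hc, hg⟩

lemma qf_jn {E G : Set (V × V)} {r w : V} (hGE : G ⊆ E) (hQF : QuasiFlame E r G) (hw : w ≠ r)
    (H : Finset V) (hH : ∀ x ∈ H, (x, w) ∈ E) :
    Jn (Rw E w) (Yr E r) ({o | (o, w) ∈ G} ∪ ↑H) := by
  classical
  have h := hQF w hw (inEdges G w ∪ (fun x => (x, w)) '' ↑H) (by
    rintro ⟨a, b⟩ (h | ⟨x, hx, he⟩)
    · exact ⟨hGE h.1, h.2⟩
    · rw [← he]; exact ⟨hH x hx, rfl⟩) (by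
    refine (H.finite_toSet.image (fun x => (x, w))).subset ?_
    rintro e ⟨h1 | h1, h2⟩
    · exact absurd h1 h2
    · exact h1)
  refine (toLk hw h).mono ?_
  rintro o (ho | ho)
  · exact Or.inl ⟨ho, rfl⟩
  · exact Or.inr ⟨o, ho, rfl⟩

lemma Bs_anti {E : Set (V × V)} {w v : V} {Y O O' : Set V} (h : O ⊆ O') :
    Bs E w Y v O' ⊆ Bs E w Y v O := by
  rintro b ⟨σ, h1, h2⟩
  exact ⟨σ, h1.mono h, h2⟩

theorem main [Countable V] (E : Set (V × V)) (r : V)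
    (G : Set (V × V)) (hGE : G ⊆ E) (hQF : QuasiFlame E r G)
    (v : V) (hv : v ≠ r) :
    ∃ Istar ∈ GSet E r v, inEdges G v ⊆ Istar ∧
      QuasiFlame (E \ (inEdges E v \ Istar)) r G := by
  classical
  by_cases hvY : v ∈ Yr E r
  · have hrv : (r, v) ∈ E := hvY.resolve_left hv
    refine finish (I := {x | (x, v) ∈ G} ∪ ↑({r} : Finset V)) hGE hQF hv ?_ ?_
      (qf_jn hGE hQF hv {r} (by simpa using hrv)) ?_ ?_
    · rintro x (hx | hx)
      · exact hGE hx
      · simp at hx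
        rw [hx]; exact hrv
    · intro x hx; exact Or.inl hx
    · intro _; right; simp
    · intro w hw _ H hH
      obtain ⟨σ, h⟩ := qf_jn hGE hQF hw H hH
      exact ⟨σ, h, Or.inl hvY⟩
  haveI : Nonempty V := ⟨v⟩
  have hvv := noloop hQF hv
  set O : V → Finset V → Set V := fun w H => {o | (o, w) ∈ G} ∪ ↑H with hO
  set B : V → Finset V → Set V := fun w H => Bs E w (Yr E r) v (O w H) with hB
  have hanti : ∀ w H H', H ⊆ H' → B w H' ⊆ B w H := by
    intro w H H' h
    exact Bs_anti (union_subset_union_right _ (by exact_mod_cast h))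
  have hBX : ∀ w H, v ∉ B w H → B w H ⊆ {x | (x, v) ∈ E} := by
    rintro w H h b ⟨σ, h1, h2⟩
    rcases h1.adj v hvY with h3 | h3
    · exact absurd ⟨σ, h1, h3.symm⟩ h
    · rw [h2] at h3; exact h3.1
  have hne : ∀ w H, w ≠ r → (∀ x ∈ H, (x, w) ∈ E) → (B w H).Nonempty := by
    intro w H hw hH
    obtain ⟨σ, h⟩ := qf_jn hGE hQF hw H hH
    exact ⟨σ v, σ, h, rfl⟩
  set PF : V × Finset V → Prop := fun q => q.1 ≠ r ∧ q.1 ≠ v ∧ (∀ x ∈ q.2, (x, q.1) ∈ E) ∧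
    v ∉ B q.1 q.2 ∧ (B q.1 q.2).Finite ∧
    ∀ H', q.2 ⊆ H' → (∀ x ∈ H', (x, q.1) ∈ E) → B q.1 H' = B q.1 q.2 with hPF
  set PB : V × Finset V → Prop := fun q => v ∉ B q.1 q.2 ∧ (B q.1 q.2).Infinite with hPB
  obtain ⟨I, hI1, hI2, hI3, hI4, hI5⟩ := selection' (N := Rw E v) (Y := Yr E r)
    (X := {x | (x, v) ∈ E}) (X' := {x | (x, v) ∈ G}) (Rw_refl E v) (fun x hx => hGE hx)
    (fun H hH => qf_jn hGE hQF hv H (fun x hx => hH hx))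
    ((fun q => B q.1 q.2) '' {q | PF q}) ((to_countable _).image _)
    (by
      rintro _ ⟨⟨w, H⟩, ⟨h1, h2, h3, h4, h5, h6⟩, rfl⟩
      refine ⟨h5, hne w H h1 h3, hBX w H h4, ?_⟩
      intro A f hA hAf
      refine honest (O := O w H) hvY h2 (noloop hQF h1) hvv hA ?_ h4 ?_
      · rw [inter_comm]; exact hAf
      · intro z hz
        have h7 := h6 (insert z H) (Finset.subset_insert _ _) (by
          intro x hx
          rcases Finset.mem_insert.1 hx with h | h
          · rw [h]; exact hz
          · exact h3 x h)
        have h8 : f ∈ B w H := by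
          have : f ∈ A ∩ B w H := by rw [hAf]; rfl
          exact this.2
        have h9 : O w (insert z H) = insert z (O w H) := by
          ext x; simp [hO]
        rw [← h9]
        change f ∈ B w (insert z H)
        rw [h7]; exact h8)
    ((fun q => B q.1 q.2) '' {q | PB q}) ((to_countable _).image _)
    (by
      rintro _ ⟨⟨w, H⟩, ⟨h1, h2⟩, rfl⟩
      exact ⟨h2, hBX w H h1⟩)
  refine finish hGE hQF hv (fun x hx => hI2 hx) (fun x hx => hI1 hx) hI3
    (fun h => absurd (Or.inr h) hvY) ?_
  intro w hw hwv H hH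
  have fin : ∀ b ∈ B w H, b = v ∨ b ∈ I → ∃ σ, Lk (Rw E w) (Yr E r) ({o | (o, w) ∈ G} ∪ ↑H) σ ∧
        (v ∈ Yr E r ∨ σ v = v ∨ σ v ∈ I) := by
    rintro b ⟨σ, h1, rfl⟩ h2
    exact ⟨σ, h1, Or.inr h2⟩
  by_cases hvB : v ∈ B w H
  · exact fin v hvB (Or.inl rfl)
  by_cases hex : ∃ n, ∃ H', H ⊆ H' ∧ (∀ x ∈ H', (x, w) ∈ E) ∧ (B w H').Finite ∧ (B w H').ncard = n
  · have hmin := fun m => Nat.find_min (m := m) hex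
    obtain ⟨H', h1, h2, h3, h4⟩ := Nat.find_spec hex
    obtain ⟨b, hb1, hb2⟩ := hI4 (B w H') ⟨(w, H'), ⟨hw, hwv, h2, fun h => hvB (hanti w H H' h1 h),
      h3, by
        intro H'' h5 h6
        refine eq_of_subset_of_ncard_le (hanti w H' H'' h5) ?_ h3
        by_contra hlt
        push Not at hlt
        refine hmin (B w H'').ncard (by rw [← h4]; exact hlt) ⟨H'', h1.trans h5, h6,
          h3.subset (hanti w H' H'' h5), rfl⟩⟩, rfl⟩
    exact fin b (hanti w H H' h1 hb1) (Or.inr hb2)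
  · obtain ⟨b, hb1, hb2⟩ := hI5 (B w H) ⟨(w, H), ⟨hvB, fun hf => hex ⟨_, H, subset_rfl, hH, hf, rfl⟩⟩, rfl⟩
    exact fin b hb1 (Or.inr hb2)

end QFW

/-- **Key lemma.** In a countable `G`-quasi-flame `D` there is, for each `v ≠ r`, a set
`I* ∈ 𝒢_D(v)` containing `in_G(v)` such that the restriction of `D` to `I*` at `v`
is again a `G`-quasi-flame. -/
theorem stmt16 {V : Type u} [Countable V] (E : Set (V × V)) (r : V)
    (G : Set (V × V)) (hGE : G ⊆ E) (hQF : QuasiFlame E r G)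
    (v : V) (hv : v ≠ r) :
    ∃ Istar ∈ GSet E r v, inEdges G v ⊆ Istar ∧
      QuasiFlame (E \ (inEdges E v \ Istar)) r G := by
  exact QFW.main E r G hGE hQF v hv
end
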